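/- arXiv:math/0608245 — 2 statements merged into one kernel-verified Lean document; each statement's English description precedes it below -/
import Mathlib

section
/- Let r, k, j, n be integers with n ≥ 5r+19, r+1 ≥ k ≥ 5 and j ≥ 5, and let Z be a simple graph on k vertices and j edges which contains Z_4 as a subgraph but does not contain a cycle on 4 vertices. If π = (d_1, ..., d_n) is an n-term graphic sequence with σ(π) ≥ (r−1)(2n−r) − 3(n−r) − 1 if n−r is odd, and σ(π) ≥ (r−1)(2n−r) − 3(n−r) − 2 if n−r is even, then π is potentially K_{r+1} − Z-graphic. -/
open SimpleGraph Finset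
open scoped Classical

/-- `G` contains a copy of `H` as a subgraph. -/
def ContainsCopy {α β : Type*} (G : SimpleGraph α) (H : SimpleGraph β) : Prop :=
  ∃ f : β ↪ α, ∀ u v, H.Adj u v → G.Adj (f u) (f v)

/-- `G` is a realization of the degree sequence `d` (vertex `i` has degree `d i`). -/
def IsRealization {n : ℕ} (G : SimpleGraph (Fin n)) (d : Fin n → ℕ) : Prop :=
  ∀ i, G.degree i = d i

/-- `d` is a graphic sequence: it is nonincreasing and is the degree sequence of a
simple graph on `n` vertices. -/
def IsGraphic {n : ℕ} (d : Fin n → ℕ) : Prop :=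
  Antitone d ∧ ∃ G : SimpleGraph (Fin n), IsRealization G d

/-- `d` is potentially `H`-graphic: some realization of `d` contains a copy of `H`. -/
def PotentiallyGraphic {n : ℕ} (d : Fin n → ℕ) {β : Type*} (H : SimpleGraph β) : Prop :=
  ∃ G : SimpleGraph (Fin n), IsRealization G d ∧ ContainsCopy G H

/-- The set of even integers `l` such that every `n`-term graphic sequence with degree sum
at least `l` is potentially `H`-graphic; `σ(H, n)` is the least element of this set. -/
def SigmaSet {β : Type*} (H : SimpleGraph β) (n : ℕ) : Set ℕ :=
  {l | Even l ∧ ∀ d : Fin n → ℕ, IsGraphic d → l ≤ ∑ i, d i → PotentiallyGraphic d H}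

/-- `K_m - H`: the complete graph on `m` vertices minus the edge set of a copy of `H`. -/
def KsubH (m k : ℕ) (h : k ≤ m) (H : SimpleGraph (Fin k)) : SimpleGraph (Fin m) :=
  (⊤ : SimpleGraph (Fin m)) \ H.map (Fin.castLEEmb h)

/-- `Z₄ = K₄ - P₂`: the complete graph on 4 vertices minus two adjacent edges. -/
def Z4 : SimpleGraph (Fin 4) :=
  (⊤ : SimpleGraph (Fin 4)) \ SimpleGraph.fromEdgeSet {s(0, 1), s(1, 2)}

/-- The cycle on 4 vertices. -/
def C4 : SimpleGraph (Fin 4) :=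
  SimpleGraph.fromEdgeSet {s(0, 1), s(1, 2), s(2, 3), s(3, 0)}

/-- 1-indexed access `d_i` to a finite sequence (0 outside the range). -/
def nth {n : ℕ} (d : Fin n → ℕ) (i : ℕ) : ℕ :=
  if h : i - 1 < n then d ⟨i - 1, h⟩ else 0

section Switching

variable {V : Type*} [Fintype V]

/-- Replacing the edges `ab`, `cd` by the non-edges `ac`, `bd` preserves all degrees. -/
theorem exists_switch (G : SimpleGraph V) {a b c d : V} (hab : G.Adj a b) (hcd : G.Adj c d)
    (hac : ¬ G.Adj a c) (hbd : ¬ G.Adj b d) (nac : a ≠ c) (nbd : b ≠ d) :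
    ∃ G' : SimpleGraph V, (∀ w, G'.degree w = G.degree w) ∧
      ∀ p q, G'.Adj p q ↔ (G.Adj p q ∧ ¬ (p = a ∧ q = b) ∧ ¬ (p = b ∧ q = a) ∧
        ¬ (p = c ∧ q = d) ∧ ¬ (p = d ∧ q = c)) ∨
        (p = a ∧ q = c) ∨ (p = c ∧ q = a) ∨ (p = b ∧ q = d) ∨ (p = d ∧ q = b) := by
  have nab := hab.ne
  have ncd := hcd.ne
  have nad : a ≠ d := by rintro rfl; exact hac hcd.symm
  have nbc : b ≠ c := by rintro rfl; exact hac hab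
  obtain ⟨G', hG'⟩ : ∃ G' : SimpleGraph V, ∀ p q, G'.Adj p q ↔
      (G.Adj p q ∧ ¬ (p = a ∧ q = b) ∧ ¬ (p = b ∧ q = a) ∧
        ¬ (p = c ∧ q = d) ∧ ¬ (p = d ∧ q = c)) ∨
        (p = a ∧ q = c) ∨ (p = c ∧ q = a) ∨ (p = b ∧ q = d) ∨ (p = d ∧ q = b) :=
    ⟨{ Adj := fun p q => (G.Adj p q ∧ ¬ (p = a ∧ q = b) ∧ ¬ (p = b ∧ q = a) ∧
        ¬ (p = c ∧ q = d) ∧ ¬ (p = d ∧ q = c)) ∨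
        (p = a ∧ q = c) ∨ (p = c ∧ q = a) ∨ (p = b ∧ q = d) ∨ (p = d ∧ q = b)
       symm := ⟨by
        intro p q h
        rcases h with ⟨h, h1, h2, h3, h4⟩ | h | h | h | h
        · exact Or.inl ⟨h.symm, fun k => h2 k.symm, fun k => h1 k.symm, fun k => h4 k.symm,
            fun k => h3 k.symm⟩
        · exact Or.inr (Or.inr (Or.inl h.symm))
        · exact Or.inr (Or.inl h.symm)
        · exact Or.inr (Or.inr (Or.inr (Or.inr h.symm)))
        · exact Or.inr (Or.inr (Or.inr (Or.inl h.symm)))⟩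
       loopless := ⟨by
        intro p h
        rcases h with h | ⟨rfl, h⟩ | ⟨rfl, h⟩ | ⟨rfl, h⟩ | ⟨rfl, h⟩
        · exact G.irrefl h.1
        · exact nac h
        · exact nac h.symm
        · exact nbd h
        · exact nbd h.symm⟩ }, fun p q => Iff.rfl⟩
  refine ⟨G', fun w => ?_, hG'⟩
  have key : ∀ w x y : V, G.Adj w x → ¬ G.Adj w y →
      (∀ q, G'.Adj w q ↔ (G.Adj w q ∧ q ≠ x) ∨ q = y) → G'.degree w = G.degree w := by
    intro w x y hx hy h
    have : G'.neighborFinset w = insert y ((G.neighborFinset w).erase x) := by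
      ext q
      simp only [mem_neighborFinset, h, mem_insert, mem_erase]
      tauto
    rw [← card_neighborFinset_eq_degree, this, card_insert_of_notMem (by simp [hy]),
      card_erase_of_mem (by simpa using hx), card_neighborFinset_eq_degree]
    have : 0 < G.degree w := by
      rw [degree_pos_iff_exists_adj]; exact ⟨x, hx⟩
    omega
  by_cases ha : w = a
  · subst ha
    refine key w b c hab hac fun q => ?_
    simp [hG', nab, nac, nad]
  by_cases hb : w = b
  · subst hb
    refine key w a d hab.symm hbd fun q => ?_
    simp [hG', nab.symm, nbc, nbd]
  by_cases hc : w = c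
  · subst hc
    refine key w d a hcd (fun h => hac h.symm) fun q => ?_
    simp [hG', nac.symm, nbc.symm, ncd]
  by_cases hd : w = d
  · subst hd
    refine key w c b hcd.symm (fun h => hbd h.symm) fun q => ?_
    simp [hG', nad.symm, nbd.symm, ncd.symm]
  have : G'.neighborFinset w = G.neighborFinset w := by
    ext q
    rw [mem_neighborFinset, mem_neighborFinset, hG']; simp [ha, hb, hc, hd]
  rw [← card_neighborFinset_eq_degree, this, card_neighborFinset_eq_degree]

/-- `G` has an inclusion-maximal set of common edges with `H` among all graphs with the same
degrees as `G`. -/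
def MaxMeet (G H : SimpleGraph V) : Prop :=
  ∀ G' : SimpleGraph V, (∀ w, G'.degree w = G.degree w) →
    (∀ p q, G.Adj p q → H.Adj p q → G'.Adj p q) → ∀ p q, H.Adj p q → G'.Adj p q → G.Adj p q

theorem exists_maxMeet (G H : SimpleGraph V) :
    ∃ G' : SimpleGraph V, (∀ w, G'.degree w = G.degree w) ∧ MaxMeet G' H := by
  obtain ⟨G', hG', hmax⟩ := exists_max_image
    (univ.filter fun G' : SimpleGraph V => ∀ w, G'.degree w = G.degree w)
    (fun G' => #(G' ⊓ H).edgeFinset) ⟨G, by simp⟩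
  simp only [mem_filter, mem_univ, true_and] at hG' hmax
  refine ⟨G', hG', fun G'' hdeg hsub p q hH hadj => ?_⟩
  have hle : (G' ⊓ H).edgeFinset ⊆ (G'' ⊓ H).edgeFinset := by
    rw [edgeFinset_subset_edgeFinset]
    intro p q h
    exact ⟨hsub p q h.1 h.2, h.2⟩
  have heq := eq_of_subset_of_card_le hle (hmax G'' fun w => (hdeg w).trans (hG' w))
  rw [edgeFinset_inj] at heq
  have : (G'' ⊓ H).Adj p q := ⟨hadj, hH⟩
  rw [← heq] at this
  exact this.1

/-- A configuration in which the missing edge `uv` of `H` could be gained if the edges `ux`, `vy`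
could be released. -/
structure Stuck (G H : SimpleGraph V) (S : Finset V) (u v x y : V) : Prop where
  maxMeet : MaxMeet G H
  supp : ∀ p q, H.Adj p q → p ∈ S
  huv : H.Adj u v
  not_uv : ¬ G.Adj u v
  ux : G.Adj u x
  not_ux : ¬ H.Adj u x
  vy : G.Adj v y
  not_vy : ¬ H.Adj v y

variable {G H : SimpleGraph V} {S : Finset V} {u v x y : V}

theorem Stuck.symm (h : Stuck G H S u v x y) : Stuck G H S v u y x :=
  ⟨h.maxMeet, h.supp, h.huv.symm, fun k => h.not_uv k.symm, h.vy, h.not_vy, h.ux, h.not_ux⟩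

theorem Stuck.transfer (h : Stuck G H S u v x y) {G' : SimpleGraph V}
    (hdeg : ∀ w, G'.degree w = G.degree w)
    (hsub : ∀ p q, G.Adj p q → H.Adj p q → G'.Adj p q)
    (hux : G'.Adj u x) (hvy : G'.Adj v y) : Stuck G' H S u v x y where
  maxMeet := fun G'' hd hs p q hH hadj => by
    have key := h.maxMeet G'' (fun w => (hd w).trans (hdeg w))
      (fun p q h1 h2 => hs p q (hsub p q h1 h2) h2)
    exact hsub p q (key p q hH hadj) hH
  supp := h.supp
  huv := h.huv
  not_uv := fun k => h.not_uv (h.maxMeet G' hdeg hsub u v h.huv k)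
  ux := hux
  not_ux := h.not_ux
  vy := hvy
  not_vy := h.not_vy

theorem Stuck.adj_of_ne (h : Stuck G H S u v x y) (hxy : x ≠ y) : G.Adj x y := by
  by_contra hn
  have hHs : ∀ p q, H.Adj p q → H.Adj q p := fun p q k => k.symm
  have nux := h.not_ux
  have nvy := h.not_vy
  obtain ⟨G', hd, hG'⟩ := exists_switch G h.ux h.vy h.not_uv hn h.huv.ne hxy
  refine h.not_uv (h.maxMeet G' hd (fun p q h1 h2 => ?_) u v h.huv ?_)
  · rw [hG']; grind
  · rw [hG']; simp

/-- The neighbours of a vertex outside `S` that misses `y` are all equal or adjacent to `x`. -/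
theorem Stuck.adj_or_eq (h : Stuck G H S u v x y) {z c : V} (hz : z ∉ S) (hzc : G.Adj z c)
    (hzy : ¬ G.Adj z y) (nzy : z ≠ y) : c = x ∨ G.Adj c x := by
  by_contra! hcon
  obtain ⟨ncx, hcx⟩ := hcon
  have nuv := h.huv.ne
  have nuz : u ≠ z := by rintro rfl; exact hz (h.supp _ _ h.huv)
  have hzH : ∀ q, ¬ H.Adj z q := fun q k => hz (h.supp _ _ k)
  have hHz : ∀ q, ¬ H.Adj q z := fun q k => hz (h.supp _ _ k.symm)
  have nzx : z ≠ x := by rintro rfl; exact hcx hzc.symm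
  have nzc := hzc.ne
  have hux := h.ux
  have hvy := h.vy
  have nux := h.not_ux
  have nvy := h.not_vy
  have nxy := h.not_uv
  have hHs : ∀ p q, H.Adj p q → H.Adj q p := fun p q k => k.symm
  have hGs : ∀ p q, G.Adj p q → G.Adj q p := fun p q k => k.symm
  have hHu : ∀ q, q = x → ¬ H.Adj u q ∧ ¬ H.Adj q u := by
    rintro q rfl; exact ⟨nux, fun k => nux k.symm⟩
  have hHv : ∀ q, q = y → ¬ H.Adj v q ∧ ¬ H.Adj q v := by
    rintro q rfl; exact ⟨nvy, fun k => nvy k.symm⟩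
  have fin : ∀ G' : SimpleGraph V, (∀ w, G'.degree w = G.degree w) →
      (∀ p q, G.Adj p q → H.Adj p q → G'.Adj p q) → ¬ G'.Adj u v := fun G' h1 h2 h3 =>
    h.not_uv (h.maxMeet G' h1 h2 u v h.huv h3)
  by_cases huz : G.Adj u z
  · obtain ⟨G₁, hd₁, hG₁⟩ := exists_switch G huz hvy h.not_uv hzy nuv nzy
    refine fin G₁ hd₁ (fun p q h1 h2 => ?_) ?_
    · rw [hG₁]; left; refine ⟨h1, ?_, ?_, ?_, ?_⟩ <;> rintro ⟨rfl, rfl⟩ <;> simp_all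
    · rw [hG₁]; simp
  · obtain ⟨G₁, hd₁, hG₁⟩ := exists_switch G hux hzc huz (fun k => hcx k.symm) nuz (Ne.symm ncx)
    have e1 : G₁.Adj u z := by rw [hG₁]; simp
    have e2 : G₁.Adj v y := by
      rw [hG₁]; left
      refine ⟨hvy, ?_, ?_, ?_, ?_⟩ <;> rintro ⟨rfl, rfl⟩
      · exact nuv rfl
      · exact hzy (by simp_all)
      · exact hz (h.supp _ _ h.huv.symm)
      · exact nzy rfl
    have hsub : ∀ p q, G.Adj p q → H.Adj p q → G₁.Adj p q := by
      intro p q h1 h2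
      rw [hG₁]; left; refine ⟨h1, ?_, ?_, ?_, ?_⟩ <;> rintro ⟨rfl, rfl⟩ <;> simp_all
    have e3 : ¬ G₁.Adj u v := fin G₁ hd₁ hsub
    have e4 : ¬ G₁.Adj z y := by
      rw [hG₁]
      rintro (⟨k, -⟩ | ⟨rfl, -⟩ | ⟨-, rfl⟩ | ⟨rfl, -⟩ | ⟨rfl, -⟩)
      · exact hzy k
      · exact nuz rfl
      · exact nxy hvy.symm
      · exact nzx rfl
      · exact nzc rfl
    obtain ⟨G₂, hd₂, hG₂⟩ := exists_switch G₁ e1 e2 e3 e4 nuv nzy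
    refine fin G₂ (fun w => (hd₂ w).trans (hd₁ w)) (fun p q h1 h2 => ?_) ?_
    · rw [hG₂]; left
      refine ⟨hsub p q h1 h2, ?_, ?_, ?_, ?_⟩ <;> rintro ⟨rfl, rfl⟩ <;> simp_all
    · rw [hG₂]; simp

end Switching

section NearClique

variable {V : Type*}

/-- The unordered pairs `{p, q}` and `{a, b}` coincide. -/
def SamePair (a b p q : V) : Prop := (p = a ∧ q = b) ∨ (p = b ∧ q = a)

/-- All pairs of distinct vertices of `Y` are adjacent, except possibly the edges of a triangle
with a pendant edge, or the edges of the disjoint union of a path with two edges and an edge. -/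
def NearClique (G : SimpleGraph V) (Y : Finset V) : Prop :=
  (∃ a ∈ Y, ∃ b ∈ Y, ∃ c ∈ Y, ∃ d ∈ Y, [a, b, c, d].Nodup ∧
    ∀ p ∈ Y, ∀ q ∈ Y, p ≠ q → ¬ G.Adj p q →
      SamePair a b p q ∨ SamePair a c p q ∨ SamePair b c p q ∨ SamePair a d p q) ∨
  (∃ a ∈ Y, ∃ b ∈ Y, ∃ c ∈ Y, ∃ d ∈ Y, ∃ e ∈ Y, [a, b, c, d, e].Nodup ∧
    ∀ p ∈ Y, ∀ q ∈ Y, p ≠ q → ¬ G.Adj p q →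
      SamePair a b p q ∨ SamePair a c p q ∨ SamePair d e p q)

theorem NearClique.of_triangle {G : SimpleGraph V} {Y : Finset V} {a b c : V} (hY : 4 ≤ #Y)
    (ha : a ∈ Y) (hb : b ∈ Y) (hc : c ∈ Y) (hab : a ≠ b) (hac : a ≠ c) (hbc : b ≠ c)
    (h : ∀ p ∈ Y, ∀ q ∈ Y, p ≠ q → ¬ G.Adj p q →
      (p = a ∨ p = b ∨ p = c) ∧ (q = a ∨ q = b ∨ q = c)) : NearClique G Y := by
  obtain ⟨d, hd⟩ : (Y \ {a, b, c}).Nonempty := by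
    rw [← card_pos]
    have := le_card_sdiff {a, b, c} Y
    have := card_le_three (a := a) (b := b) (c := c)
    omega
  simp only [mem_sdiff, mem_insert, mem_singleton, not_or] at hd
  refine Or.inl ⟨a, ha, b, hb, c, hc, d, hd.1, ?_, fun p hp q hq hpq hn => ?_⟩
  · simp; grind
  · have := h p hp q hq hpq hn
    unfold SamePair
    grind

theorem NearClique.of_clique {G : SimpleGraph V} {Y : Finset V} (hY : 4 ≤ #Y)
    (h : ∀ p ∈ Y, ∀ q ∈ Y, p ≠ q → G.Adj p q) : NearClique G Y := by
  obtain ⟨a, b, c, ha, hb, hc, hab, hac, hbc⟩ :=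
    (two_lt_card_iff (s := Y)).1 (by omega)
  exact .of_triangle hY ha hb hc hab hac hbc fun p hp q hq hpq hn => absurd (h p hp q hq hpq) hn

theorem NearClique.of_pair {G : SimpleGraph V} {Y : Finset V} {a b : V} (hY : 4 ≤ #Y)
    (ha : a ∈ Y) (hb : b ∈ Y) (hab : a ≠ b)
    (h : ∀ p ∈ Y, ∀ q ∈ Y, p ≠ q → ¬ G.Adj p q → (p = a ∨ p = b) ∧ (q = a ∨ q = b)) :
    NearClique G Y := by
  obtain ⟨c, hc⟩ : (Y \ {a, b}).Nonempty := by
    rw [← card_pos]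
    have := le_card_sdiff {a, b} Y
    have := card_le_two (a := a) (b := b)
    omega
  simp only [mem_sdiff, mem_insert, mem_singleton, not_or] at hc
  exact .of_triangle hY ha hb hc.1 hab (Ne.symm hc.2.1) (Ne.symm hc.2.2)
    fun p hp q hq hpq hn => by have := h p hp q hq hpq hn; tauto

end NearClique

section Far

variable {V : Type*} [Fintype V]

/-- Some graph with the same degrees as `G` has a near-clique on `r + 1` vertices. -/
def PotNear (G : SimpleGraph V) (r : ℕ) : Prop :=
  ∃ G' : SimpleGraph V, (∀ w, G'.degree w = G.degree w) ∧ ∃ Y : Finset V, #Y = r + 1 ∧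
    NearClique G' Y

theorem PotNear.of_near {G : SimpleGraph V} {r : ℕ} {Y : Finset V} (hY : #Y = r + 1)
    (h : NearClique G Y) : PotNear G r :=
  ⟨G, fun _ => rfl, Y, hY, h⟩

theorem PotNear.congr {G G' : SimpleGraph V} {r : ℕ} (h : PotNear G' r)
    (hd : ∀ w, G'.degree w = G.degree w) : PotNear G r := by
  obtain ⟨G'', hd', hY⟩ := h
  exact ⟨G'', fun w => (hd' w).trans (hd w), hY⟩

/-- `z` lies outside `S` and outside the closed neighbourhoods of `x` and `y`. -/
structure Far (G : SimpleGraph V) (S : Finset V) (x y z : V) : Prop where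
  notMem : z ∉ S
  ne_left : z ≠ x
  ne_right : z ≠ y
  not_left : ¬ G.Adj z x
  not_right : ¬ G.Adj z y

variable {G H : SimpleGraph V} {S : Finset V} {u v x y z z' : V}

theorem Stuck.adj_left (h : Stuck G H S u v x y) (hz : Far G S x y z) {c : V} (hc : G.Adj z c) :
    G.Adj c x :=
  (h.adj_or_eq hz.notMem hc hz.not_right hz.ne_right).resolve_left
    (by rintro rfl; exact hz.not_left hc)

theorem Stuck.not_adj_far (h : Stuck G H S u v x y) (hz : Far G S x y z) (hz' : Far G S x y z') :
    ¬ G.Adj z z' := fun k => hz'.not_left (h.adj_left hz k)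

/-- Distinct neighbours of two far vertices are adjacent. -/
theorem Stuck.adj_of_far (h : Stuck G H S u v x y) (hz : Far G S x y z) (hz' : Far G S x y z')
    (hne : z ≠ z') {c c' : V} (hc : G.Adj z c) (hc' : G.Adj z' c') (hcc : c ≠ c') :
    G.Adj c c' := by
  by_contra hn
  have hzz := h.not_adj_far hz hz'
  obtain ⟨G', hd, hG'⟩ := exists_switch G hc hc' hzz hn hne hcc
  have huS := h.supp _ _ h.huv
  have hvS := h.supp _ _ h.huv.symm
  have keep : ∀ p q, p ∈ S → q ≠ z → q ≠ z' → G.Adj p q → G'.Adj p q := by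
    intro p q hp hqz hqz' hpq
    rw [hG']; left
    refine ⟨hpq, ?_, ?_, ?_, ?_⟩ <;> rintro ⟨rfl, rfl⟩
    · exact hz.notMem hp
    · exact hqz rfl
    · exact hz'.notMem hp
    · exact hqz' rfl
  have hs : Stuck G' H S u v x y := by
    refine h.transfer hd (fun p q h1 h2 => keep p q (h.supp _ _ h2) ?_ ?_ h1)
      (keep _ _ huS hz.ne_left.symm hz'.ne_left.symm h.ux)
      (keep _ _ hvS hz.ne_right.symm hz'.ne_right.symm h.vy)
    · rintro rfl; exact hz.notMem (h.supp _ _ h2.symm)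
    · rintro rfl; exact hz'.notMem (h.supp _ _ h2.symm)
  have nc := hc.ne
  have nc' := hc'.ne
  have h1 : ¬ G'.Adj z y := by
    rw [hG']
    rintro (⟨k, -⟩ | ⟨-, rfl⟩ | ⟨k, -⟩ | ⟨k, -⟩ | ⟨rfl, -⟩)
    · exact hz.not_right k
    · exact hz'.ne_right rfl
    · exact hne k
    · exact nc k
    · exact hzz hc'.symm
  have h2 : ¬ G'.Adj z' x := by
    rw [hG']
    rintro (⟨k, -⟩ | ⟨k, -⟩ | ⟨-, rfl⟩ | ⟨rfl, -⟩ | ⟨k, -⟩)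
    · exact hz'.not_left k
    · exact hne k.symm
    · exact hz.ne_left rfl
    · exact hzz hc
    · exact nc' k
  have h3 : G'.Adj z z' := by rw [hG']; simp
  rcases hs.adj_or_eq hz.notMem h3 h1 hz.ne_right with k | k
  · exact hz'.ne_left k
  · exact h2 k

/-- If the neighbourhood of one far vertex is not a clique, then it contains that of any other. -/
theorem Stuck.adj_of_not_clique (h : Stuck G H S u v x y) (hz : Far G S x y z)
    (hz' : Far G S x y z') (hne : z ≠ z') {c₁ c₂ c : V} (hc₁ : G.Adj z c₁) (hc₂ : G.Adj z c₂)
    (hcc : c₁ ≠ c₂) (hn : ¬ G.Adj c₁ c₂) (hc : G.Adj z' c) : G.Adj z c := by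
  by_contra hzc
  have hzz := h.not_adj_far hz hz'
  have hc₁z : ¬ G.Adj z' c₁ := fun k => hn (h.adj_of_far hz hz' hne hc₂ k hcc.symm).symm
  have n1 : z ≠ c := by rintro rfl; exact hzz hc.symm
  have n2 : c₁ ≠ z' := by rintro rfl; exact hzz hc₁
  obtain ⟨G', hd, hG'⟩ := exists_switch G hc₁ hc.symm hzc (fun k => hc₁z k.symm) n1 n2
  have huS := h.supp _ _ h.huv
  have hvS := h.supp _ _ h.huv.symm
  have keep : ∀ p q, p ∈ S → q ≠ z → q ≠ z' → G.Adj p q → G'.Adj p q := by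
    intro p q hp hqz hqz' hpq
    rw [hG']; left
    refine ⟨hpq, ?_, ?_, ?_, ?_⟩ <;> rintro ⟨rfl, rfl⟩
    · exact hz.notMem hp
    · exact hqz rfl
    · exact hqz' rfl
    · exact hz'.notMem hp
  have hs : Stuck G' H S u v x y := by
    refine h.transfer hd (fun p q h1 h2 => keep p q (h.supp _ _ h2) ?_ ?_ h1)
      (keep _ _ huS hz.ne_left.symm hz'.ne_left.symm h.ux)
      (keep _ _ hvS hz.ne_right.symm hz'.ne_right.symm h.vy)
    · rintro rfl; exact hz.notMem (h.supp _ _ h2.symm)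
    · rintro rfl; exact hz'.notMem (h.supp _ _ h2.symm)
  have hx1 := hz.not_left
  have hy1 := hz.not_right
  have hx2 := hz'.not_left
  have hy2 := hz'.not_right
  have far_z : Far G' S x y z := by
    refine ⟨hz.notMem, hz.ne_left, hz.ne_right, ?_, ?_⟩ <;> rw [hG'] <;>
      rintro (⟨k, -⟩ | ⟨-, rfl⟩ | ⟨k, -⟩ | ⟨k, -⟩ | ⟨k, -⟩)
    · exact hx1 k
    · exact hx2 hc
    · exact n1 k
    · exact hc₁.ne k
    · exact hne k
    · exact hy1 k
    · exact hy2 hc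
    · exact n1 k
    · exact hc₁.ne k
    · exact hne k
  have far_z' : Far G' S x y z' := by
    refine ⟨hz'.notMem, hz'.ne_left, hz'.ne_right, ?_, ?_⟩ <;> rw [hG'] <;>
      rintro (⟨k, -⟩ | ⟨k, -⟩ | ⟨k, -⟩ | ⟨k, -⟩ | ⟨-, rfl⟩)
    · exact hx2 k
    · exact hne k.symm
    · exact hc.ne k
    · exact n2 k.symm
    · exact hx1 hc₁
    · exact hy2 k
    · exact hne k.symm
    · exact hc.ne k
    · exact n2 k.symm
    · exact hy1 hc₁
  have e1 : G'.Adj z' c₁ := by rw [hG']; simp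
  have e2 : G'.Adj z c₂ := by
    rw [hG']; left
    refine ⟨hc₂, ?_, ?_, ?_, ?_⟩ <;> rintro ⟨k, k'⟩
    · exact hcc k'.symm
    · exact hc₁.ne k
    · exact n1 k
    · exact hne k
  have e3 := hs.adj_of_far far_z far_z' hne e2 e1 hcc.symm
  rw [hG'] at e3
  rcases e3 with ⟨k, -⟩ | ⟨k, -⟩ | ⟨-, k⟩ | ⟨-, k⟩ | ⟨k, -⟩
  · exact hn k.symm
  · exact hc₂.ne k.symm
  · exact hc₁.ne k.symm
  · exact n2 k
  · exact hzz (k ▸ hc₂)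

theorem Stuck.potNear_of_subset (h : Stuck G H S u v x y) (hz : Far G S x y z)
    (hz' : Far G S x y z') (hne : z ≠ z') {r : ℕ} (hr : 3 ≤ r) (hdeg : r ≤ G.degree z' + 2)
    (hsub : ∀ c, G.Adj z' c → G.Adj z c) : PotNear G r := by
  obtain ⟨D, hD, hcard⟩ := exists_subset_card_eq (s := G.neighborFinset z') (n := r - 2)
    (by rw [card_neighborFinset_eq_degree]; omega)
  have hD' : ∀ p ∈ D, G.Adj z' p ∧ G.Adj z p ∧ G.Adj p x := fun p hp => by
    have : G.Adj z' p := by simpa using hD hp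
    exact ⟨this, hsub p this, h.adj_left hz' this⟩
  have hzz := h.not_adj_far hz hz'
  have hx1 := hz.not_left
  have hx2 := hz'.not_left
  have hcard' : #(insert x (insert z (insert z' D))) = r + 1 := by
    rw [card_insert_of_notMem, card_insert_of_notMem, card_insert_of_notMem, hcard]
    · omega
    · intro k; exact (hD' _ k).1.ne rfl
    · simp only [mem_insert, not_or]
      exact ⟨hne, fun k => (hD' _ k).2.1.ne rfl⟩
    · simp only [mem_insert, not_or]
      exact ⟨hz.ne_left.symm, hz'.ne_left.symm, fun k => (hD' _ k).2.2.ne rfl⟩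
  refine .of_near hcard' (.of_triangle (a := x) (b := z) (c := z') (by omega) (by simp) (by simp)
    (by simp) hz.ne_left.symm hz'.ne_left.symm hne fun p hp q hq hpq hn => ?_)
  have hGs : ∀ p q, G.Adj p q → G.Adj q p := fun p q k => k.symm
  simp only [mem_insert] at hp hq
  by_cases hpD : p ∈ D
  · by_cases hqD : q ∈ D
    · exact absurd (h.adj_of_far hz hz' hne (hD' p hpD).2.1 (hD' q hqD).1 hpq) hn
    · have := hD' p hpD
      rcases hq with rfl | rfl | rfl | k
      · exact absurd this.2.2 hn
      · exact absurd this.2.1.symm hn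
      · exact absurd this.1.symm hn
      · exact absurd k hqD
  · by_cases hqD : q ∈ D
    · have := hD' q hqD
      rcases hp with rfl | rfl | rfl | k
      · exact absurd this.2.2.symm hn
      · exact absurd this.2.1 hn
      · exact absurd this.1 hn
      · exact absurd k hpD
    · tauto

/-- Two far vertices of degree at least `r - 2` force a near-clique. -/
theorem Stuck.potNear_of_far (h : Stuck G H S u v x y) (hz : Far G S x y z)
    (hz' : Far G S x y z') (hne : z ≠ z') {r : ℕ} (hr : 3 ≤ r) (hdeg : r ≤ G.degree z + 2)
    (hdeg' : r ≤ G.degree z' + 2) : PotNear G r := by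
  by_cases hs : ∀ c, G.Adj z' c → G.Adj z c
  · exact h.potNear_of_subset hz hz' hne hr hdeg' hs
  by_cases hs' : ∀ c, G.Adj z c → G.Adj z' c
  · exact h.potNear_of_subset hz' hz hne.symm hr hdeg hs'
  have cl : ∀ c c', G.Adj z c → G.Adj z c' → c ≠ c' → G.Adj c c' := by
    intro c c' hc hc' hcc
    by_contra hn
    exact hs fun e he => h.adj_of_not_clique hz hz' hne hc hc' hcc hn he
  have cl' : ∀ c c', G.Adj z' c → G.Adj z' c' → c ≠ c' → G.Adj c c' := by
    intro c c' hc hc' hcc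
    by_contra hn
    exact hs' fun e he => h.adj_of_not_clique hz' hz hne.symm hc hc' hcc hn he
  push Not at hs hs'
  obtain ⟨e, he, hze⟩ := hs
  set C := G.neighborFinset z ∪ G.neighborFinset z' with hC
  have memC : ∀ p, p ∈ C ↔ G.Adj z p ∨ G.Adj z' p := by simp [hC]
  have clC : ∀ p ∈ C, ∀ q ∈ C, p ≠ q → G.Adj p q := by
    intro p hp q hq hpq
    rw [memC] at hp hq
    rcases hp with hp | hp <;> rcases hq with hq | hq
    · exact cl _ _ hp hq hpq
    · exact h.adj_of_far hz hz' hne hp hq hpq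
    · exact (h.adj_of_far hz hz' hne hq hp hpq.symm).symm
    · exact cl' _ _ hp hq hpq
  have xC : ∀ p ∈ C, G.Adj p x := by
    intro p hp
    rcases (memC p).1 hp with hp | hp
    · exact h.adj_left hz hp
    · exact h.adj_left hz' hp
  have eC : e ∈ C := (memC e).2 (Or.inr he)
  have hNC : G.neighborFinset z ⊆ C.erase e := by
    intro p hp
    rw [mem_neighborFinset] at hp
    rw [mem_erase, memC]
    exact ⟨by rintro rfl; exact hze hp, Or.inl hp⟩
  have hcard : G.degree z ≤ #C - 1 := by
    rw [← card_neighborFinset_eq_degree, ← card_erase_of_mem eC]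
    exact card_le_card hNC
  have posC : 0 < #C := card_pos.2 ⟨e, eC⟩
  by_cases hr' : r ≤ #C
  · obtain ⟨D, hD, hDc⟩ := exists_subset_card_eq hr'
    have hDx : #(insert x D) = r + 1 := by
      rw [card_insert_of_notMem, hDc]
      intro k; exact (xC x (hD k)).ne rfl
    refine .of_near hDx (.of_clique (by omega) ?_)
    intro p hp q hq hpq
    rw [mem_insert] at hp hq
    rcases hp with rfl | hp <;> rcases hq with rfl | hq
    · exact absurd rfl hpq
    · exact (xC _ (hD hq)).symm
    · exact xC _ (hD hp)
    · exact clC _ (hD hp) _ (hD hq) hpq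
  · have hCr : #C = r - 1 := by omega
    have heq : G.neighborFinset z = C.erase e := by
      refine eq_of_subset_of_card_le hNC ?_
      rw [card_erase_of_mem eC, card_neighborFinset_eq_degree]
      omega
    have hzC : ∀ p ∈ C, p ≠ e → G.Adj z p := by
      intro p hp hpe
      rw [← mem_neighborFinset, heq, mem_erase]
      exact ⟨hpe, hp⟩
    have zC : z ∉ C := by
      rw [memC]
      rintro (k | k)
      · exact k.ne rfl
      · exact h.not_adj_far hz' hz k
    have xC' : x ∉ C := fun k => (xC x k).ne rfl
    have hcard' : #(insert x (insert z C)) = r + 1 := by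
      rw [card_insert_of_notMem, card_insert_of_notMem zC, hCr]
      · omega
      · simp only [mem_insert, not_or]; exact ⟨hz.ne_left.symm, xC'⟩
    refine .of_near hcard' (.of_triangle (a := x) (b := z) (c := e) (by omega) (by simp) (by simp)
      (by simp [eC]) hz.ne_left.symm ?_ ?_ fun p hp q hq hpq hn => ?_)
    · rintro rfl; exact xC' eC
    · rintro rfl; exact zC eC
    · have hGs : ∀ p q, G.Adj p q → G.Adj q p := fun p q k => k.symm
      simp only [mem_insert] at hp hq
      grind

end Far

section Moves

theorem NearClique.map {V W : Type*} {G : SimpleGraph V} {G' : SimpleGraph W} {Y : Finset V}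
    (f : V ↪ W) (h : NearClique G Y)
    (hf : ∀ p ∈ Y, ∀ q ∈ Y, G.Adj p q → G'.Adj (f p) (f q)) : NearClique G' (Y.map f) := by
  rcases h with ⟨a, ha, b, hb, c, hc, d, hd, hn, h⟩ | ⟨a, ha, b, hb, c, hc, d, hd, e, he, hn, h⟩
  · refine Or.inl ⟨f a, mem_map_of_mem f ha, f b, mem_map_of_mem f hb, f c, mem_map_of_mem f hc,
      f d, mem_map_of_mem f hd, hn.map f.injective, ?_⟩
    simp only [mem_map, forall_exists_index, and_imp, forall_apply_eq_imp_iff₂]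
    intro p hp q hq hpq hG
    have := h p hp q hq (fun k => hpq (by rw [k])) (fun k => hG (hf p hp q hq k))
    simpa only [SamePair, f.injective.eq_iff] using this
  · refine Or.inr ⟨f a, mem_map_of_mem f ha, f b, mem_map_of_mem f hb, f c, mem_map_of_mem f hc,
      f d, mem_map_of_mem f hd, f e, mem_map_of_mem f he, hn.map f.injective, ?_⟩
    simp only [mem_map, forall_exists_index, and_imp, forall_apply_eq_imp_iff₂]
    intro p hp q hq hpq hG
    have := h p hp q hq (fun k => hpq (by rw [k])) (fun k => hG (hf p hp q hq k))
    simpa only [SamePair, f.injective.eq_iff] using this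

theorem NearClique.cone {V : Type*} {G : SimpleGraph V} {Y : Finset V} {v : V}
    (h : NearClique G Y) (hv : ∀ p ∈ Y, G.Adj v p) : NearClique G (insert v Y) := by
  have key : ∀ p ∈ insert v Y, ∀ q ∈ insert v Y, p ≠ q → ¬ G.Adj p q → p ∈ Y ∧ q ∈ Y := by
    intro p hp q hq hpq hG
    rw [mem_insert] at hp hq
    rcases hp with rfl | hp <;> rcases hq with rfl | hq
    · exact absurd rfl hpq
    · exact absurd (hv q hq) hG
    · exact absurd (hv p hp).symm hG
    · exact ⟨hp, hq⟩
  have hm : ∀ p ∈ Y, p ∈ insert v Y := fun p hp => mem_insert_of_mem hp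
  rcases h with ⟨a, ha, b, hb, c, hc, d, hd, hn, h⟩ | ⟨a, ha, b, hb, c, hc, d, hd, e, he, hn, h⟩
  · refine Or.inl ⟨a, hm a ha, b, hm b hb, c, hm c hc, d, hm d hd, hn, fun p hp q hq hpq hG => ?_⟩
    obtain ⟨hp, hq⟩ := key p hp q hq hpq hG
    exact h p hp q hq hpq hG
  · refine Or.inr ⟨a, hm a ha, b, hm b hb, c, hm c hc, d, hm d hd, e, hm e he, hn,
      fun p hp q hq hpq hG => ?_⟩
    obtain ⟨hp, hq⟩ := key p hp q hq hpq hG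
    exact h p hp q hq hpq hG

variable {V : Type*} [Fintype V]

/-- The first part of the Erdős–Gallai double count. -/
theorem sum_degree_le (G : SimpleGraph V) (X : Finset V) :
    ∑ w ∈ X, G.degree w ≤ #X * (#X - 1) + ∑ w ∈ Xᶜ, #(G.neighborFinset w ∩ X) := by
  have h1 : ∀ w ∈ X, G.degree w ≤ (#X - 1) + #(Xᶜ.bipartiteAbove G.Adj w) := by
    intro w hw
    have : G.neighborFinset w ⊆ X.erase w ∪ Xᶜ.bipartiteAbove G.Adj w := by
      intro q hq
      rw [mem_neighborFinset] at hq
      simp only [mem_union, mem_erase, bipartiteAbove, mem_filter, mem_compl]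
      have := hq.ne
      tauto
    calc G.degree w = #(G.neighborFinset w) := (card_neighborFinset_eq_degree _ _).symm
      _ ≤ _ := card_le_card this
      _ ≤ _ := card_union_le _ _
      _ = _ := by rw [card_erase_of_mem hw]
  calc ∑ w ∈ X, G.degree w ≤ ∑ w ∈ X, ((#X - 1) + #(Xᶜ.bipartiteAbove G.Adj w)) :=
        sum_le_sum h1
    _ = #X * (#X - 1) + ∑ w ∈ Xᶜ, #(X.bipartiteBelow G.Adj w) := by
        rw [sum_add_distrib, sum_const, smul_eq_mul,
          sum_card_bipartiteAbove_eq_sum_card_bipartiteBelow]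
    _ = _ := by
        congr 1
        refine sum_congr rfl fun w _ => congrArg card ?_
        ext q
        simp [bipartiteBelow, G.adj_comm, and_comm]

/-- A vertex can be made adjacent to any set of vertices of largest degrees. -/
theorem exists_adj_top (G : SimpleGraph V) (v : V) (Z : Finset V) (hv : v ∉ Z)
    (hZ : #Z ≤ G.degree v) (htop : ∀ z ∈ Z, ∀ w ∉ Z, w ≠ v → G.degree w ≤ G.degree z) :
    ∃ G' : SimpleGraph V, (∀ w, G'.degree w = G.degree w) ∧ ∀ z ∈ Z, G'.Adj v z := by
  obtain ⟨H, hH⟩ : ∃ H : SimpleGraph V, ∀ p q, H.Adj p q ↔ (p = v ∧ q ∈ Z) ∨ (q = v ∧ p ∈ Z) :=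
    ⟨{ Adj := fun p q => (p = v ∧ q ∈ Z) ∨ (q = v ∧ p ∈ Z)
       symm := ⟨fun p q h => h.symm⟩
       loopless := ⟨by rintro p (⟨rfl, h⟩ | ⟨rfl, h⟩) <;> exact hv h⟩ }, fun _ _ => Iff.rfl⟩
  obtain ⟨G', hd, hmax⟩ := exists_maxMeet G H
  refine ⟨G', hd, fun z hz => ?_⟩
  by_contra hvz
  have nzv : z ≠ v := by rintro rfl; exact hv hz
  obtain ⟨w, hw, hwZ⟩ : ∃ w, G'.Adj v w ∧ w ∉ Z := by
    by_contra! hcon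
    have hsub : G'.neighborFinset v ⊂ Z := by
      refine Finset.ssubset_iff_subset_ne.2 ⟨fun q hq => hcon q (by simpa using hq), fun k => ?_⟩
      rw [← k, mem_neighborFinset] at hz
      exact hvz hz
    have := card_lt_card hsub
    rw [card_neighborFinset_eq_degree, hd] at this
    omega
  have hwz : G'.degree w ≤ G'.degree z := by
    rw [hd, hd]; exact htop z hz w hwZ hw.ne.symm
  have nwz : w ≠ z := by rintro rfl; exact hwZ hz
  obtain ⟨y, hzy, hyw, nyw⟩ : ∃ y, G'.Adj z y ∧ ¬ G'.Adj w y ∧ w ≠ y := by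
    by_contra! hcon
    have hsub : (G'.neighborFinset z).erase w ⊂ (G'.neighborFinset w).erase z := by
      rw [Finset.ssubset_iff_subset_ne]
      constructor
      · intro q hq
        simp only [mem_erase, mem_neighborFinset] at hq ⊢
        refine ⟨hq.2.ne.symm, ?_⟩
        by_contra k
        exact hq.1 (hcon q hq.2 k).symm
      · intro k
        have : v ∈ (G'.neighborFinset w).erase z := by simp [nzv.symm, hw.symm]
        rw [← k] at this
        simp only [mem_erase, mem_neighborFinset] at this
        exact hvz this.2.symm
    have hlt := card_lt_card hsub
    by_cases hzw : G'.Adj z w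
    · rw [card_erase_of_mem (by simpa using hzw), card_erase_of_mem (by simpa using hzw.symm),
        card_neighborFinset_eq_degree, card_neighborFinset_eq_degree] at hlt
      omega
    · rw [erase_eq_of_notMem (by simpa using hzw),
        erase_eq_of_notMem (by simpa using fun k => hzw k.symm),
        card_neighborFinset_eq_degree, card_neighborFinset_eq_degree] at hlt
      omega
  have nyv : y ≠ v := by rintro rfl; exact hvz hzy.symm
  obtain ⟨G'', hd', hG''⟩ := exists_switch G' hw hzy hvz hyw nzv.symm nyw
  refine hvz (hmax G'' hd' (fun p q h1 h2 => ?_) v z (by simp [hH, hz]) (by rw [hG'']; simp))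
  rw [hH] at h2
  rw [hG'']; left
  refine ⟨h1, ?_, ?_, ?_, ?_⟩ <;> rintro ⟨rfl, rfl⟩ <;> simp_all

/-- A vertex of a near-clique can be exchanged for one of at least the same degree. -/
theorem NearClique.exchange {G : SimpleGraph V} {Y : Finset V} (h : NearClique G Y) {w w' : V}
    (hw : w ∈ Y) (hw' : w' ∉ Y) (hd : G.degree w ≤ G.degree w') :
    ∃ G' : SimpleGraph V, (∀ p, G'.degree p = G.degree p) ∧
      NearClique G' (insert w' (Y.erase w)) := by
  have hne : w ≠ w' := by rintro rfl; exact hw' hw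
  set A := (G.neighborFinset w \ G.neighborFinset w').erase w' with hA
  set B := (G.neighborFinset w' \ G.neighborFinset w).erase w with hB
  have hGs : ∀ p q, G.Adj p q → G.Adj q p := fun p q k => k.symm
  have memA : ∀ q, q ∈ A ↔ q ≠ w' ∧ G.Adj w q ∧ ¬ G.Adj w' q := by simp [hA]
  have memB : ∀ q, q ∈ B ↔ q ≠ w ∧ G.Adj w' q ∧ ¬ G.Adj w q := by simp [hB]
  have hAB : #A ≤ #B := by
    have e1 := card_sdiff_add_card_inter (G.neighborFinset w) (G.neighborFinset w')
    have e2 := card_sdiff_add_card_inter (G.neighborFinset w') (G.neighborFinset w)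
    rw [inter_comm] at e2
    rw [card_neighborFinset_eq_degree] at e1 e2
    by_cases hadj : G.Adj w w'
    · rw [hA, hB, card_erase_of_mem (by simp [hadj]), card_erase_of_mem (by simp [hadj.symm])]
      omega
    · rw [hA, hB, erase_eq_of_notMem (by simp [hadj]),
        erase_eq_of_notMem (by simp [hadj, G.adj_comm w' w])]
      omega
  obtain ⟨E, hE, hEc⟩ := exists_subset_card_eq hAB
  have hD : ∀ q ∈ A ∪ E, q ≠ w ∧ q ≠ w' := by
    intro q hq
    rcases mem_union.1 hq with hq | hq
    · have := (memA q).1 hq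
      exact ⟨this.2.1.ne.symm, this.1⟩
    · have := (memB q).1 (hE hq)
      exact ⟨this.1, this.2.1.ne.symm⟩
  set D := A ∪ E with hDdef
  obtain ⟨G', hG'⟩ : ∃ G' : SimpleGraph V, ∀ p q, G'.Adj p q ↔
      G.Adj (if q ∈ D then Equiv.swap w w' p else p) (if p ∈ D then Equiv.swap w w' q else q) :=
    ⟨{ Adj := fun p q => G.Adj (if q ∈ D then Equiv.swap w w' p else p)
          (if p ∈ D then Equiv.swap w w' q else q)
       symm := ⟨fun p q h => h.symm⟩
       loopless := ⟨fun p h => h.ne rfl⟩ }, fun _ _ => Iff.rfl⟩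
  have hfix : ∀ p, p ≠ w → p ≠ w' → Equiv.swap w w' p = p := fun p h1 h2 =>
    Equiv.swap_apply_of_ne_of_ne h1 h2
  have wD : w ∉ D := fun k => (hD w k).1 rfl
  have wD' : w' ∉ D := fun k => (hD w' k).2 rfl
  have adj_w : ∀ q, G'.Adj w q ↔ if q ∈ D then G.Adj w' q else G.Adj w q := by
    intro q
    rw [hG', if_neg wD]
    split_ifs <;> simp
  have adj_w' : ∀ q, G'.Adj w' q ↔ if q ∈ D then G.Adj w q else G.Adj w' q := by
    intro q
    rw [hG', if_neg wD']
    split_ifs <;> simp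
  refine ⟨G', fun p => ?_, ?_⟩
  · by_cases hpw : p = w
    · subst hpw
      have : G'.neighborFinset p = (G.neighborFinset p \ A) ∪ E := by
        ext q
        simp only [mem_neighborFinset, adj_w, mem_union, mem_sdiff]
        have := memA q
        have := memB q
        have := @hE q
        have : q ∈ D ↔ q ∈ A ∨ q ∈ E := by simp [hDdef]
        split_ifs <;> grind
      have hdis : Disjoint (G.neighborFinset p \ A) E := by
        rw [Finset.disjoint_left]
        intro q h1 h2
        have := (memB q).1 (hE h2)
        simp [this] at h1
      have hsub : A ⊆ G.neighborFinset p := fun q hq => by simpa using ((memA q).1 hq).2.1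
      have hcard := card_sdiff_add_card_eq_card hsub
      rw [← card_neighborFinset_eq_degree, this, card_union_of_disjoint hdis, hEc, hcard,
        card_neighborFinset_eq_degree]
    by_cases hpw' : p = w'
    · subst hpw'
      have : G'.neighborFinset p = (G.neighborFinset p \ E) ∪ A := by
        ext q
        simp only [mem_neighborFinset, adj_w', mem_union, mem_sdiff]
        have := memA q
        have := memB q
        have := @hE q
        have : q ∈ D ↔ q ∈ A ∨ q ∈ E := by simp [hDdef]
        split_ifs <;> grind
      have hdis : Disjoint (G.neighborFinset p \ E) A := by
        rw [Finset.disjoint_left]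
        intro q h1 h2
        have := (memA q).1 h2
        simp [this] at h1
      have hsub : E ⊆ G.neighborFinset p := fun q hq => by simpa using ((memB q).1 (hE hq)).2.1
      have hcard := card_sdiff_add_card_eq_card hsub
      rw [← card_neighborFinset_eq_degree, this, card_union_of_disjoint hdis, ← hEc, hcard,
        card_neighborFinset_eq_degree]
    by_cases hpD : p ∈ D
    · have : G'.neighborFinset p = (G.neighborFinset p).map (Equiv.swap w w').toEmbedding := by
        ext q
        rw [mem_neighborFinset, hG', if_pos hpD, hfix p hpw hpw', ite_self, mem_map_equiv,
          mem_neighborFinset, Equiv.symm_swap]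
      rw [← card_neighborFinset_eq_degree, this, card_map, card_neighborFinset_eq_degree]
    · have : G'.neighborFinset p = G.neighborFinset p := by
        ext q
        rw [mem_neighborFinset, hG', if_neg hpD, hfix p hpw hpw', ite_self, mem_neighborFinset]
      rw [← card_neighborFinset_eq_degree, this, card_neighborFinset_eq_degree]
  · have hmap : insert w' (Y.erase w) = Y.map (Equiv.swap w w').toEmbedding := by
      ext q
      rw [mem_map_equiv, Equiv.symm_swap, mem_insert, mem_erase]
      by_cases h1 : q = w
      · subst h1; simp [hne, hw']
      by_cases h2 : q = w'
      · subst h2; simp [hw]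
      rw [hfix q h1 h2]; tauto
    have main : ∀ q ∈ Y, q ≠ w → G.Adj w q → G'.Adj w' q := by
      intro q hq hqw hadj
      rw [adj_w']
      split_ifs with hqD
      · exact hadj
      · by_contra k
        exact hqD (mem_union_left _ ((memA q).2 ⟨by rintro rfl; exact hw' hq, hadj, k⟩))
    rw [hmap]
    refine h.map _ fun p hp q hq hpq => ?_
    have hpw' : p ≠ w' := by rintro rfl; exact hw' hp
    have hqw' : q ≠ w' := by rintro rfl; exact hw' hq
    simp only [Equiv.toEmbedding_apply]
    by_cases h1 : p = w
    · subst h1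
      rw [Equiv.swap_apply_left, hfix q hpq.ne.symm hqw']
      exact main q hq hpq.ne.symm hpq
    by_cases h2 : q = w
    · subst h2
      rw [Equiv.swap_apply_left, hfix p h1 hpw']
      exact (main p hp h1 hpq.symm).symm
    rw [hfix p h1 hpw', hfix q h2 hqw', hG', hfix p h1 hpw', hfix q h2 hqw', ite_self, ite_self]
    exact hpq

theorem NearClique.relocate {A B : Finset V} (hBA : B ⊆ A) : ∀ (k : ℕ) (G : SimpleGraph V)
    (Y : Finset V), NearClique G Y → #Y ≤ #B → #(Y \ A) ≤ k →
    (∀ p ∉ A, ∀ s ∈ B, G.degree p ≤ G.degree s) →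
    ∃ G' : SimpleGraph V, (∀ p, G'.degree p = G.degree p) ∧ ∃ Y' ⊆ A, #Y' = #Y ∧
      NearClique G' Y' := by
  intro k
  induction k with
  | zero =>
    intro G Y h _ hk _
    refine ⟨G, fun _ => rfl, Y, ?_, rfl, h⟩
    rwa [Nat.le_zero, card_eq_zero, sdiff_eq_empty_iff_subset] at hk
  | succ k ih =>
    intro G Y h hYB hk hd
    by_cases hYA : Y ⊆ A
    · exact ⟨G, fun _ => rfl, Y, hYA, rfl, h⟩
    obtain ⟨y, hyY, hyA⟩ := not_subset.1 hYA
    obtain ⟨s, hsB, hsY⟩ : ∃ s ∈ B, s ∉ Y := by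
      by_contra! hcon
      have hlt : #B < #Y := card_lt_card
        ⟨fun s hs => hcon s hs, fun hsub => hyA (hBA (hsub hyY))⟩
      omega
    obtain ⟨G', hd', hN⟩ := h.exchange hyY hsY (hd y hyA s hsB)
    have hcard : #(insert s (Y.erase y)) = #Y := by
      rw [card_insert_of_notMem (fun k => hsY (mem_of_mem_erase k)), card_erase_of_mem hyY]
      have := card_pos.2 ⟨y, hyY⟩
      omega
    have hcard' : #(insert s (Y.erase y) \ A) ≤ k := by
      have hsub : insert s (Y.erase y) \ A ⊆ (Y \ A).erase y := by
        intro q hq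
        simp only [mem_sdiff, mem_insert, mem_erase] at hq ⊢
        have := hBA hsB
        grind
      have := card_le_card hsub
      rw [card_erase_of_mem (by simp [hyY, hyA])] at this
      omega
    obtain ⟨G'', hd'', Y', hY', hc, hN'⟩ := ih G' _ hN (hcard ▸ hYB) hcard'
      (fun p hp s hs => by rw [hd', hd']; exact hd p hp s hs)
    exact ⟨G'', fun p => (hd'' p).trans (hd' p), Y', hY', hc.trans hcard, hN'⟩

end Moves

section Delete

variable {V : Type*} [Fintype V]

variable {G : SimpleGraph V} {v : V} {G₁ : SimpleGraph {x // x ≠ v}}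

theorem degree_comap_ne (hG₁ : G₁ = G.comap Subtype.val) (x : {x // x ≠ v}) :
    G₁.degree x + (if G.Adj v x then 1 else 0) = G.degree x := by
  have hmap : (G₁.neighborFinset x).map ⟨Subtype.val, Subtype.val_injective⟩ =
      (G.neighborFinset x).erase v := by
    ext q
    simp only [mem_map, mem_neighborFinset, Function.Embedding.coeFn_mk, mem_erase, hG₁,
      comap_adj]
    constructor
    · rintro ⟨a, ha, rfl⟩; exact ⟨a.2, ha⟩
    · rintro ⟨h1, h2⟩; exact ⟨⟨q, h1⟩, h2, rfl⟩
  have hc : G₁.degree x = #((G.neighborFinset x).erase v) := by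
    rw [← hmap, card_map, card_neighborFinset_eq_degree]
  rw [hc]
  split_ifs with h
  · rw [card_erase_of_mem (by simpa using h.symm), card_neighborFinset_eq_degree]
    have : 0 < G.degree x := (degree_pos_iff_exists_adj (G := G) (v := (x : V))).2 ⟨v, h.symm⟩
    omega
  · rw [erase_eq_of_notMem (by simpa using fun k => h k.symm), card_neighborFinset_eq_degree,
      add_zero]

theorem sum_degree_comap_ne (hG₁ : G₁ = G.comap Subtype.val) :
    ∑ x, G₁.degree x + 2 * G.degree v = ∑ x, G.degree x := by
  have h1 : ∑ x : {x // x ≠ v}, G.degree x = ∑ x ∈ univ.erase v, G.degree x :=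
    (sum_subtype (univ.erase v) (by simp) fun x => G.degree x).symm
  have h2 : ∑ x : {x // x ≠ v}, (if G.Adj v x then 1 else 0) = G.degree v := by
    rw [← sum_subtype (univ.erase v) (by simp) fun x => if G.Adj v x then 1 else 0,
      sum_boole, ← card_neighborFinset_eq_degree, Nat.cast_id]
    congr 1
    ext q
    simp only [mem_filter, mem_erase, mem_univ, and_true, mem_neighborFinset, and_iff_right_iff_imp]
    exact fun k => k.ne.symm
  have h3 := sum_congr (s₁ := (univ : Finset {x // x ≠ v})) rfl fun x _ => degree_comap_ne hG₁ x
  rw [sum_add_distrib, h2, h1] at h3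
  have := add_sum_erase univ (fun x => G.degree x) (mem_univ v)
  omega

theorem PotNear.of_comap_ne {B : Finset V} {r : ℕ} (hG₁ : G₁ = G.comap Subtype.val)
    (hB : #B = r + 1) (hvB : ∀ s ∈ B, G.Adj v s)
    (hd : ∀ p, p ≠ v → ¬ G.Adj v p → ∀ s ∈ B, G.degree p + 1 ≤ G.degree s)
    (h : PotNear G₁ r) : PotNear G (r + 1) := by
  obtain ⟨G₂, hd₂, Y, hY, hN⟩ := h
  have hcardB : #(univ.filter fun x : {x // x ≠ v} => (x : V) ∈ B) = #B := by
    rw [← card_map ⟨Subtype.val, Subtype.val_injective⟩]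
    congr 1
    ext q
    simp only [mem_map, mem_filter, mem_univ, true_and, Function.Embedding.coeFn_mk,
      Subtype.exists, exists_and_left, exists_prop, exists_eq_right_right]
    exact ⟨fun k => k.1, fun k => ⟨k, (hvB q k).ne.symm⟩⟩
  obtain ⟨G₃, hd₃, Y', hY', hcY, hN'⟩ := NearClique.relocate
    (A := univ.filter fun x : {x // x ≠ v} => G.Adj v x)
    (B := univ.filter fun x : {x // x ≠ v} => (x : V) ∈ B)
    (fun x hx => by simp only [mem_filter, mem_univ, true_and] at hx ⊢; exact hvB _ hx)
    _ G₂ Y hN (by rw [hcardB, hY, hB]) le_rfl (by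
      intro p hp s hs
      simp only [mem_filter, mem_univ, true_and] at hp hs
      rw [hd₂, hd₂]
      have e1 := degree_comap_ne hG₁ p
      have e2 := degree_comap_ne hG₁ s
      rw [if_neg hp] at e1
      rw [if_pos (hvB _ hs)] at e2
      have := hd p p.2 hp s hs
      omega)
  obtain ⟨G₄, hG₄⟩ : ∃ G₄ : SimpleGraph V, ∀ p q, G₄.Adj p q ↔
      ((p = v ∨ q = v) ∧ G.Adj p q) ∨ ∃ (hp : p ≠ v) (hq : q ≠ v), G₃.Adj ⟨p, hp⟩ ⟨q, hq⟩ :=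
    ⟨{ Adj := fun p q => ((p = v ∨ q = v) ∧ G.Adj p q) ∨
          ∃ (hp : p ≠ v) (hq : q ≠ v), G₃.Adj ⟨p, hp⟩ ⟨q, hq⟩
       symm := ⟨by
        rintro p q (⟨h1, h2⟩ | ⟨hp, hq, h⟩)
        · exact Or.inl ⟨h1.symm, h2.symm⟩
        · exact Or.inr ⟨hq, hp, h.symm⟩⟩
       loopless := ⟨by
        rintro p (⟨h1, h2⟩ | ⟨hp, hq, h⟩)
        · exact h2.ne rfl
        · exact h.ne rfl⟩ }, fun _ _ => Iff.rfl⟩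
  have hG₄v : ∀ q, G₄.Adj v q ↔ G.Adj v q := by
    intro q; rw [hG₄]; simp
  have hcomap : G₄.comap (Subtype.val : {x // x ≠ v} → V) = G₃ := by
    ext p q
    rw [comap_adj, hG₄]
    simp [p.2, q.2]
  have hdeg : ∀ w, G₄.degree w = G.degree w := by
    intro w
    by_cases hw : w = v
    · subst hw
      rw [← card_neighborFinset_eq_degree, ← card_neighborFinset_eq_degree]
      congr 1
      ext q
      simp [hG₄v]
    · have e1 := degree_comap_ne hcomap.symm ⟨w, hw⟩
      have e2 := degree_comap_ne hG₁ ⟨w, hw⟩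
      simp only [hG₄v] at e1
      rw [hd₃, hd₂] at e1
      rw [← e1, ← e2]
  have hvY : v ∉ Y'.map ⟨Subtype.val, Subtype.val_injective⟩ := by
    simp only [mem_map, Function.Embedding.coeFn_mk, not_exists, not_and]
    exact fun x _ => x.2
  refine ⟨G₄, hdeg, insert v (Y'.map ⟨Subtype.val, Subtype.val_injective⟩), ?_, ?_⟩
  · rw [card_insert_of_notMem hvY, card_map, hcY, hY]
  · refine (hN'.map ⟨Subtype.val, Subtype.val_injective⟩ fun p _ q _ hpq => ?_).cone ?_
    · rw [← hcomap] at hpq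
      exact hpq
    · intro p hp
      simp only [mem_map, Function.Embedding.coeFn_mk] at hp
      obtain ⟨x, hx, rfl⟩ := hp
      rw [hG₄v]
      simpa using hY' hx

/-- The reduction by deleting a vertex of large degree, given the result for `r`. -/
theorem PotNear.of_large_degree {S : Finset V} {m r : ℕ}
    (hS : #S = r + 2) (hv : v ∈ S) (hm : ∀ s ∈ S, m ≤ G.degree s)
    (hout : ∀ w ∉ S, G.degree w ≤ m)
    (hlarge : #{w ∈ Sᶜ | G.degree w = m} + r + 1 ≤ G.degree v)
    (ih : ∀ G' : SimpleGraph V, (∀ w, G'.degree w = G.degree w) →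
      ∀ G₁ : SimpleGraph {x // x ≠ v}, G₁ = G'.comap Subtype.val → PotNear G₁ r) :
    PotNear G (r + 1) := by
  set F := {w ∈ Sᶜ | G.degree w = m} with hF
  have memF : ∀ w, w ∈ F ↔ w ∉ S ∧ G.degree w = m := by simp [hF]
  have hSv : #(S.erase v) = r + 1 := by rw [card_erase_of_mem hv, hS]; omega
  obtain ⟨G', hd, hadj⟩ := exists_adj_top G v (S.erase v ∪ F)
    (by simp [memF, hv]) (by have := card_union_le (S.erase v) F; omega) (by
      intro z hz w hw hwv
      simp only [mem_union, mem_erase, memF, not_or, not_and] at hz hw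
      have hwS : w ∉ S := hw.1 hwv
      have := hout w hwS
      rcases hz with hz | hz
      · exact this.trans (hm z hz.2)
      · omega)
  refine PotNear.congr ?_ hd
  refine .of_comap_ne rfl hSv (fun s hs => hadj s (mem_union_left _ hs)) ?_ (ih G' hd _ rfl)
  intro p hpv hp s hs
  rw [hd, hd]
  have hpS : p ∉ S := fun k => hp (hadj p (mem_union_left _ (mem_erase.2 ⟨hpv, k⟩)))
  have hpF : p ∉ F := fun k => hp (hadj p (mem_union_right _ k))
  have h1 := hout p hpS
  have h2 := hm s (mem_of_mem_erase hs)
  rw [memF] at hpF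
  have : G.degree p ≠ m := fun k => hpF ⟨hpS, k⟩
  omega

end Delete

section FlatLarge

variable {V : Type*} [Fintype V] {G : SimpleGraph V}

theorem PotNear.of_clique_side {u v : V} {A B : Finset V} {r : ℕ} (hr : 3 ≤ r) (huv : u ≠ v)
    (hvA : v ∉ A) (huB : u ∉ B) (hA : ∀ a ∈ A, G.Adj u a) (hB : ∀ b ∈ B, G.Adj v b)
    (hAB : ∀ a ∈ A, ∀ b ∈ B, a ≠ b → G.Adj a b)
    (hcl : ∀ a ∈ A, ∀ a' ∈ A, a ≠ a' → G.Adj a a') (hAc : r - 1 ≤ #A) (hBc : r - 1 ≤ #B) :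
    PotNear G r := by
  have huA : u ∉ A := fun k => (hA u k).ne rfl
  have hGs : ∀ p q, G.Adj p q → G.Adj q p := fun p q k => k.symm
  by_cases hAr : r ≤ #A
  · obtain ⟨D, hD, hDc⟩ := exists_subset_card_eq hAr
    have hcard : #(insert u D) = r + 1 := by
      rw [card_insert_of_notMem (fun k => huA (hD k)), hDc]
    refine .of_near hcard (.of_clique (by omega) fun p hp q hq hpq => ?_)
    rw [mem_insert] at hp hq
    have := @hD p
    have := @hD q
    grind
  have hAr' : #A = r - 1 := by omega
  have pair : ∀ b, b ≠ u → b ∉ A → (∀ a ∈ A, G.Adj a b) → PotNear G r := by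
    intro b hbu hbA hb
    have hcard : #(insert u (insert b A)) = r + 1 := by
      rw [card_insert_of_notMem (by simp [hbu.symm, huA]), card_insert_of_notMem hbA]; omega
    refine .of_near hcard (.of_pair (a := u) (b := b) (by omega) (by simp) (by simp) hbu.symm
      fun p hp q hq hpq hn => ?_)
    simp only [mem_insert] at hp hq
    grind
  by_cases hsub : B ⊆ A
  · have heq : B = A := eq_of_subset_of_card_le hsub (by omega)
    exact pair v huv.symm hvA fun a ha => (hB a (heq ▸ ha)).symm
  · obtain ⟨b, hb, hbA⟩ := not_subset.1 hsub
    refine pair b ?_ hbA fun a ha => hAB a ha b hb ?_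
    · rintro rfl; exact huB hb
    · rintro rfl; exact hbA ha

/-- The complete graph on a finite set of vertices, with the pairs in `M` removed. -/
theorem exists_completeOn {V : Type*} (S : Finset V) (M : V → V → Prop)
    (hM : ∀ p q, M p q → M q p) :
    ∃ H : SimpleGraph V, ∀ p q, H.Adj p q ↔ p ∈ S ∧ q ∈ S ∧ p ≠ q ∧ ¬ M p q :=
  ⟨{ Adj := fun p q => p ∈ S ∧ q ∈ S ∧ p ≠ q ∧ ¬ M p q
     symm := ⟨fun _ _ h => ⟨h.2.1, h.1, h.2.2.1.symm, fun k => h.2.2.2 (hM _ _ k)⟩⟩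
     loopless := ⟨fun _ h => h.2.2.1 rfl⟩ }, fun _ _ => Iff.rfl⟩

theorem card_neighbor_sdiff {S : Finset V} {u v : V} {r : ℕ} (hS : #S = r + 1) (hu : u ∈ S)
    (hv : v ∈ S) (huv : u ≠ v) (hn : ¬ G.Adj u v) :
    G.degree u + 1 ≤ #(G.neighborFinset u \ S) + r := by
  have h1 := card_sdiff_add_card_inter (G.neighborFinset u) S
  have hsub : G.neighborFinset u ∩ S ⊆ (S.erase u).erase v := by
    intro q hq
    simp only [mem_inter, mem_neighborFinset, mem_erase] at hq ⊢
    refine ⟨?_, hq.1.ne.symm, hq.2⟩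
    rintro rfl; exact hn hq.1
  have h2 := card_le_card hsub
  rw [card_erase_of_mem (mem_erase.2 ⟨huv.symm, hv⟩), card_erase_of_mem hu, hS] at h2
  rw [card_neighborFinset_eq_degree] at h1
  have : 1 < #S := one_lt_card.2 ⟨u, hu, v, hv, huv⟩
  omega

variable {H : SimpleGraph V} {S : Finset V} {u v x y z : V} {m r : ℕ}

/-- A vertex outside `S` in the closed neighbourhood of `x` but not of `y` has smaller degree
than `x`. -/
theorem Stuck.degree_lt (h : Stuck G H S u v x y) (hz : z ∉ S) (hzx : z = x ∨ G.Adj z x)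
    (nzy : z ≠ y) (hzy : ¬ G.Adj z y) : G.degree z < G.degree x := by
  have nzx : z ≠ x := by
    rintro rfl; exact hzy (h.adj_of_ne nzy)
  have hzx := hzx.resolve_left nzx
  have nxy : x ≠ y := by rintro rfl; exact hzy hzx
  have hxy := h.adj_of_ne nxy
  have hsub : G.neighborFinset z ⊆ (((insert x (G.neighborFinset x)).erase z).erase y) := by
    intro c hc
    rw [mem_neighborFinset] at hc
    simp only [mem_erase, mem_insert, mem_neighborFinset]
    refine ⟨by rintro rfl; exact hzy hc, hc.ne.symm, ?_⟩
    rcases h.adj_or_eq hz hc hzy nzy with k | k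
    · exact Or.inl k
    · exact Or.inr k.symm
  have := card_le_card hsub
  rw [card_erase_of_mem (by simp [nzy.symm, hxy]), card_erase_of_mem (by simp [hzx.symm]),
    card_insert_of_notMem (by simp), card_neighborFinset_eq_degree,
    card_neighborFinset_eq_degree] at this
  have : 0 < G.degree x := (degree_pos_iff_exists_adj G x).2 ⟨y, hxy⟩
  omega

theorem clique_or_clique {A B : Finset V} (hMM : MaxMeet G H) (hsupp : ∀ p q, H.Adj p q → p ∈ S)
    (huvH : H.Adj u v) (huv : ¬ G.Adj u v) (hA : ∀ a ∈ A, G.Adj u a ∧ a ∉ S)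
    (hB : ∀ b ∈ B, G.Adj v b ∧ b ∉ S) :
    (∀ a ∈ A, ∀ a' ∈ A, a ≠ a' → G.Adj a a') ∨ (∀ b ∈ B, ∀ b' ∈ B, b ≠ b' → G.Adj b b') := by
  have hst : ∀ a ∈ A, ∀ b ∈ B, Stuck G H S u v a b := fun a ha b hb =>
    ⟨hMM, hsupp, huvH, huv, (hA a ha).1, fun k => (hA a ha).2 (hsupp _ _ k.symm),
      (hB b hb).1, fun k => (hB b hb).2 (hsupp _ _ k.symm)⟩
  by_contra! hcon
  obtain ⟨⟨a₁, ha₁, a₂, ha₂, na, hna⟩, b₁, hb₁, b₂, hb₂, nb, hnb⟩ := hcon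
  have n11 : a₁ ≠ b₁ := by
    rintro rfl; exact hnb ((hst _ ha₁ _ hb₂).adj_of_ne nb)
  have n22 : a₂ ≠ b₂ := by
    rintro rfl; exact hnb ((hst _ ha₂ _ hb₁).adj_of_ne nb.symm).symm
  have h11 := hst a₁ ha₁ b₁ hb₁
  obtain ⟨G', hd, hG'⟩ := exists_switch G (h11.adj_of_ne n11) ((hst a₂ ha₂ b₂ hb₂).adj_of_ne n22)
    hna hnb na nb
  have keep : ∀ p q, p ∈ S → G.Adj p q → G'.Adj p q := by
    intro p q hp hpq
    rw [hG']; left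
    refine ⟨hpq, ?_, ?_, ?_, ?_⟩ <;> rintro ⟨rfl, rfl⟩
    · exact (hA _ ha₁).2 hp
    · exact (hB _ hb₁).2 hp
    · exact (hA _ ha₂).2 hp
    · exact (hB _ hb₂).2 hp
  have hst' := h11.transfer hd (fun p q h1 h2 => keep p q (hsupp _ _ h2) h1)
    (keep _ _ (hsupp _ _ huvH) h11.ux) (keep _ _ (hsupp _ _ huvH.symm) h11.vy)
  have k := hst'.adj_of_ne n11
  rw [hG'] at k
  rcases k with ⟨-, k, -⟩ | ⟨-, k⟩ | ⟨k, -⟩ | ⟨k, -⟩ | ⟨k, -⟩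
  · exact k ⟨rfl, rfl⟩
  · exact hna (k ▸ h11.adj_of_ne n11)
  · exact na k
  · exact n11 k
  · subst k; exact hnb (h11.adj_of_ne n11).symm

theorem flat_large_bound {n r m i k : ℤ} (hn : 5 * r + 19 ≤ n) (hr : 4 ≤ r) (hmr : r ≤ m)
    (hm : m + 3 ≤ 2 * r) (hi : i ≤ m) (hk : k ≤ 2 * m - i) :
    (r + 1) * (i + r) + k * m + m + (n - (r + 1 + k)) * (r - 3) <
      (2 * r - 5) * n - r ^ 2 + 4 * r - 2 := by
  nlinarith [mul_nonneg (by linarith : 0 ≤ 2 * m - i - k) (by linarith : 0 ≤ m - r + 3),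
    mul_nonneg (sub_nonneg.2 hi) (by linarith : 0 ≤ 2 * r - 2 - m),
    mul_nonneg (sub_nonneg.2 hm) (by linarith : 0 ≤ 2 * r - 3 + m + 5),
    mul_nonneg (sub_nonneg.2 hn) (by linarith : 0 ≤ r - 2)]

theorem PotNear.of_flat_large (hr : 4 ≤ r) (hn : 5 * r + 19 ≤ Fintype.card V)
    (hsum : (2 * (r : ℤ) - 5) * Fintype.card V - r ^ 2 + 4 * r - 2 ≤ ∑ w, (G.degree w : ℤ))
    (hS : #S = r + 1) (hm : ∀ s ∈ S, m ≤ G.degree s) (hout : ∀ w ∉ S, G.degree w ≤ m)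
    (hflat : ∀ s ∈ S, G.degree s + 1 ≤ #{w ∈ Sᶜ | G.degree w = m} + r) (hmr : r ≤ m) :
    PotNear G r := by
  obtain ⟨H, hH⟩ := exists_completeOn S (fun _ _ => False) fun _ _ => id
  obtain ⟨G', hd, hMM⟩ := exists_maxMeet G H
  refine PotNear.congr ?_ hd
  simp only [← hd] at hsum hm hout hflat
  clear hd
  generalize G' = G at *
  by_contra hno
  have hsupp : ∀ p q, H.Adj p q → p ∈ S := fun p q k => ((hH p q).1 k).1
  obtain ⟨u, hu, v, hv, huv, hnuv⟩ : ∃ u ∈ S, ∃ v ∈ S, u ≠ v ∧ ¬ G.Adj u v := by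
    by_contra! hcon
    exact hno (.of_near hS (.of_clique (by omega) hcon))
  have huvH : H.Adj u v := (hH u v).2 ⟨hu, hv, huv, id⟩
  set A := G.neighborFinset u \ S with hA
  set B := G.neighborFinset v \ S with hB
  have memA : ∀ a ∈ A, G.Adj u a ∧ a ∉ S := by simp [hA]
  have memB : ∀ b ∈ B, G.Adj v b ∧ b ∉ S := by simp [hB]
  have cA := card_neighbor_sdiff hS hu hv huv hnuv
  have cB := card_neighbor_sdiff hS hv hu huv.symm fun k => hnuv k.symm
  rw [← hA] at cA
  rw [← hB] at cB
  have hmu := hm u hu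
  have hmv := hm v hv
  have hst : ∀ a ∈ A, ∀ b ∈ B, Stuck G H S u v a b := fun a ha b hb =>
    ⟨hMM, hsupp, huvH, hnuv, (memA a ha).1, fun k => (memA a ha).2 (hsupp _ _ k.symm),
      (memB b hb).1, fun k => (memB b hb).2 (hsupp _ _ k.symm)⟩
  have hm2 : m + 3 ≤ 2 * r := by
    by_contra hm2
    refine hno ?_
    rcases clique_or_clique hMM hsupp huvH hnuv memA memB with hcl | hcl
    · exact .of_clique_side (by omega) huv (fun k => (memA _ k).2 hv) (fun k => (memB _ k).2 hu)
        (fun a ha => (memA a ha).1) (fun b hb => (memB b hb).1)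
        (fun a ha b hb hab => (hst a ha b hb).adj_of_ne hab) hcl (by omega) (by omega)
    · exact .of_clique_side (by omega) huv.symm (fun k => (memB _ k).2 hu)
        (fun k => (memA _ k).2 hv) (fun b hb => (memB b hb).1) (fun a ha => (memA a ha).1)
        (fun b hb a ha hab => ((hst a ha b hb).adj_of_ne hab.symm).symm) hcl
        (by omega) (by omega)
  obtain ⟨a, ha⟩ : A.Nonempty := card_pos.1 (by omega)
  obtain ⟨b, hb⟩ : B.Nonempty := card_pos.1 (by omega)
  have hab := hst a ha b hb
  set Na := insert a (G.neighborFinset a) \ S with hNa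
  set Nb := insert b (G.neighborFinset b) \ S with hNb
  have cN : ∀ w t : V, w ∈ S → t ∉ S → G.Adj w t →
      #(insert t (G.neighborFinset t) \ S) ≤ m := by
    intro w t hw ht hwt
    have hsub : insert t (G.neighborFinset t) \ S ⊆ (insert t (G.neighborFinset t)).erase w := by
      intro q hq
      simp only [mem_sdiff, mem_erase] at hq ⊢
      exact ⟨by rintro rfl; exact hq.2 hw, hq.1⟩
    have := card_le_card hsub
    rw [card_erase_of_mem (by simp [hwt.symm]), card_insert_of_notMem (by simp),
      card_neighborFinset_eq_degree] at this
    have := hout t ht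
    omega
  have cNa : #Na ≤ m := cN u a hu (memA a ha).2 (memA a ha).1
  have cNb : #Nb ≤ m := cN v b hv (memB b hb).2 (memB b hb).1
  have hcup := card_union_add_card_inter Na Nb
  set R := {w ∈ (S ∪ (Na ∪ Nb))ᶜ | r ≤ G.degree w + 2} with hR
  have cR : #R ≤ 1 := by
    rw [card_le_one]
    intro z hz z' hz'
    by_contra hne
    have far : ∀ z ∈ R, Far G S a b z ∧ r ≤ G.degree z + 2 := by
      intro z hz
      simp only [hR, hNa, hNb, mem_filter, mem_compl, mem_union, mem_sdiff, mem_insert,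
        mem_neighborFinset, not_or, not_and, not_not, G.adj_comm a z, G.adj_comm b z] at hz
      refine ⟨⟨hz.1.1, ?_, ?_, ?_, ?_⟩, hz.2⟩ <;> intro k <;> tauto
    exact hno (hab.potNear_of_far (far z hz).1 (far z' hz').1 hne (by omega) (far z hz).2
      (far z' hz').2)
  have hF : {w ∈ Sᶜ | G.degree w = m} ⊆ (Na ∩ Nb) ∪ R := by
    intro z hz
    simp only [mem_filter, mem_compl] at hz
    obtain ⟨hzS, hzm⟩ := hz
    have da := hout a (memA a ha).2
    have db := hout b (memB b hb).2
    have memNa : z ∈ Na ↔ z = a ∨ G.Adj z a := by simp [hNa, hzS, G.adj_comm]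
    have memNb : z ∈ Nb ↔ z = b ∨ G.Adj z b := by simp [hNb, hzS, G.adj_comm]
    simp only [mem_union, mem_inter, hR, mem_filter, mem_compl, hzS, false_or]
    by_cases h1 : z ∈ Na <;> by_cases h2 : z ∈ Nb
    · exact Or.inl ⟨h1, h2⟩
    · rw [memNb, not_or] at h2
      have := hab.degree_lt hzS (memNa.1 h1) h2.1 h2.2
      omega
    · rw [memNa, not_or] at h1
      have := hab.symm.degree_lt hzS (memNb.1 h2) h1.1 h1.2
      omega
    · exact Or.inr ⟨by simp [h1, h2], by omega⟩
  have cF := (card_le_card hF).trans (card_union_le _ _)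
  set i := #(Na ∩ Nb) with hi
  set k := #(Na ∪ Nb) with hk
  have hi' : i ≤ m := (card_le_card inter_subset_left).trans cNa
  have dis : Disjoint S (Na ∪ Nb) := by
    rw [Finset.disjoint_left]
    intro q hq
    simp [hNa, hNb, hq]
  have cSK : #(S ∪ (Na ∪ Nb)) = r + 1 + k := by rw [card_union_of_disjoint dis, hS]
  have cC := card_add_card_compl (S ∪ (Na ∪ Nb))
  have sumS : ∑ w ∈ S, G.degree w ≤ #S • (i + r) := sum_le_card_nsmul _ _ _ fun w hw => by
    have := hflat w hw
    omega
  have sumK : ∑ w ∈ Na ∪ Nb, G.degree w ≤ k • m :=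
    sum_le_card_nsmul _ _ _ fun w hw => hout w (Finset.disjoint_right.1 dis hw)
  have sumR : ∑ w ∈ R, G.degree w ≤ #R • m := sum_le_card_nsmul _ _ _ fun w hw =>
    hout w fun k => by simp [hR, k] at hw
  have sumR' : ∑ w ∈ (S ∪ (Na ∪ Nb))ᶜ with ¬ r ≤ G.degree w + 2, G.degree w ≤
      #{w ∈ (S ∪ (Na ∪ Nb))ᶜ | ¬ r ≤ G.degree w + 2} • (r - 3) :=
    sum_le_card_nsmul _ _ _ fun w hw => by
      rw [mem_filter] at hw
      omega
  have cR' : #{w ∈ (S ∪ (Na ∪ Nb))ᶜ | ¬ r ≤ G.degree w + 2} ≤ #(S ∪ (Na ∪ Nb))ᶜ :=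
    card_filter_le _ _
  have tot : ∑ w, G.degree w ≤ (r + 1) * (i + r) + k * m + m + #(S ∪ (Na ∪ Nb))ᶜ * (r - 3) := by
    rw [← sum_add_sum_compl (S ∪ (Na ∪ Nb)), sum_union dis,
      ← sum_filter_add_sum_filter_not (S ∪ (Na ∪ Nb))ᶜ fun w => r ≤ G.degree w + 2, ← hR]
    simp only [smul_eq_mul, hS] at sumS sumK sumR sumR'
    have h1 : #R * m ≤ 1 * m := Nat.mul_le_mul_right _ cR
    have h2 := Nat.mul_le_mul_right (r - 3) cR'
    omega
  have htot : (∑ w, (G.degree w : ℤ)) ≤ (r + 1) * (i + r) + k * m + m +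
      (Fintype.card V - (r + 1 + k)) * (r - 3) := by
    have e1 : ((r - 3 : ℕ) : ℤ) = r - 3 := by push_cast [Nat.cast_sub (by omega : 3 ≤ r)]; ring
    have e2 : (#(S ∪ (Na ∪ Nb))ᶜ : ℤ) = Fintype.card V - (r + 1 + k) := by
      have : #(S ∪ (Na ∪ Nb))ᶜ + (r + 1 + k) = Fintype.card V := by omega
      rw [← this]; push_cast; ring
    rw [← e1, ← e2]
    exact_mod_cast tot
  have hki : (k : ℤ) ≤ 2 * m - i := by omega
  have hn' : 5 * (r : ℤ) + 19 ≤ Fintype.card V := by exact_mod_cast hn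
  have hr' : 4 ≤ (r : ℤ) := by exact_mod_cast hr
  have hmr' : (r : ℤ) ≤ m := by exact_mod_cast hmr
  have hm2' : (m : ℤ) + 3 ≤ 2 * r := by exact_mod_cast hm2
  have hi'' : (i : ℤ) ≤ m := by exact_mod_cast hi'
  exact absurd (hsum.trans htot) (not_le.2 (flat_large_bound hn' hr' hmr' hm2' hi'' hki))

end FlatLarge

section FlatSmall

variable {V : Type*} [Fintype V] {G : SimpleGraph V} {S : Finset V} {M : V → V → Prop} {r : ℕ}

/-- Either a near-clique exists, or the complete graph on `S` without the pairs in `M` can be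
realized up to missing pairs one of whose ends has no neighbour outside the pattern. -/
theorem exists_saturated (hr : 3 ≤ r) (hM : ∀ p q, M p q → M q p)
    (hML : ∀ p q, M p q → G.degree p < r) (hS : #S = r + 1)
    (hLS : ∀ w, r ≤ G.degree w → w ∈ S) (hq : 3 * r + 2 ≤ #{w | r ≤ G.degree w + 2})
    (hno : ¬ PotNear G r) :
    ∃ G' : SimpleGraph V, (∀ w, G'.degree w = G.degree w) ∧
      ∀ p ∈ S, ∀ q ∈ S, p ≠ q → ¬ M p q → ¬ G'.Adj p q →
        (G.degree p < r ∧ ∀ w, G'.Adj p w → w ∈ S ∧ ¬ M p w) ∨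
        (G.degree q < r ∧ ∀ w, G'.Adj q w → w ∈ S ∧ ¬ M q w) := by
  obtain ⟨H, hH⟩ := exists_completeOn S M hM
  obtain ⟨G', hd, hMM⟩ := exists_maxMeet G H
  refine ⟨G', hd, ?_⟩
  have hno' : ¬ PotNear G' r := fun k => hno (k.congr hd)
  simp only [← hd] at hML hLS hq ⊢
  have hsupp : ∀ p q, H.Adj p q → p ∈ S := fun p q k => ((hH p q).1 k).1
  have hlt : ∀ p ∈ S, ∀ q ∈ S, p ≠ q → ¬ G'.Adj p q → (∀ w, G'.Adj p w → H.Adj p w) →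
      G'.degree p < r ∧ ∀ w, G'.Adj p w → w ∈ S ∧ ¬ M p w := by
    intro p hp q hqS hpq hn hsub
    refine ⟨?_, fun w hw => ?_⟩
    · have hsub' : G'.neighborFinset p ⊆ (S.erase p).erase q := by
        intro w hw
        rw [mem_neighborFinset] at hw
        simp only [mem_erase]
        exact ⟨by rintro rfl; exact hn hw, hw.ne.symm, ((hH p w).1 (hsub w hw)).2.1⟩
      have := card_le_card hsub'
      rw [card_erase_of_mem (mem_erase.2 ⟨hpq.symm, hqS⟩), card_erase_of_mem hp, hS,
        card_neighborFinset_eq_degree] at this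
      omega
    · have := (hH p w).1 (hsub w hw)
      exact ⟨this.2.1, this.2.2.2⟩
  intro u hu v hv huv hMuv hn
  by_cases h1 : ∀ w, G'.Adj u w → H.Adj u w
  · exact Or.inl (hlt u hu v hv huv hn h1)
  by_cases h2 : ∀ w, G'.Adj v w → H.Adj v w
  · exact Or.inr (hlt v hv u hu huv.symm (fun k => hn k.symm) h2)
  push Not at h1 h2
  obtain ⟨x, hux, nux⟩ := h1
  obtain ⟨y, hvy, nvy⟩ := h2
  refine absurd ?_ hno'
  have hst : Stuck G' H S u v x y :=
    ⟨hMM, hsupp, (hH u v).2 ⟨hu, hv, huv, hMuv⟩, hn, hux, nux, hvy, nvy⟩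
  have small : ∀ u x, u ∈ S → G'.Adj u x → ¬ H.Adj u x → G'.degree x < r := by
    intro u x hu hux nux
    by_contra hx
    exact nux ((hH u x).2 ⟨hu, hLS x (by omega), hux.ne, fun k => hx (hML x u (hM _ _ k))⟩)
  have dx := small u x hu hux nux
  have dy := small v y hv hvy nvy
  have cx : #((insert x (G'.neighborFinset x)).erase u) + 1 ≤ r := by
    rw [card_erase_of_mem (by simp [hux.symm]), card_insert_of_notMem (by simp),
      card_neighborFinset_eq_degree]
    have : 0 < G'.degree x := (degree_pos_iff_exists_adj G' x).2 ⟨u, hux.symm⟩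
    omega
  have cy : #(insert y (G'.neighborFinset y)) ≤ r := by
    rw [card_insert_of_notMem (by simp), card_neighborFinset_eq_degree]
    omega
  set W := S ∪ ((insert x (G'.neighborFinset x)).erase u ∪ insert y (G'.neighborFinset y)) with hW
  have cW : #W ≤ 3 * r := by
    have e1 := card_union_le S
      ((insert x (G'.neighborFinset x)).erase u ∪ insert y (G'.neighborFinset y))
    rw [← hW] at e1
    have e2 := card_union_le ((insert x (G'.neighborFinset x)).erase u)
      (insert y (G'.neighborFinset y))
    omega
  have c2 : 1 < #(({w | r ≤ G'.degree w + 2} : Finset V) \ W) := by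
    have := le_card_sdiff W ({w | r ≤ G'.degree w + 2} : Finset V)
    omega
  obtain ⟨z, hz, z', hz', hne⟩ := one_lt_card.1 c2
  have far : ∀ z ∈ ({w | r ≤ G'.degree w + 2} : Finset V) \ W,
      Far G' S x y z ∧ r ≤ G'.degree z + 2 := by
    intro z hz
    simp only [hW, mem_sdiff, mem_filter, mem_univ, true_and, mem_union, mem_erase, mem_insert,
      mem_neighborFinset, not_or, not_and, G'.adj_comm x z, G'.adj_comm y z] at hz
    have nzu : z ≠ u := by rintro rfl; exact hz.2.1 hu
    have := hz.2.2.1 nzu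
    exact ⟨⟨hz.2.1, this.1, hz.2.2.2.1, this.2, hz.2.2.2.2⟩, hz.1⟩
  exact hst.potNear_of_far (far z hz).1 (far z' hz').1 hne hr (far z hz).2 (far z' hz').2

theorem PotNear.of_pattern (hr : 3 ≤ r) (hM : ∀ p q, M p q → M q p)
    (hML : ∀ p q, M p q → G.degree p < r) (hS : #S = r + 1)
    (hLS : ∀ w, r ≤ G.degree w → w ∈ S) (hq : 3 * r + 2 ≤ #{w | r ≤ G.degree w + 2})
    (hT : ∀ u ∈ S, G.degree u < r →
      ∃ T ⊆ S, r ≤ G.degree u + #T ∧ ∀ t ∈ T, t ≠ u ∧ M u t)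
    (hnear : ∀ G' : SimpleGraph V, (∀ p ∈ S, ∀ q ∈ S, p ≠ q → ¬ G'.Adj p q → M p q) →
      NearClique G' S) : PotNear G r := by
  by_contra hno
  obtain ⟨G', hd, hsat⟩ := exists_saturated hr hM hML hS hLS hq hno
  have key : ∀ p ∈ S, ∀ q ∈ S, p ≠ q → ¬ M p q → ¬ G'.Adj p q → G.degree p < r →
      ¬ ∀ w, G'.Adj p w → w ∈ S ∧ ¬ M p w := by
    intro p hp q hqS hpq hMpq hn hpr hsub
    obtain ⟨T, hTS, hTc, hTM⟩ := hT p hp hpr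
    have hsub' : G'.neighborFinset p ∪ T ⊆ (S.erase p).erase q := by
      intro w hw
      rw [mem_union, mem_neighborFinset] at hw
      simp only [mem_erase]
      rcases hw with hw | hw
      · exact ⟨by rintro rfl; exact hn hw, hw.ne.symm, (hsub w hw).1⟩
      · exact ⟨by rintro rfl; exact hMpq (hTM _ hw).2, (hTM w hw).1, hTS hw⟩
    have hdis : Disjoint (G'.neighborFinset p) T := by
      rw [Finset.disjoint_left]
      intro w hw hwT
      rw [mem_neighborFinset] at hw
      exact (hsub w hw).2 (hTM w hwT).2
    have := card_le_card hsub'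
    rw [card_erase_of_mem (mem_erase.2 ⟨hpq.symm, hqS⟩), card_erase_of_mem hp, hS,
      card_union_of_disjoint hdis, card_neighborFinset_eq_degree, hd] at this
    omega
  refine hno (PotNear.congr (.of_near hS (hnear G' fun p hp q hqS hpq hn => ?_)) hd)
  by_contra hMpq
  rcases hsat p hp q hqS hpq hMpq hn with ⟨h1, h2⟩ | ⟨h1, h2⟩
  · exact key p hp q hqS hpq hMpq hn h1 h2
  · exact key q hqS p hp hpq.symm (fun k => hMpq (hM _ _ k)) (fun k => hn k.symm) h1 h2

end FlatSmall

section SamePair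

variable {V : Type*}

theorem SamePair.swap {a b p q : V} (h : SamePair a b p q) : SamePair a b q p :=
  h.elim (fun k => Or.inr ⟨k.2, k.1⟩) fun k => Or.inl ⟨k.2, k.1⟩

theorem SamePair.left (a b : V) : SamePair a b a b := Or.inl ⟨rfl, rfl⟩

theorem SamePair.right (a b : V) : SamePair a b b a := Or.inr ⟨rfl, rfl⟩

theorem SamePair.mem_left {a b p q : V} (h : SamePair a b p q) : p = a ∨ p = b :=
  h.elim (fun k => Or.inl k.1) fun k => Or.inr k.1

theorem SamePair.mem_right {a b p q : V} (h : SamePair a b p q) : q = a ∨ q = b :=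
  h.swap.mem_left

end SamePair

section FlatSmallCases

variable {V : Type*} [Fintype V] {G : SimpleGraph V} {r : ℕ}

theorem PotNear.of_card_add_four (hr : 4 ≤ r) (hL : #{w | r ≤ G.degree w} + 4 = r)
    (hq : 3 * r + 2 ≤ #{w | r ≤ G.degree w + 2}) (hD : 5 ≤ #{w | G.degree w + 1 = r}) :
    PotNear G r := by
  obtain ⟨a, b, c, ha, hb, hc, hab, hac, hbc⟩ :=
    (two_lt_card_iff (s := ({w | G.degree w + 1 = r} : Finset V))).1 (by omega)
  obtain ⟨e, he, f, hf, hef⟩ : ∃ e ∈ ({w | G.degree w + 1 = r} : Finset V) \ {a, b, c},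
      ∃ f ∈ ({w | G.degree w + 1 = r} : Finset V) \ {a, b, c}, e ≠ f := by
    rw [← one_lt_card]
    have := le_card_sdiff {a, b, c} ({w | G.degree w + 1 = r} : Finset V)
    have := card_le_three (a := a) (b := b) (c := c)
    omega
  simp only [mem_sdiff, mem_filter, mem_univ, true_and, mem_insert, mem_singleton, not_or]
    at ha hb hc he hf
  obtain ⟨he, hea, heb, hec⟩ := he
  obtain ⟨hf, hfa, hfb, hfc⟩ := hf
  set L : Finset V := {w | r ≤ G.degree w} with hLdef
  have memL : ∀ w, w ∈ L ↔ r ≤ G.degree w := by simp [hLdef]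
  have nL : ∀ w, G.degree w + 1 = r → w ∉ L := by
    intro w hw k
    rw [memL] at k
    omega
  have hS : #(insert a (insert b (insert c (insert e (insert f L))))) = r + 1 := by
    rw [card_insert_of_notMem, card_insert_of_notMem, card_insert_of_notMem,
      card_insert_of_notMem, card_insert_of_notMem (nL f hf)]
    · omega
    · simp [hef, nL e he]
    · simp [Ne.symm hec, Ne.symm hfc, nL c hc]
    · simp [hbc, Ne.symm heb, Ne.symm hfb, nL b hb]
    · simp [hab, hac, Ne.symm hea, Ne.symm hfa, nL a ha]
  refine .of_pattern (M := fun p q => SamePair a b p q ∨ SamePair a c p q ∨ SamePair e f p q)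
    (by omega) ?_ ?_ hS ?_ hq ?_ ?_
  · rintro p q (k | k | k)
    · exact Or.inl k.swap
    · exact Or.inr (Or.inl k.swap)
    · exact Or.inr (Or.inr k.swap)
  · rintro p q (k | k | k) <;> rcases k.mem_left with rfl | rfl <;> omega
  · intro w hw
    simp [(memL w).2 hw]
  · intro u hu hur
    have huL : u ∉ L := by rw [memL]; omega
    simp only [mem_insert, huL, or_false] at hu
    have pick : ∀ t, t ∈ insert a (insert b (insert c (insert e (insert f L)))) → t ≠ u →
        G.degree u + 1 = r →
        (SamePair a b u t ∨ SamePair a c u t ∨ SamePair e f u t) →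
        ∃ T ⊆ insert a (insert b (insert c (insert e (insert f L)))), r ≤ G.degree u + #T ∧
          ∀ t ∈ T, t ≠ u ∧ (SamePair a b u t ∨ SamePair a c u t ∨ SamePair e f u t) :=
      fun t h1 h2 h3 h4 => ⟨{t}, by simpa using h1, by simp [h3], by simp [h2, h4]⟩
    rcases hu with rfl | rfl | rfl | rfl | rfl
    · exact pick b (by simp) hab.symm ha (Or.inl (.left _ _))
    · exact pick a (by simp) hab hb (Or.inl (.right _ _))
    · exact pick a (by simp) hac hc (Or.inr (Or.inl (.right _ _)))
    · exact pick f (by simp) hef.symm he (Or.inr (Or.inr (.left _ _)))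
    · exact pick e (by simp) hef hf (Or.inr (Or.inr (.right _ _)))
  · intro G' h
    exact Or.inr ⟨a, by simp, b, by simp, c, by simp, e, by simp, f, by simp,
      by simp [hab, hac, hbc, hef, Ne.symm hea, Ne.symm heb, Ne.symm hec, Ne.symm hfa,
        Ne.symm hfb, Ne.symm hfc], h⟩

theorem PotNear.of_card_add_three (hr : 3 ≤ r) (hL : #{w | r ≤ G.degree w} + 3 = r)
    (hq : 3 * r + 2 ≤ #{w | r ≤ G.degree w + 2}) (hD : 1 ≤ #{w | G.degree w + 1 = r}) :
    PotNear G r := by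
  set L : Finset V := {w | r ≤ G.degree w} with hLdef
  have memL : ∀ w, w ∈ L ↔ r ≤ G.degree w := by simp [hLdef]
  obtain ⟨d, hd⟩ := card_pos.1 hD
  obtain ⟨a, b, c, ha, hb, hc, hab, hac, hbc⟩ :=
    (two_lt_card_iff (s := ({w | r ≤ G.degree w + 2} : Finset V) \ insert d L)).1 (by
      have := le_card_sdiff (insert d L) ({w | r ≤ G.degree w + 2} : Finset V)
      have := card_insert_le d L
      omega)
  simp only [mem_sdiff, mem_filter, mem_univ, true_and, mem_insert, not_or] at ha hb hc hd
  obtain ⟨ha, had, haL⟩ := ha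
  obtain ⟨hb, hbd, hbL⟩ := hb
  obtain ⟨hc, hcd, hcL⟩ := hc
  have hdL : d ∉ L := by rw [memL]; omega
  have hS : #(insert a (insert b (insert c (insert d L)))) = r + 1 := by
    rw [card_insert_of_notMem, card_insert_of_notMem, card_insert_of_notMem,
      card_insert_of_notMem hdL]
    · omega
    · simp [hcd, hcL]
    · simp [hbc, hbd, hbL]
    · simp [hab, hac, had, haL]
  refine .of_pattern (M := fun p q => SamePair a b p q ∨ SamePair a c p q ∨ SamePair b c p q ∨
    SamePair a d p q) hr ?_ ?_ hS ?_ hq ?_ ?_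
  · rintro p q (k | k | k | k)
    · exact Or.inl k.swap
    · exact Or.inr (Or.inl k.swap)
    · exact Or.inr (Or.inr (Or.inl k.swap))
    · exact Or.inr (Or.inr (Or.inr k.swap))
  · simp only [memL] at haL hbL hcL hdL
    rintro p q (k | k | k | k) <;> rcases k.mem_left with rfl | rfl <;> omega
  · intro w hw
    simp [(memL w).2 hw]
  · intro u hu hur
    have huL : u ∉ L := by rw [memL]; omega
    simp only [mem_insert, huL, or_false] at hu
    rcases hu with rfl | rfl | rfl | rfl
    · refine ⟨{b, c}, by simp [insert_subset_iff], by rw [card_pair hbc]; omega, ?_⟩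
      simp [SamePair, hab, hac, hab.symm, hac.symm]
    · refine ⟨{a, c}, by simp [insert_subset_iff], by rw [card_pair hac]; omega, ?_⟩
      simp [SamePair, hab, hbc, hab.symm, hbc.symm]
    · refine ⟨{a, b}, by simp [insert_subset_iff], by rw [card_pair hab]; omega, ?_⟩
      simp [SamePair, hac, hbc, hac.symm, hbc.symm]
    · refine ⟨{a}, by simp, by rw [card_singleton]; omega, ?_⟩
      simp [SamePair, had]
  · intro G' h
    exact Or.inl ⟨a, by simp, b, by simp, c, by simp, d, by simp,
      by simp [hab, hac, hbc, had, hbd, hcd], h⟩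

theorem PotNear.of_card_add_two (hr : 3 ≤ r) (hL : #{w | r ≤ G.degree w} + 2 = r)
    (hq : 3 * r + 2 ≤ #{w | r ≤ G.degree w + 2}) : PotNear G r := by
  set L : Finset V := {w | r ≤ G.degree w} with hLdef
  have memL : ∀ w, w ∈ L ↔ r ≤ G.degree w := by simp [hLdef]
  obtain ⟨a, b, c, ha, hb, hc, hab, hac, hbc⟩ :=
    (two_lt_card_iff (s := ({w | r ≤ G.degree w + 2} : Finset V) \ L)).1 (by
      have := le_card_sdiff L ({w | r ≤ G.degree w + 2} : Finset V)
      omega)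
  simp only [mem_sdiff, mem_filter, mem_univ, true_and] at ha hb hc
  obtain ⟨ha, haL⟩ := ha
  obtain ⟨hb, hbL⟩ := hb
  obtain ⟨hc, hcL⟩ := hc
  have hS : #(insert a (insert b (insert c L))) = r + 1 := by
    rw [card_insert_of_notMem, card_insert_of_notMem, card_insert_of_notMem hcL]
    · omega
    · simp [hbc, hbL]
    · simp [hab, hac, haL]
  refine .of_pattern (M := fun p q => (p = a ∨ p = b ∨ p = c) ∧ (q = a ∨ q = b ∨ q = c)) hr
    (fun p q k => ⟨k.2, k.1⟩) ?_ hS ?_ hq ?_ ?_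
  · simp only [memL] at haL hbL hcL
    rintro p q ⟨rfl | rfl | rfl, -⟩ <;> omega
  · intro w hw
    simp [(memL w).2 hw]
  · intro u hu hur
    have huL : u ∉ L := by rw [memL]; omega
    simp only [mem_insert, huL, or_false] at hu
    rcases hu with rfl | rfl | rfl
    · refine ⟨{b, c}, by simp [insert_subset_iff], by rw [card_pair hbc]; omega, ?_⟩
      simp [hab.symm, hac.symm]
    · refine ⟨{a, c}, by simp [insert_subset_iff], by rw [card_pair hac]; omega, ?_⟩
      simp [hab, hbc.symm]
    · refine ⟨{a, b}, by simp [insert_subset_iff], by rw [card_pair hab]; omega, ?_⟩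
      simp [hac, hbc]
  · intro G' h
    exact .of_triangle (by omega) (by simp) (by simp) (by simp) hab hac hbc h

theorem PotNear.of_card_add_one (hr : 3 ≤ r) (hL : #{w | r ≤ G.degree w} + 1 = r)
    (hq : 3 * r + 2 ≤ #{w | r ≤ G.degree w + 2}) : PotNear G r := by
  set L : Finset V := {w | r ≤ G.degree w} with hLdef
  have memL : ∀ w, w ∈ L ↔ r ≤ G.degree w := by simp [hLdef]
  obtain ⟨y, hy, z, hz, hyz⟩ :=
    (one_lt_card (s := ({w | r ≤ G.degree w + 2} : Finset V) \ L)).1 (by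
      have := le_card_sdiff L ({w | r ≤ G.degree w + 2} : Finset V)
      omega)
  simp only [mem_sdiff, mem_filter, mem_univ, true_and] at hy hz
  obtain ⟨hy, hyL⟩ := hy
  obtain ⟨hz, hzL⟩ := hz
  have hS : #(insert y (insert z L)) = r + 1 := by
    rw [card_insert_of_notMem (by simp [hyz, hyL]), card_insert_of_notMem hzL]
    omega
  by_contra hno
  obtain ⟨G', hd, hsat⟩ := exists_saturated (M := SamePair y z) hr (fun p q k => k.swap)
    (by
      intro p q k
      by_contra hp
      rcases k.mem_left with rfl | rfl
      · exact hyL ((memL _).2 (not_lt.1 hp))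
      · exact hzL ((memL _).2 (not_lt.1 hp))) hS (fun w hw => by simp [(memL w).2 hw]) hq hno
  have nlt : ∀ p ∈ L, ¬ G.degree p < r := fun p hp => not_lt.2 ((memL p).1 hp)
  have clique : ∀ p ∈ L, ∀ q ∈ L, p ≠ q → G'.Adj p q := by
    intro p hp q hq hpq
    by_contra hn
    rcases hsat p (by simp [hp]) q (by simp [hq]) hpq (by
      intro k
      rcases k.mem_left with rfl | rfl
      · exact hyL hp
      · exact hzL hp) hn with k | k
    · exact nlt p hp k.1
    · exact nlt q hq k.1
  have one : ∀ t, (t = y ∨ t = z) → r ≤ G.degree t + 2 →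
      ∃ l ∈ L, ∀ p ∈ L, p ≠ l → G'.Adj t p := by
    intro t ht htr
    have htL : t ∉ L := by rcases ht with rfl | rfl <;> assumption
    by_cases hall : ∀ p ∈ L, G'.Adj t p
    · obtain ⟨l, hl⟩ : L.Nonempty := card_pos.1 (by omega)
      exact ⟨l, hl, fun p hp _ => hall p hp⟩
    push Not at hall
    obtain ⟨l, hl, hn⟩ := hall
    have htl : t ≠ l := by rintro rfl; exact htL hl
    have htS : t ∈ insert y (insert z L) := by rcases ht with rfl | rfl <;> simp
    have nM : ¬ SamePair y z t l := by
      intro k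
      rcases k.mem_right with rfl | rfl
      · exact hyL hl
      · exact hzL hl
    have hsub : G'.neighborFinset t ⊆ L.erase l := by
      intro w hw
      rw [mem_neighborFinset] at hw
      rcases hsat t htS l (by simp [hl]) htl nM hn with k | k
      · have := k.2 w hw
        simp only [mem_insert] at this
        refine mem_erase.2 ⟨by rintro rfl; exact hn hw, ?_⟩
        rcases this with ⟨rfl | rfl | hwL, nMw⟩
        · rcases ht with rfl | rfl
          · exact absurd hw (G'.loopless.irrefl _)
          · exact absurd (SamePair.right _ _) nMw
        · rcases ht with rfl | rfl
          · exact absurd (SamePair.left _ _) nMw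
          · exact absurd hw (G'.loopless.irrefl _)
        · exact hwL
      · exact absurd k.1 (nlt l hl)
    have heq := eq_of_subset_of_card_le hsub (by
      rw [card_erase_of_mem hl, card_neighborFinset_eq_degree, hd]; omega)
    refine ⟨l, hl, fun p hp hpl => ?_⟩
    rw [← mem_neighborFinset, heq]
    exact mem_erase.2 ⟨hpl, hp⟩
  obtain ⟨k, hk, hyk⟩ := one y (Or.inl rfl) hy
  obtain ⟨l, hl, hzl⟩ := one z (Or.inr rfl) hz
  have nyk : y ≠ k := by rintro rfl; exact hyL hk
  have nyl : y ≠ l := by rintro rfl; exact hyL hl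
  have nzk : z ≠ k := by rintro rfl; exact hzL hk
  have nzl : z ≠ l := by rintro rfl; exact hzL hl
  have miss : ∀ p ∈ insert y (insert z L), ∀ q ∈ insert y (insert z L), p ≠ q → ¬ G'.Adj p q →
      SamePair y z p q ∨ SamePair y k p q ∨ SamePair z l p q := by
    have aux : ∀ q ∈ L, (¬ G'.Adj y q → q = k) ∧ (¬ G'.Adj z q → q = l) := fun q hq =>
      ⟨fun h => by_contra fun c => h (hyk q hq c), fun h => by_contra fun c => h (hzl q hq c)⟩
    intro p hp q hq hpq hn
    rw [mem_insert, mem_insert] at hp hq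
    rcases hp with rfl | rfl | hp <;> rcases hq with rfl | rfl | hq
    · exact absurd rfl hpq
    · exact Or.inl (.left _ _)
    · exact Or.inr (Or.inl (Or.inl ⟨rfl, (aux q hq).1 hn⟩))
    · exact Or.inl (.right _ _)
    · exact absurd rfl hpq
    · exact Or.inr (Or.inr (Or.inl ⟨rfl, (aux q hq).2 hn⟩))
    · exact Or.inr (Or.inl (Or.inr ⟨(aux p hp).1 fun c => hn c.symm, rfl⟩))
    · exact Or.inr (Or.inr (Or.inr ⟨(aux p hp).2 fun c => hn c.symm, rfl⟩))
    · exact absurd (clique p hp q hq hpq) hn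
  refine hno (PotNear.congr (.of_near hS ?_) hd)
  by_cases hkl : k = l
  · subst hkl
    refine .of_triangle (a := y) (b := z) (c := k) (by omega) (by simp) (by simp) (by simp [hk])
      hyz nyk nzk fun p hp q hq hpq hn => ?_
    rcases miss p hp q hq hpq hn with h | h | h <;>
      rcases h.mem_left with h1 | h1 <;> rcases h.mem_right with h2 | h2 <;> simp [h1, h2]
  · refine Or.inl ⟨y, by simp, z, by simp, l, by simp [hl], k, by simp [hk],
      by simp [hyz, nyl, nyk, nzl, nzk, Ne.symm hkl], fun p hp q hq hpq hn => ?_⟩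
    rcases miss p hp q hq hpq hn with h | h | h
    · exact Or.inl h
    · exact Or.inr (Or.inr (Or.inr h))
    · exact Or.inr (Or.inr (Or.inl h))

theorem PotNear.of_card_eq (hr : 3 ≤ r) (hL : #{w | r ≤ G.degree w} = r)
    (hq : 3 * r + 2 ≤ #{w | r ≤ G.degree w + 2}) : PotNear G r := by
  set L : Finset V := {w | r ≤ G.degree w} with hLdef
  have memL : ∀ w, w ∈ L ↔ r ≤ G.degree w := by simp [hLdef]
  obtain ⟨z, hz⟩ : (({w | r ≤ G.degree w + 2} : Finset V) \ L).Nonempty := by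
    rw [← card_pos]
    have := le_card_sdiff L ({w | r ≤ G.degree w + 2} : Finset V)
    omega
  simp only [mem_sdiff, mem_filter, mem_univ, true_and] at hz
  obtain ⟨hz, hzL⟩ := hz
  have hS : #(insert z L) = r + 1 := by rw [card_insert_of_notMem hzL, hL]
  by_contra hno
  obtain ⟨G', hd, hsat⟩ := exists_saturated (M := fun _ _ => False) hr (fun _ _ => id)
    (fun _ _ => False.elim) hS (fun w hw => by simp [(memL w).2 hw]) hq hno
  have nlt : ∀ p ∈ L, ¬ G.degree p < r := fun p hp => not_lt.2 ((memL p).1 hp)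
  have clique : ∀ p ∈ L, ∀ q ∈ L, p ≠ q → G'.Adj p q := by
    intro p hp q hq hpq
    by_contra hn
    rcases hsat p (by simp [hp]) q (by simp [hq]) hpq id hn with k | k
    · exact nlt p hp k.1
    · exact nlt q hq k.1
  refine hno (PotNear.congr (.of_near hS ?_) hd)
  have miss : ∀ p ∈ insert z L, ∀ q ∈ insert z L, p ≠ q → ¬ G'.Adj p q →
      (p = z ∧ q ∈ L ∧ ¬ G'.Adj z q) ∨ (q = z ∧ p ∈ L ∧ ¬ G'.Adj z p) := by
    intro p hp q hq hpq hn
    rw [mem_insert] at hp hq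
    rcases hp with rfl | hp <;> rcases hq with rfl | hq
    · exact absurd rfl hpq
    · exact Or.inl ⟨rfl, hq, hn⟩
    · exact Or.inr ⟨rfl, hp, fun c => hn c.symm⟩
    · exact absurd (clique p hp q hq hpq) hn
  obtain ⟨k, hk, l, hl, hkl, hkl'⟩ :
      ∃ k ∈ L, ∃ l ∈ L, k ≠ l ∧ ∀ p ∈ L, ¬ G'.Adj z p → p = k ∨ p = l := by
    by_cases hall : #{p ∈ L | ¬ G'.Adj z p} ≤ 2
    · obtain ⟨T, hT1, hT2, hT3⟩ := exists_subsuperset_card_eq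
        (filter_subset (fun p => ¬ G'.Adj z p) L) hall (by omega)
      obtain ⟨k, l, hkl, rfl⟩ := card_eq_two.1 hT3
      refine ⟨k, hT2 (by simp), l, hT2 (by simp), hkl, fun p hp hn => ?_⟩
      simpa using hT1 (mem_filter.2 ⟨hp, hn⟩)
    · obtain ⟨k, hk⟩ := card_pos.1 (by omega : 0 < #{p ∈ L | ¬ G'.Adj z p})
      rw [mem_filter] at hk
      have hsub : G'.neighborFinset z ⊆ {p ∈ L | G'.Adj z p} := by
        intro w hw
        rw [mem_neighborFinset] at hw
        rcases hsat z (by simp) k (by simp [hk.1]) (by rintro rfl; exact hzL hk.1) id hk.2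
          with c | c
        · have := mem_insert.1 (c.2 w hw).1
          exact mem_filter.2 ⟨this.resolve_left hw.ne.symm, hw⟩
        · exact absurd c.1 (nlt k hk.1)
      have h1 := card_le_card hsub
      have h2 := card_filter_add_card_filter_not (s := L) fun p => G'.Adj z p
      rw [card_neighborFinset_eq_degree, hd] at h1
      omega
  refine .of_triangle (a := z) (b := k) (c := l) (by omega) (by simp) (by simp [hk])
    (by simp [hl]) (by rintro rfl; exact hzL hk) (by rintro rfl; exact hzL hl) hkl
    fun p hp q hq hpq hn => ?_
  rcases miss p hp q hq hpq hn with ⟨rfl, h1, h2⟩ | ⟨rfl, h1, h2⟩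
  · exact ⟨Or.inl rfl, Or.inr (hkl' q h1 h2)⟩
  · exact ⟨Or.inr (hkl' p h1 h2), Or.inl rfl⟩

end FlatSmallCases

section FlatSmallBounds

theorem min_degree_bound {n r m : ℤ} (hn : 5 * r + 19 ≤ n) (hr : 4 ≤ r) (hm : m ≤ r - 3) :
    r * (r - 1) + 2 * ((n - r) * m) < (2 * r - 5) * n - r ^ 2 + 4 * r - 2 := by
  nlinarith [mul_nonneg (sub_nonneg.2 hm) (by linarith : 0 ≤ n - r)]

theorem card_moderate_bound {n r l q : ℤ} (hn : 5 * r + 19 ≤ n) (hr : 4 ≤ r) (hl : l ≤ r)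
    (hqr : r + 1 ≤ q)
    (h : (2 * r - 5) * n - r ^ 2 + 4 * r - 2 ≤
      l * (q - 2) + (q - l) * (r - 1) + (n - q) * (r - 3)) : 3 * r + 2 ≤ q := by
  by_contra hq
  have h1 : l * (q - 2) + (q - l) * (r - 1) ≤ r * (q - 2) + (q - r) * (r - 1) := by
    nlinarith [mul_nonneg (sub_nonneg.2 hl) (by linarith : 0 ≤ q - 1 - r)]
  have h2 : (r - 2) * n + 5 * r - 2 ≤ (r + 2) * q := by linarith
  have h3 : (r + 2) * q ≤ (r + 2) * (3 * r + 1) :=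
    mul_le_mul_of_nonneg_left (by linarith) (by linarith)
  nlinarith [mul_nonneg (sub_nonneg.2 hn) (by linarith : 0 ≤ r - 2)]

theorem card_large_bound {n r l k : ℤ} (hn : 5 * r + 19 ≤ n) (hr : 4 ≤ r) (hk : k ≤ n - l)
    (h : (2 * r - 5) * n - r ^ 2 + 4 * r - 2 ≤ l * (l - 1) + (n - l) * (r - 2 + l) + k) :
    r ≤ l + 4 ∧ (l + 4 = r → 5 ≤ k) ∧ (l + 3 = r → 1 ≤ k) := by
  refine ⟨?_, ?_, ?_⟩
  · by_contra hl
    nlinarith [mul_nonneg (by linarith : 0 ≤ r - 5 - l) (by linarith : 0 ≤ n - r)]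
  · rintro rfl
    nlinarith
  · rintro rfl
    nlinarith

variable {V : Type*} [Fintype V] {G : SimpleGraph V} {S : Finset V} {m r : ℕ}

theorem PotNear.of_flat_small (hr : 4 ≤ r) (hn : 5 * r + 19 ≤ Fintype.card V)
    (hsum : (2 * (r : ℤ) - 5) * Fintype.card V - r ^ 2 + 4 * r - 2 ≤ ∑ w, (G.degree w : ℤ))
    (hS : #S = r + 1) (hm : ∀ s ∈ S, m ≤ G.degree s) (hout : ∀ w ∉ S, G.degree w ≤ m)
    (hflat : ∀ s ∈ S, G.degree s + 1 ≤ #{w ∈ Sᶜ | G.degree w = m} + r)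
    (hex : ∃ s ∈ S, G.degree s = m) (hmr : m < r) : PotNear G r := by
  obtain ⟨s, hs, hsm⟩ := hex
  have hn' : 5 * (r : ℤ) + 19 ≤ Fintype.card V := by exact_mod_cast hn
  have hr' : 4 ≤ (r : ℤ) := by exact_mod_cast hr
  rw [← Nat.cast_sum] at hsum
  have hm2 : r ≤ m + 2 := by
    by_contra hm2
    have cX : #(S.erase s) = r := by rw [card_erase_of_mem hs, hS]; rfl
    have cC : (#(S.erase s)ᶜ : ℤ) = Fintype.card V - r := by
      have := card_add_card_compl (S.erase s)
      omega
    have hX := sum_degree_le G (S.erase s)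
    have hle : ∀ w ∈ (S.erase s)ᶜ, G.degree w ≤ m := by
      intro w hw
      by_cases hws : w = s
      · rw [hws, hsm]
      · exact hout w fun k => (mem_compl.1 hw) (mem_erase.2 ⟨hws, k⟩)
    have h1 : ∑ w ∈ (S.erase s)ᶜ, G.degree w ≤ #(S.erase s)ᶜ • m := sum_le_card_nsmul _ _ _ hle
    have h2 : ∑ w ∈ (S.erase s)ᶜ, #(G.neighborFinset w ∩ S.erase s) ≤ #(S.erase s)ᶜ • m :=
      sum_le_card_nsmul _ _ _ fun w hw =>
        (card_le_card inter_subset_left).trans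
          ((card_neighborFinset_eq_degree G w).le.trans (hle w hw))
    have htot := sum_add_sum_compl (S.erase s) fun w => G.degree w
    rw [cX] at hX
    rw [smul_eq_mul] at h1 h2
    have h3 : ∑ w, G.degree w ≤ r * (r - 1) + 2 * (#(S.erase s)ᶜ * m) := by omega
    have h4 : ((∑ w, G.degree w : ℕ) : ℤ) ≤
        r * (r - 1) + 2 * ((Fintype.card V - r) * m) := by
      rw [← cC, show (r : ℤ) - 1 = ((r - 1 : ℕ) : ℤ) by omega]
      exact_mod_cast h3
    exact absurd (hsum.trans h4) (not_le.2 (min_degree_bound hn' hr' (by omega)))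
  set L : Finset V := {w | r ≤ G.degree w} with hL
  set Q : Finset V := {w | r ≤ G.degree w + 2} with hQ
  have memL : ∀ w, w ∈ L ↔ r ≤ G.degree w := by simp [hL]
  have memQ : ∀ w, w ∈ Q ↔ r ≤ G.degree w + 2 := by simp [hQ]
  have hLS : L ⊆ S.erase s := by
    intro w hw
    rw [memL] at hw
    refine mem_erase.2 ⟨by rintro rfl; omega, ?_⟩
    by_contra hwS
    have := hout w hwS
    omega
  have cL : #L ≤ r := by
    have := card_le_card hLS
    rw [card_erase_of_mem hs, hS] at this
    omega
  have hLQ : L ⊆ Q := fun w hw => (memQ w).2 (((memL w).1 hw).trans (by omega))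
  have hFQ : #{w ∈ Sᶜ | G.degree w = m} + (r + 1) ≤ #Q := by
    rw [← hS, ← card_union_of_disjoint]
    · refine card_le_card (union_subset ?_ fun w hw => ?_)
      · intro w hw
        rw [mem_filter] at hw
        rw [memQ]
        omega
      · have := hm w hw
        rw [memQ]
        omega
    · rw [Finset.disjoint_left]
      intro w hw hwS
      rw [mem_filter, mem_compl] at hw
      exact hw.1 hwS
  have cQ : #Q ≤ Fintype.card V := card_le_univ Q
  have hq : 3 * r + 2 ≤ #Q := by
    have h1 : ∑ w ∈ L, G.degree w ≤ #L • (#Q - 2) := sum_le_card_nsmul _ _ _ fun w hw => by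
      have := hflat w (mem_of_mem_erase (hLS hw))
      omega
    have h2 : ∑ w ∈ Q \ L, G.degree w ≤ #(Q \ L) • (r - 1) :=
      sum_le_card_nsmul _ _ _ fun w hw => by
        rw [mem_sdiff, memL] at hw
        omega
    have h3 : ∑ w ∈ Qᶜ, G.degree w ≤ #Qᶜ • (r - 3) := sum_le_card_nsmul _ _ _ fun w hw => by
      rw [mem_compl, memQ] at hw
      omega
    have htot := sum_add_sum_compl Q fun w => G.degree w
    have htot' := sum_sdiff (f := fun w => G.degree w) hLQ
    have c1 := card_sdiff_add_card_eq_card hLQ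
    have c2 := card_add_card_compl Q
    rw [smul_eq_mul] at h1 h2 h3
    have h4 : ∑ w, G.degree w ≤ #L * (#Q - 2) + #(Q \ L) * (r - 1) + #Qᶜ * (r - 3) := by omega
    have h5 : ((∑ w, G.degree w : ℕ) : ℤ) ≤
        #L * (#Q - 2) + (#Q - #L) * (r - 1) + (Fintype.card V - #Q) * (r - 3) := by
      rw [show (r : ℤ) - 1 = ((r - 1 : ℕ) : ℤ) by omega,
        show (r : ℤ) - 3 = ((r - 3 : ℕ) : ℤ) by omega,
        show (#Q : ℤ) - 2 = ((#Q - 2 : ℕ) : ℤ) by omega,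
        show (#Q : ℤ) - #L = (#(Q \ L) : ℤ) by omega,
        show (Fintype.card V : ℤ) - #Q = (#Qᶜ : ℤ) by omega]
      exact_mod_cast h4
    have := card_moderate_bound hn' hr' (by exact_mod_cast cL) (by omega) (hsum.trans h5)
    exact_mod_cast this
  set D : Finset V := {w | G.degree w + 1 = r} with hD
  have hDL : D ⊆ Lᶜ := by
    intro w hw
    rw [mem_compl, memL]
    simp only [hD, mem_filter, mem_univ, true_and] at hw
    omega
  have cD := card_le_card hDL
  have cLc := card_add_card_compl L
  have hbound : (r : ℤ) ≤ #L + 4 ∧ ((#L : ℤ) + 4 = r → 5 ≤ (#D : ℤ)) ∧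
      ((#L : ℤ) + 3 = r → 1 ≤ (#D : ℤ)) := by
    refine card_large_bound hn' hr' (by omega) (hsum.trans ?_)
    have hX := sum_degree_le G L
    have h1 : ∑ w ∈ Lᶜ, #(G.neighborFinset w ∩ L) ≤ #Lᶜ • #L :=
      sum_le_card_nsmul _ _ _ fun w _ => card_le_card inter_subset_right
    have h2 : ∑ w ∈ D, G.degree w ≤ #D • (r - 1) := sum_le_card_nsmul _ _ _ fun w hw => by
      simp only [hD, mem_filter, mem_univ, true_and] at hw
      omega
    have h3 : ∑ w ∈ Lᶜ \ D, G.degree w ≤ #(Lᶜ \ D) • (r - 2) :=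
      sum_le_card_nsmul _ _ _ fun w hw => by
        simp only [hD, mem_sdiff, mem_compl, memL, mem_filter, mem_univ, true_and] at hw
        omega
    have htot := sum_add_sum_compl L fun w => G.degree w
    have htot' := sum_sdiff (f := fun w => G.degree w) hDL
    have c1 := card_sdiff_add_card_eq_card hDL
    rw [smul_eq_mul] at h1 h2 h3
    have h4 : ∑ w, G.degree w ≤ #L * (#L - 1) + #Lᶜ * #L + #D * (r - 1) + #(Lᶜ \ D) * (r - 2) := by
      omega
    have h5 : ((∑ w, G.degree w : ℕ) : ℤ) ≤
        #L * (#L - 1) + #Lᶜ * #L + #D * (r - 1) + #(Lᶜ \ D) * (r - 2) := by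
      rw [show (r : ℤ) - 1 = ((r - 1 : ℕ) : ℤ) by omega,
        show (r : ℤ) - 2 = ((r - 2 : ℕ) : ℤ) by omega]
      rcases Nat.eq_zero_or_pos #L with h0 | h0
      · rw [h0] at h4 ⊢
        push_cast at h4 ⊢
        have : ((∑ w, G.degree w : ℕ) : ℤ) ≤
          ((0 * (0 - 1) + #Lᶜ * 0 + #D * (r - 1) + #(Lᶜ \ D) * (r - 2) : ℕ) : ℤ) := by
          exact_mod_cast h4
        simpa using this
      · rw [show (#L : ℤ) - 1 = ((#L - 1 : ℕ) : ℤ) by omega]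
        exact_mod_cast h4
    have e1 : (#Lᶜ : ℤ) = Fintype.card V - #L := by omega
    have e2 : (#(Lᶜ \ D) : ℤ) = Fintype.card V - #L - #D := by omega
    rw [e1, e2] at h5
    linarith
  obtain ⟨b1, b2, b3⟩ := hbound
  have hcases : #L + 4 = r ∨ #L + 3 = r ∨ #L + 2 = r ∨ #L + 1 = r ∨ #L = r := by omega
  rcases hcases with h | h | h | h | h
  · have hD5 : 5 ≤ #D := by omega
    exact .of_card_add_four hr h hq hD5
  · have hD1 : 1 ≤ #D := by omega
    exact .of_card_add_three (by omega) h hq hD1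
  · exact .of_card_add_two (by omega) h hq
  · exact .of_card_add_one (by omega) h hq
  · exact .of_card_eq (by omega) h hq

end FlatSmallBounds

section MainInduction

theorem exists_top_set {V : Type*} [Fintype V] (f : V → ℕ) {k : ℕ} (hk : k ≤ Fintype.card V) :
    ∃ S : Finset V, #S = k ∧ ∀ s ∈ S, ∀ w ∉ S, f w ≤ f s := by
  induction k with
  | zero => exact ⟨∅, rfl, by simp⟩
  | succ k ih =>
    obtain ⟨S, hS, htop⟩ := ih (by omega)
    have hne : Sᶜ.Nonempty := by
      rw [← card_pos]
      have := card_add_card_compl S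
      omega
    obtain ⟨v, hv, hmax⟩ := exists_max_image Sᶜ f hne
    rw [mem_compl] at hv
    refine ⟨insert v S, by rw [card_insert_of_notMem hv, hS], fun s hs w hw => ?_⟩
    rw [mem_insert, not_or] at hw
    rcases mem_insert.1 hs with rfl | hs
    · exact hmax w (mem_compl.2 hw.2)
    · exact htop s hs w hw.2

theorem PotNear.of_sum_three {V : Type*} [Fintype V] {G : SimpleGraph V}
    (hn : 4 ≤ Fintype.card V) (hsum : Fintype.card V < ∑ w, G.degree w) : PotNear G 3 := by
  obtain ⟨d, hd⟩ : ∃ d, 1 < G.degree d := by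
    by_contra! hcon
    have := sum_le_card_nsmul univ (fun w => G.degree w) 1 fun w _ => hcon w
    rw [smul_eq_mul, mul_one, card_univ] at this
    omega
  rw [← card_neighborFinset_eq_degree] at hd
  obtain ⟨b, hb, c, hc, hbc⟩ := one_lt_card.1 hd
  rw [mem_neighborFinset] at hb hc
  obtain ⟨a, ha⟩ : ({d, b, c} : Finset V)ᶜ.Nonempty := by
    rw [← card_pos]
    have := card_add_card_compl ({d, b, c} : Finset V)
    have := card_le_three (a := d) (b := b) (c := c)
    omega
  simp only [mem_compl, mem_insert, mem_singleton, not_or] at ha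
  obtain ⟨had, hab, hac⟩ := ha
  have hcard : #({a, b, c, d} : Finset V) = 4 := by
    rw [card_insert_of_notMem (by simp [hab, hac, had]),
      card_insert_of_notMem (by simp [hbc, hb.ne.symm]), card_pair hc.ne.symm]
  refine .of_near hcard (Or.inl ⟨a, by simp, b, by simp, c, by simp, d, by simp,
    by simp [hab, hac, had, hbc, hb.ne.symm, hc.ne.symm], fun p hp q hq hpq hn => ?_⟩)
  simp only [mem_insert, mem_singleton] at hp hq
  rcases hp with rfl | rfl | rfl | rfl <;> rcases hq with rfl | rfl | rfl | rfl <;>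
    first
    | exact absurd rfl hpq
    | exact absurd hb hn
    | exact absurd hc hn
    | exact absurd hb.symm hn
    | exact absurd hc.symm hn
    | simp [SamePair]

theorem PotNear.of_sum {r : ℕ} (hr : 3 ≤ r) : ∀ {V : Type*} [Fintype V] {G : SimpleGraph V},
    5 * r + 19 ≤ Fintype.card V →
    (2 * (r : ℤ) - 5) * Fintype.card V - r ^ 2 + 4 * r - 2 ≤ ∑ w, (G.degree w : ℤ) →
    PotNear G r := by
  induction r, hr using Nat.le_induction with
  | base =>
    intro V _ G hn hsum
    refine .of_sum_three (by omega) ?_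
    have : (Fintype.card V : ℤ) < ∑ w, (G.degree w : ℤ) := by
      push_cast at hsum
      linarith
    exact_mod_cast this
  | succ r hr ih =>
    intro V _ G hn hsum
    obtain ⟨S, hS, htop⟩ := exists_top_set (fun w => G.degree w)
      (by omega : r + 1 + 1 ≤ Fintype.card V)
    have hSne : S.Nonempty := card_pos.1 (by omega)
    obtain ⟨v, hv, hmax⟩ := exists_max_image S (fun w => G.degree w) hSne
    obtain ⟨s, hs, hmin⟩ := exists_min_image S (fun w => G.degree w) hSne
    have hout : ∀ w ∉ S, G.degree w ≤ G.degree s := htop s hs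
    by_cases hlarge : #{w ∈ Sᶜ | G.degree w = G.degree s} + r + 1 ≤ G.degree v
    · refine .of_large_degree hS hv hmin hout hlarge fun G' hd G₁ hG₁ => ih ?_ ?_
      · rw [Fintype.card_subtype_compl, Fintype.card_subtype_eq]
        omega
      · have h1 := sum_degree_comap_ne hG₁
        have h2 : G'.degree v < Fintype.card V := G'.degree_lt_card_verts v
        simp only [hd] at h1 h2
        have h3 : ((Fintype.card {x // x ≠ v} : ℕ) : ℤ) = Fintype.card V - 1 := by
          rw [Fintype.card_subtype_compl, Fintype.card_subtype_eq]
          omega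
        rw [← Nat.cast_sum] at hsum ⊢
        rw [h3]
        push_cast at hsum
        have h4 : ((∑ x, G₁.degree x : ℕ) : ℤ) + 2 * G.degree v = (∑ x, G.degree x : ℕ) := by
          exact_mod_cast h1
        have h5 : (G.degree v : ℤ) + 1 ≤ Fintype.card V := by exact_mod_cast h2
        push_cast at h4 ⊢
        linarith
    · have hflat : ∀ w ∈ S, G.degree w + 1 ≤ #{w ∈ Sᶜ | G.degree w = G.degree s} + (r + 1) := by
        intro w hw
        have : G.degree w ≤ G.degree v := hmax w hw
        omega
      by_cases hmr : r + 1 ≤ G.degree s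
      · exact .of_flat_large (by omega) hn hsum hS hmin hout hflat hmr
      · exact .of_flat_small (by omega) hn hsum hS hmin hout hflat ⟨s, hs, rfl⟩ (by omega)

end MainInduction

section Embedding

theorem exists_embedding_extending {α β ι : Type*} [Fintype α] [Nonempty ι] {t : Finset β}
    (ht : Fintype.card α = #t) {x : ι → α} (hx : x.Injective) {y : ι → β} (hy : y.Injective)
    (hyt : ∀ i, y i ∈ t) : ∃ g : α ↪ β, (∀ a, g a ∈ t) ∧ ∀ i, g (x i) = y i := by
  have hinv := Function.leftInverse_invFun hx
  obtain ⟨g, hg⟩ := Set.MapsTo.exists_equiv_extend_of_card_eq ht (s := Set.range x)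
    (f := y ∘ Function.invFun x) (fun a _ => hyt _) (by
      rintro _ ⟨i, rfl⟩ _ ⟨j, rfl⟩ h
      simp only [Function.comp_apply, hinv i, hinv j] at h
      rw [hy h])
  refine ⟨g.toEmbedding.trans (Function.Embedding.subtype _), fun a => (g a).2, fun i => ?_⟩
  have := hg (x i) ⟨i, rfl⟩
  rw [Function.comp_apply, hinv i] at this
  exact this

/-- If the missing pairs of an `m`-set `Y` lie in an image of part of `Z`, then `K_m - Z` embeds
in `Y`. -/
theorem containsCopy_KsubH {β ι : Type*} [Nonempty ι] {G : SimpleGraph β} {Y : Finset β} {m k : ℕ}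
    {h : k ≤ m} {Z : SimpleGraph (Fin k)} (hY : #Y = m) {x : ι → Fin k} (hx : x.Injective)
    {y : ι → β} (hy : y.Injective) (hyY : ∀ i, y i ∈ Y)
    (hmiss : ∀ p ∈ Y, ∀ q ∈ Y, p ≠ q → ¬ G.Adj p q →
      ∃ i j, Z.Adj (x i) (x j) ∧ SamePair (y i) (y j) p q) :
    ContainsCopy G (KsubH m k h Z) := by
  obtain ⟨g, hgY, hg⟩ := exists_embedding_extending (α := Fin m) (by simp [hY])
    ((Fin.castLEEmb h).injective.comp hx) hy hyY
  refine ⟨g, fun u v huv => ?_⟩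
  simp only [KsubH, sdiff_adj, top_adj] at huv
  by_contra hn
  obtain ⟨i, j, hij, k | k⟩ :=
    hmiss _ (hgY u) _ (hgY v) (fun k => huv.1 (g.injective k)) hn
  · rw [← hg, ← hg] at k
    rw [g.injective k.1, g.injective k.2] at huv
    exact huv.2 ((map_adj ..).2 ⟨_, _, hij, rfl, rfl⟩)
  · rw [← hg, ← hg] at k
    rw [g.injective k.1, g.injective k.2] at huv
    exact huv.2 ((map_adj ..).2 ⟨_, _, hij.symm, rfl, rfl⟩)

theorem not_four_cycle {α : Type*} {Z : SimpleGraph α} (hC4 : ¬ ContainsCopy Z C4) {a b c d : α}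
    (hac : a ≠ c) (hbd : b ≠ d) (hab : Z.Adj a b) (hbc : Z.Adj b c) (hcd : Z.Adj c d)
    (hda : Z.Adj d a) : False := by
  have hinj : Function.Injective ![a, b, c, d] := by
    rw [← List.nodup_ofFn]
    simp [hac, hbd, hab.ne, hbc.ne, hcd.ne, hda.ne.symm]
  refine hC4 ⟨⟨_, hinj⟩, fun u v huv => ?_⟩
  fin_cases u <;> fin_cases v <;>
    simp [C4, hab, hbc, hcd, hda, hab.symm, hbc.symm, hcd.symm, hda.symm] at huv ⊢

theorem exists_triangle_pendant {α : Type*} {Z : SimpleGraph α} (hZ4 : ContainsCopy Z Z4) :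
    ∃ a b c d, [a, b, c, d].Nodup ∧ Z.Adj a b ∧ Z.Adj a c ∧ Z.Adj b c ∧ Z.Adj a d := by
  obtain ⟨f, hf⟩ := hZ4
  refine ⟨f 3, f 0, f 2, f 1, ?_, hf _ _ ?_, hf _ _ ?_, hf _ _ ?_, hf _ _ ?_⟩ <;> simp [Z4]

theorem exists_path_edge {α : Type*} {Z : SimpleGraph α} (hC4 : ¬ ContainsCopy Z C4)
    (hedges : 4 < Z.edgeSet.ncard) {a b c d : α} (hnd : [a, b, c, d].Nodup) (hab : Z.Adj a b)
    (hac : Z.Adj a c) (hbc : Z.Adj b c) (had : Z.Adj a d) :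
    ∃ a b c d e, [a, b, c, d, e].Nodup ∧ Z.Adj a b ∧ Z.Adj a c ∧ Z.Adj d e := by
  have nbd : b ≠ d := by rintro rfl; simp at hnd
  have ncd : c ≠ d := by rintro rfl; simp at hnd
  obtain ⟨p, q, hpq, hout⟩ : ∃ p q, Z.Adj p q ∧
      s(p, q) ∉ ({s(a, b), s(a, c), s(b, c), s(a, d)} : Finset (Sym2 α)) := by
    by_contra! hcon
    have hsub : Z.edgeSet ⊆ (({s(a, b), s(a, c), s(b, c), s(a, d)} : Finset (Sym2 α)) : Set _) := by
      intro e he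
      induction e with | _ p q => exact hcon p q he
    have := Set.ncard_le_ncard hsub (Finset.finite_toSet _)
    rw [Set.ncard_coe_finset] at this
    have := this.trans card_le_four
    omega
  simp only [mem_insert, mem_singleton, Sym2.eq_iff, not_or] at hout
  have key : ∀ e q, Z.Adj e q → e ≠ a → e ≠ b → e ≠ c → e ≠ d →
      ∃ a b c d e, [a, b, c, d, e].Nodup ∧ Z.Adj a b ∧ Z.Adj a c ∧ Z.Adj d e := by
    intro e q heq ea eb ec ed
    by_cases qa : q = a
    · subst qa
      exact ⟨q, d, e, b, c, by simp [had.ne, ea.symm, hab.ne, hac.ne, ed.symm, nbd.symm, ncd.symm,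
        eb, ec, hbc.ne], had, heq.symm, hbc⟩
    by_cases qb : q = b
    · subst qb
      exact ⟨a, c, d, q, e, by simp [had.ne, ea.symm, hab.ne, hac.ne, ed.symm, nbd.symm, ncd,
        eb.symm, ec.symm, hbc.ne.symm], hac, had, heq.symm⟩
    by_cases qc : q = c
    · subst qc
      exact ⟨a, b, d, q, e, by simp [had.ne, ea.symm, hab.ne, hac.ne, ed.symm, nbd, ncd.symm,
        eb.symm, ec.symm, hbc.ne], hab, had, heq.symm⟩
    exact ⟨a, b, c, q, e, by simp [ea.symm, hab.ne, hac.ne, eb.symm, ec.symm, hbc.ne,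
      Ne.symm qa, Ne.symm qb, Ne.symm qc, heq.ne.symm], hab, hac, heq.symm⟩
  by_cases hp : p ≠ a ∧ p ≠ b ∧ p ≠ c ∧ p ≠ d
  · exact key p q hpq hp.1 hp.2.1 hp.2.2.1 hp.2.2.2
  by_cases hq : q ≠ a ∧ q ≠ b ∧ q ≠ c ∧ q ≠ d
  · exact key q p hpq.symm hq.1 hq.2.1 hq.2.2.1 hq.2.2.2
  exfalso
  have hbd : ¬ Z.Adj b d := fun k => not_four_cycle hC4 hab.ne.symm ncd.symm k had.symm hac
    hbc.symm
  have hcd : ¬ Z.Adj c d := fun k => not_four_cycle hC4 hac.ne.symm nbd.symm k had.symm hab hbc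
  have hp' : p = a ∨ p = b ∨ p = c ∨ p = d := by
    by_contra! hcon
    exact hp hcon
  have hq' : q = a ∨ q = b ∨ q = c ∨ q = d := by
    by_contra! hcon
    exact hq hcon
  rcases hp' with rfl | rfl | rfl | rfl <;> rcases hq' with rfl | rfl | rfl | rfl <;>
    first
    | exact hpq.ne rfl
    | exact hbd hpq
    | exact hbd hpq.symm
    | exact hcd hpq
    | exact hcd hpq.symm
    | simp at hout

end Embedding

/-- For `n ≥ 5r + 19`, `r + 1 ≥ k ≥ 5`, `j ≥ 5`, and `Z` a graph on `k` vertices and `j`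
edges which contains `Z₄` but contains no cycle on 4 vertices: every `n`-term graphic
sequence `π` with `σ(π) ≥ (r-1)(2n-r) - 3(n-r) - 1` if `n - r` is odd, and
`σ(π) ≥ (r-1)(2n-r) - 3(n-r) - 2` if `n - r` is even, is potentially
`K_{r+1} - Z`-graphic. -/
theorem stmt3 (r k j n : ℕ) (hn : 5 * r + 19 ≤ n) (hk5 : 5 ≤ k) (hkr : k ≤ r + 1)
    (hj : 5 ≤ j) (Z : SimpleGraph (Fin k)) (hedges : Z.edgeSet.ncard = j)
    (hZ4 : ContainsCopy Z Z4) (hC4 : ¬ ContainsCopy Z C4)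
    (d : Fin n → ℕ) (hgraphic : IsGraphic d)
    (hσ : (if Odd (n - r)
        then ((r : ℤ) - 1) * (2 * (n : ℤ) - r) - 3 * ((n : ℤ) - r) - 1
        else ((r : ℤ) - 1) * (2 * (n : ℤ) - r) - 3 * ((n : ℤ) - r) - 2)
      ≤ ∑ i, (d i : ℤ)) :
    PotentiallyGraphic d (KsubH (r + 1) k hkr Z) := by
  obtain ⟨-, G, hG⟩ := hgraphic
  have hT : (2 * (r : ℤ) - 5) * Fintype.card (Fin n) - r ^ 2 + 4 * r - 2 ≤
      ∑ i, (G.degree i : ℤ) := by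
    simp only [hG _, Fintype.card_fin]
    split_ifs at hσ <;> linarith
  obtain ⟨G', hd, Y, hY, hN⟩ := PotNear.of_sum (by omega : 3 ≤ r) (by simpa using hn) hT
  refine ⟨G', fun i => (hd i).trans (hG i), ?_⟩
  obtain ⟨a', b', c', d', hnd', hab', hac', hbc', had'⟩ := exists_triangle_pendant hZ4
  rcases hN with ⟨a, ha, b, hb, c, hc, e, he, hnd, hmiss⟩ |
    ⟨a, ha, b, hb, c, hc, e, he, f, hf, hnd, hmiss⟩
  · refine containsCopy_KsubH (x := ![a', b', c', d']) (y := ![a, b, c, e]) hY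
      (by rw [← List.nodup_ofFn]; simpa using hnd') (by rw [← List.nodup_ofFn]; simpa using hnd)
      (fun i => by fin_cases i <;> simpa) fun p hp q hq hpq hn => ?_
    rcases hmiss p hp q hq hpq hn with k | k | k | k
    · exact ⟨0, 1, hab', k⟩
    · exact ⟨0, 2, hac', k⟩
    · exact ⟨1, 2, hbc', k⟩
    · exact ⟨0, 3, had', k⟩
  · obtain ⟨a', b', c', d', e', hnd', hab', hac', hde'⟩ :=
      exists_path_edge hC4 (by omega) hnd' hab' hac' hbc' had'
    refine containsCopy_KsubH (x := ![a', b', c', d', e']) (y := ![a, b, c, e, f]) hY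
      (by rw [← List.nodup_ofFn]; simpa using hnd') (by rw [← List.nodup_ofFn]; simpa using hnd)
      (fun i => by fin_cases i <;> simpa) fun p hp q hq hpq hn => ?_
    rcases hmiss p hp q hq hpq hn with k | k | k
    · exact ⟨0, 1, hab', k⟩
    · exact ⟨0, 2, hac', k⟩
    · exact ⟨3, 4, hde', k⟩
end

section
/- Let r ≥ 2 and n ≥ 2r be integers, and let π = (d_1, d_2, ..., d_n) be an n-term graphic sequence with d_{r−1} ≥ r and d_{r+1} ≥ r−1. If d_i ≥ 2r−i for every i = 1, 2, ..., r−2, then π is potentially K_{r+1} − e-graphic. -/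
open SimpleGraph Finset
open scoped Classical

/-- `G` has degree function `d`; degrees are counted by filtering the vertex set. -/
def HasDegrees {V : Type*} [Fintype V] (G : SimpleGraph V) (d : V → ℕ) : Prop :=
  ∀ v, #{u | G.Adj v u} = d v

/-- Any finite set contains `k` elements on which `f` is largest. -/
lemma exists_top_subset {V : Type*} (f : V → ℕ) (s : Finset V) (k : ℕ) (hk : k ≤ #s) :
    ∃ W ⊆ s, #W = k ∧ ∀ x ∈ W, ∀ y ∈ s, y ∉ W → f y ≤ f x := by
  induction k with
  | zero => exact ⟨∅, by simp, by simp, by simp⟩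
  | succ k ih =>
    obtain ⟨W, hWs, hWk, hW⟩ := ih (by omega)
    have hne : (s \ W).Nonempty := by
      rw [← Finset.card_pos, Finset.card_sdiff_of_subset hWs]
      omega
    obtain ⟨z, hz, hmax⟩ := Finset.exists_max_image (s \ W) f hne
    rw [Finset.mem_sdiff] at hz
    refine ⟨insert z W, ?_, ?_, ?_⟩
    · exact Finset.insert_subset hz.1 hWs
    · rw [Finset.card_insert_of_notMem hz.2, hWk]
    · intro x hx y hy hyW
      rw [Finset.mem_insert, not_or] at hyW
      rcases Finset.mem_insert.1 hx with rfl | hx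
      · exact hmax y (Finset.mem_sdiff.2 ⟨hy, hyW.2⟩)
      · exact hW x hx y hy hyW.2

/-- Joining an isolated vertex `v` to the set `W`. -/
lemma exists_hasDegrees_add_star {V : Type*} [Fintype V] {G : SimpleGraph V} {f d : V → ℕ}
    (hG : HasDegrees G f) (v : V) (W : Finset V) (hvW : v ∉ W) (hfv : f v = 0)
    (hdv : d v = #W) (hdW : ∀ x ∈ W, d x = f x + 1) (hd : ∀ x, x ≠ v → x ∉ W → d x = f x) :
    ∃ G' : SimpleGraph V, HasDegrees G' d ∧ G ≤ G' ∧ ∀ x ∈ W, G'.Adj v x := by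
  have hiso : ∀ x, ¬ G.Adj v x := by
    intro x hx
    have h := hG v
    rw [hfv, Finset.card_eq_zero] at h
    exact Finset.notMem_empty x (h ▸ by simpa using hx)
  let G' : SimpleGraph V :=
    { Adj := fun x y => G.Adj x y ∨ (x = v ∧ y ∈ W) ∨ (y = v ∧ x ∈ W)
      symm := ⟨fun x y h => by rw [G.adj_comm y x]; tauto⟩
      loopless := ⟨fun x h => by
        rcases h with h | ⟨rfl, h⟩ | ⟨rfl, h⟩
        · exact G.loopless.irrefl _ h
        · exact hvW h
        · exact hvW h⟩ }
  have hadj : ∀ x y, G'.Adj x y ↔ G.Adj x y ∨ (x = v ∧ y ∈ W) ∨ (y = v ∧ x ∈ W) :=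
    fun x y => Iff.rfl
  refine ⟨G', ?_, ?_, ?_⟩
  · intro x
    by_cases hxv : x = v
    · subst hxv
      rw [hdv]
      congr 1
      ext y
      simp [hadj, hiso, hvW]
    · by_cases hxW : x ∈ W
      · rw [hdW x hxW, ← hG x, ← Finset.card_insert_of_notMem (a := v)]
        · congr 1
          ext y
          simp [hadj, hxv, hxW, or_comm]
        · simpa using fun h => hiso x (G.symm.symm _ _ h)
      · rw [hd x hxv hxW, ← hG x]
        congr 1
        ext y
        simp [hadj, hxv, hxW]
  · exact fun x y h => Or.inl h
  · exact fun x hx => Or.inr (Or.inl ⟨rfl, hx⟩)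

/-- A function with even sum whose maximum is at most `M`, with at least `M + 1` values that are
at least `M - 1`, is a degree function. -/
lemma exists_hasDegrees_of_flat {V : Type*} [Fintype V] (N : ℕ) :
    ∀ (f : V → ℕ) (M : ℕ), M + ∑ x, f x ≤ N → (∀ x, f x ≤ M) →
      M + 1 ≤ #{x | M ≤ f x + 1} → Even (∑ x, f x) → ∃ G : SimpleGraph V, HasDegrees G f := by
  induction N with
  | zero =>
    intro f M hN hM _ _
    refine ⟨⊥, fun v => ?_⟩
    have := hM v
    simp
    omega
  | succ N ih =>
    intro f M hN hM hS heven
    rcases Nat.eq_zero_or_pos M with rfl | hMpos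
    · refine ⟨⊥, fun v => ?_⟩
      have := hM v
      simp
      omega
    by_cases hmax : ∃ v, f v = M
    swap
    · push Not at hmax
      refine ih f (M - 1) (by omega) (fun x => ?_) ?_ heven
      · have := hM x
        have := hmax x
        omega
      · calc M - 1 + 1 ≤ #{x | M ≤ f x + 1} := by omega
          _ ≤ _ := Finset.card_le_card (Finset.monotone_filter_right _ fun x _ (h : M ≤ f x + 1) => by omega)
    obtain ⟨v, hv⟩ := hmax
    set S : Finset V := {x | M ≤ f x + 1} with hSdef
    have hvS : v ∈ S := by simp [hSdef, hv]
    have hSv : #(S.erase v) = #S - 1 := Finset.card_erase_of_mem hvS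
    have hk : M ≤ #((univ : Finset V).erase v) :=
      (by omega : M ≤ #(S.erase v)).trans
        (Finset.card_le_card (Finset.erase_subset_erase _ (Finset.subset_univ _)))
    obtain ⟨W, hWs, hWk, hW⟩ := exists_top_subset f _ M hk
    have hvW : v ∉ W := fun h => by simpa using hWs h
    have hW' : ∀ x ∈ W, ∀ y, y ≠ v → y ∉ W → f y ≤ f x := fun x hx y hy hyW =>
      hW x hx y (by simpa using hy) hyW
    have hWS : ∀ x ∈ W, M ≤ f x + 1 := by
      intro x hx
      by_contra hlt
      have hsub : S.erase v ⊆ W.erase x := by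
        intro y hy
        rw [Finset.mem_erase] at hy
        have hyS : M ≤ f y + 1 := by simpa [hSdef] using hy.2
        have hyW : y ∈ W := by
          by_contra hyW
          have := hW' x hx y hy.1 hyW
          omega
        refine Finset.mem_erase.2 ⟨?_, hyW⟩
        rintro rfl
        omega
      have h1 := Finset.card_le_card hsub
      rw [Finset.card_erase_of_mem hx] at h1
      omega
    have hWpos : ∀ x ∈ W, 1 ≤ f x := by
      intro x hx
      by_contra hlt
      have h1 := hWS x hx
      have hM1 : M = 1 := by omega
      have hWx : W = {x} := by
        obtain ⟨y, hy⟩ := Finset.card_eq_one.1 (hWk.trans hM1)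
        rw [hy] at hx ⊢
        rw [Finset.mem_singleton.1 hx]
      have hsum : ∑ y, f y = f v := by
        refine Finset.sum_eq_single v (fun y _ hy => ?_) (by simp)
        by_cases hyx : y = x
        · subst hyx; omega
        · have := hW' x hx y hy (by simpa [hWx] using hyx)
          omega
      rw [hsum, hv, hM1] at heven
      exact absurd heven (by decide)
    let f' : V → ℕ := fun x => if x = v then 0 else if x ∈ W then f x - 1 else f x
    have hf'v : f' v = 0 := by simp [f']
    have hf'W : ∀ x ∈ W, f x = f' x + 1 := by
      intro x hx
      have hxv : x ≠ v := fun h => hvW (h ▸ hx)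
      have := hWpos x hx
      simp [f', hxv, hx]
      omega
    have hf'o : ∀ x, x ≠ v → x ∉ W → f x = f' x := by
      intro x hxv hx
      simp [f', hxv, hx]
    have hsum : ∑ x, f x = ∑ x, f' x + 2 * M := by
      have hpt : ∀ x, f x = f' x + ((if x = v then M else 0) + if x ∈ W then 1 else 0) := by
        intro x
        by_cases hxv : x = v
        · subst hxv; simp [hf'v, hvW, hv]
        · by_cases hx : x ∈ W
          · simp [hxv, hx, hf'W x hx]
          · simp [hxv, hx, hf'o x hxv hx]
      rw [Finset.sum_congr rfl fun x _ => hpt x, Finset.sum_add_distrib, Finset.sum_add_distrib]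
      simp [hWk]
      omega
    have heven' : Even (∑ x, f' x) := by
      rw [hsum] at heven
      exact (Nat.even_add.1 heven).2 (by simp)
    have hreal : ∃ G : SimpleGraph V, HasDegrees G f' := by
      by_cases hy : ∃ y, y ≠ v ∧ y ∉ W ∧ f y = M
      · obtain ⟨y, hyv, hyW, hyM⟩ := hy
        refine ih f' M (by omega) (fun x => ?_) ?_ heven'
        · have := hM x
          simp only [f']
          split_ifs <;> omega
        · rw [← hWk, ← Finset.card_insert_of_notMem hyW, hWk]
          refine Finset.card_le_card fun x hx => ?_
          simp only [Finset.mem_filter, Finset.mem_univ, true_and]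
          rcases Finset.mem_insert.1 hx with rfl | hx
          · rw [← hf'o x hyv hyW]; omega
          · have h1 := hf'W x hx
            have h2 := hW' x hx y hyv hyW
            omega
      · push Not at hy
        refine ih f' (M - 1) (by omega) (fun x => ?_) ?_ heven'
        · by_cases hxv : x = v
          · simp [hxv, hf'v]
          · have h1 := hM x
            by_cases hx : x ∈ W
            · have := hf'W x hx; omega
            · have := hf'o x hxv hx
              have := hy x hxv hx
              omega
        · calc M - 1 + 1 ≤ #(S.erase v) := by omega
            _ ≤ _ := Finset.card_le_card fun x hx => by
              rw [Finset.mem_erase] at hx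
              have h1 : M ≤ f x + 1 := by simpa [hSdef] using hx.2
              simp only [Finset.mem_filter, Finset.mem_univ, true_and]
              by_cases hxW : x ∈ W
              · have := hf'W x hxW; omega
              · have := hf'o x hx.1 hxW; omega
    obtain ⟨G, hG⟩ := hreal
    obtain ⟨G', hG', -⟩ := exists_hasDegrees_add_star hG v W hvW hf'v (hv.trans hWk.symm) hf'W hf'o
    exact ⟨G', hG'⟩

/-- Switching the edges `vx`, `yz` to `vy`, `xz` preserves degrees. -/
lemma exists_hasDegrees_switch {V : Type*} [Fintype V] {G : SimpleGraph V} {d : V → ℕ}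
    (hG : HasDegrees G d) {v x y z : V} (hvx : G.Adj v x) (hvy : ¬ G.Adj v y) (hne : y ≠ v)
    (hyz : G.Adj y z) (hxz : ¬ G.Adj x z) (hzx : z ≠ x) :
    ∃ G' : SimpleGraph V, HasDegrees G' d ∧
      ({u | G'.Adj v u} : Finset V) = insert y (({u | G.Adj v u} : Finset V).erase x) := by
  have hxy : x ≠ y := by rintro rfl; exact hvy hvx
  have hzv : z ≠ v := by rintro rfl; exact hvy hyz.symm
  have hvx' := hvx.ne
  have hyz' := hyz.ne
  have hxv : G.Adj x v := hvx.symm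
  have hzy : G.Adj z y := hyz.symm
  have hyv : ¬ G.Adj y v := fun h => hvy h.symm
  have hzx' : ¬ G.Adj z x := fun h => hxz h.symm
  obtain ⟨G', hadj⟩ : ∃ G' : SimpleGraph V, ∀ a b, G'.Adj a b ↔
      (G.Adj a b ∧ ¬ (a = v ∧ b = x) ∧ ¬ (a = x ∧ b = v) ∧
        ¬ (a = y ∧ b = z) ∧ ¬ (a = z ∧ b = y)) ∨
      (a = v ∧ b = y) ∨ (a = y ∧ b = v) ∨ (a = x ∧ b = z) ∨ (a = z ∧ b = x) := by
    refine ⟨⟨_, ⟨?_⟩, ⟨?_⟩⟩, fun a b => Iff.rfl⟩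
    · rintro a b (⟨h, h1, h2, h3, h4⟩ | h | h | h | h)
      · exact Or.inl ⟨h.symm, fun e => h2 e.symm, fun e => h1 e.symm, fun e => h4 e.symm,
          fun e => h3 e.symm⟩
      · exact Or.inr (Or.inr (Or.inl h.symm))
      · exact Or.inr (Or.inl h.symm)
      · exact Or.inr (Or.inr (Or.inr (Or.inr h.symm)))
      · exact Or.inr (Or.inr (Or.inr (Or.inl h.symm)))
    · rintro a (h | ⟨rfl, h⟩ | ⟨rfl, h⟩ | ⟨rfl, h⟩ | ⟨rfl, h⟩)
      · exact G.loopless.irrefl a h.1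
      · exact hne h.symm
      · exact hne h
      · exact hzx h.symm
      · exact hzx h
  have hcard : ∀ a b c : V, G.Adj a b → ¬ G.Adj a c →
      (∀ u, G'.Adj a u ↔ u = c ∨ u ≠ b ∧ G.Adj a u) → #{u | G'.Adj a u} = d a := by
    intro a b c hab hac h
    have : ({u | G'.Adj a u} : Finset V) = insert c (({u | G.Adj a u} : Finset V).erase b) := by
      ext u
      simp [h]
    rw [this, Finset.card_insert_of_notMem (by simp [hac]),
      Finset.card_erase_of_mem (by simpa using hab), ← hG a]
    have : 0 < #({u | G.Adj a u} : Finset V) := Finset.card_pos.2 ⟨b, by simpa using hab⟩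
    omega
  have hv : ∀ u, G'.Adj v u ↔ u = y ∨ u ≠ x ∧ G.Adj v u := by
    intro u
    rw [hadj]
    simp only [hvx', hne.symm, hzv.symm, false_and, true_and, not_false_eq_true, and_true, or_false]
    rw [or_comm, and_comm]
  refine ⟨G', fun a => ?_, ?_⟩
  · by_cases h1 : a = v
    · exact h1 ▸ hcard v x y hvx hvy hv
    by_cases h2 : a = x
    · refine h2 ▸ hcard x v z hxv hxz fun u => ?_
      rw [hadj]
      simp only [hvx'.symm, hxy, hzx.symm, false_and, true_and, not_false_eq_true, and_true,
        or_false, false_or]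
      rw [or_comm, and_comm]
    by_cases h3 : a = y
    · refine h3 ▸ hcard y z v hyz hyv fun u => ?_
      rw [hadj]
      simp only [hne, hxy.symm, hyz', false_and, true_and, not_false_eq_true, and_true,
        or_false, false_or]
      rw [or_comm, and_comm]
    by_cases h4 : a = z
    · refine h4 ▸ hcard z y x hzy hzx' fun u => ?_
      rw [hadj]
      simp only [hzv, hzx, hyz'.symm, false_and, true_and, not_false_eq_true,
        false_or]
      rw [or_comm, and_comm]
    · rw [← hG a]
      congr 1
      ext u
      simp [hadj, h1, h2, h3, h4]
  · ext u
    simp [hv]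

/-- A realization in which the neighbourhood of `v` consists of vertices of largest weight, for
any weight compatible with the degrees. -/
lemma exists_hasDegrees_top_neighbors {V : Type*} [Fintype V] {G : SimpleGraph V} {d : V → ℕ}
    (hG : HasDegrees G d) (v : V) (w : V → ℕ) (hw : ∀ x y, w x < w y → d x ≤ d y) :
    ∃ G' : SimpleGraph V, HasDegrees G' d ∧
      ∀ x y, G'.Adj v x → ¬ G'.Adj v y → y ≠ v → w y ≤ w x := by
  obtain ⟨H, hH, hmax⟩ := Set.exists_max_image {H : SimpleGraph V | HasDegrees H d}
    (fun H => ∑ u with H.Adj v u, w u) (Set.toFinite _) ⟨G, hG⟩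
  refine ⟨H, hH, fun x y hx hy hyv => ?_⟩
  by_contra hlt
  push Not at hlt
  have hxy : x ≠ y := by rintro rfl; exact hy hx
  have hex : ∃ z, H.Adj y z ∧ ¬ H.Adj x z ∧ z ≠ x := by
    by_contra hno
    push Not at hno
    have hsub : (({u | H.Adj y u} : Finset V).erase x) ⊂ (({u | H.Adj x u} : Finset V).erase y) := by
      rw [Finset.ssubset_iff_of_subset]
      · exact ⟨v, by simpa using ⟨hyv.symm, hx.symm⟩, by simpa using fun _ h => hy (H.symm.symm _ _ h)⟩
      · intro z hz
        simp only [Finset.mem_erase, Finset.mem_filter, Finset.mem_univ, true_and] at hz ⊢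
        refine ⟨fun h => H.loopless.irrefl y (h ▸ hz.2), ?_⟩
        by_contra h
        exact hz.1 (hno z hz.2 h)
    have hcard := Finset.card_lt_card hsub
    have hd := hw x y hlt
    rw [← hH x, ← hH y] at hd
    by_cases hadj : H.Adj x y
    · rw [Finset.card_erase_of_mem (by simpa using hadj.symm),
        Finset.card_erase_of_mem (by simpa using hadj)] at hcard
      omega
    · rw [Finset.erase_eq_of_notMem (by simpa using fun h => hadj (H.symm.symm _ _ h)),
        Finset.erase_eq_of_notMem (by simpa using hadj)] at hcard
      omega
  obtain ⟨z, hyz, hxz, hzx⟩ := hex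
  obtain ⟨H', hH', hN⟩ := exists_hasDegrees_switch hH hx hy hyv hyz hxz hzx
  have hle := hmax H' hH'
  rw [hN, Finset.sum_insert (by simp [hy])] at hle
  have := Finset.add_sum_erase ({u | H.Adj v u} : Finset V) w (by simpa using hx)
  omega

/-- Lowering `f` by one on `w` vertices of largest value keeps the lowered values near the top. -/
lemma exists_lower_step {V : Type*} [Fintype V] {d f : V → ℕ} {C : Finset V} {m w : ℕ}
    (hfd : ∀ x, f x ≤ d x) (hdm : ∀ x, d x ≤ m) (hC : ∀ x ∈ C, d x = m)
    (hinv : ∀ x y, f x < d x → f y ≤ f x + 1) (hw : w ≤ #C) (hsum : w ≤ ∑ x, f x) :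
    ∃ (W : Finset V) (f' : V → ℕ), #W = w ∧ (∀ x, f x = f' x + if x ∈ W then 1 else 0) ∧
      ∀ x y, f' x < d x → f' y ≤ f' x + 1 := by
  obtain ⟨W, -, hWw, hW⟩ := exists_top_subset f univ w (hw.trans (Finset.card_le_univ C))
  have hCtop : ∀ x ∈ C, ∀ y, f y ≤ f x + 1 := by
    intro x hx y
    rcases (hfd x).lt_or_eq with h | h
    · exact hinv x y h
    · have := hfd y
      have := hdm y
      have := hC x hx
      omega
  have hWtop : ∀ x ∈ W, ∀ y, f y ≤ f x + 1 := by
    intro x hx y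
    by_contra hlt
    have hsub : C ⊆ W.erase x := by
      intro z hz
      have h1 := hCtop z hz y
      refine Finset.mem_erase.2 ⟨?_, ?_⟩
      · rintro rfl
        omega
      · by_contra hzW
        have := hW x hx z (Finset.mem_univ z) hzW
        omega
    have h1 := Finset.card_le_card hsub
    rw [Finset.card_erase_of_mem hx] at h1
    have : 0 < #W := Finset.card_pos.2 ⟨x, hx⟩
    omega
  have hWpos : ∀ x ∈ W, 1 ≤ f x := by
    intro x hx
    by_contra hlt
    have hle : ∑ y, f y ≤ ∑ y, if y ∈ W.erase x then 1 else 0 := by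
      refine Finset.sum_le_sum fun y _ => ?_
      split_ifs with hy
      · have := hWtop x hx y
        omega
      · by_cases hyW : y ∈ W
        · have : y = x := by
            by_contra h
            exact hy (Finset.mem_erase.2 ⟨h, hyW⟩)
          subst this
          omega
        · have := hW x hx y (Finset.mem_univ y) hyW
          omega
    rw [Finset.sum_boole, Finset.filter_univ_mem, Finset.card_erase_of_mem hx] at hle
    have : 0 < #W := Finset.card_pos.2 ⟨x, hx⟩
    simp only [Nat.cast_id] at hle
    omega
  refine ⟨W, fun x => if x ∈ W then f x - 1 else f x, hWw, fun x => ?_, fun x y hx => ?_⟩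
  · by_cases h : x ∈ W
    · have := hWpos x h
      simp only [h, if_true]
      omega
    · simp [h]
  · by_cases hxW : x ∈ W
    · have h1 := hWpos x hxW
      by_cases hyW : y ∈ W
      · have := hWtop x hxW y
        simp only [hxW, hyW, if_true]
        omega
      · have := hW x hxW y (Finset.mem_univ y) hyW
        simp only [hxW, hyW, if_true, if_false]
        omega
    · simp only [hxW, if_false] at hx ⊢
      have := hinv x y hx
      split_ifs <;> omega

/-- Lowering `d` successively on sets of prescribed sizes `w 0, …, w (k - 1)`. -/
lemma exists_lower_steps {V : Type*} [Fintype V] {d : V → ℕ} {C : Finset V} {m : ℕ} {w : ℕ → ℕ}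
    (hdm : ∀ x, d x ≤ m) (hC : ∀ x ∈ C, d x = m) (k : ℕ) (hw : ∀ i < k, w i ≤ #C)
    (hsum : ∑ i ∈ range k, w i ≤ ∑ x, d x) :
    ∃ (W : ℕ → Finset V) (f : V → ℕ), (∀ i < k, #(W i) = w i) ∧
      (∀ x, d x = f x + #{i ∈ range k | x ∈ W i}) ∧
      (∑ x, d x = ∑ x, f x + ∑ i ∈ range k, w i) ∧ ∀ x y, f x < d x → f y ≤ f x + 1 := by
  induction k with
  | zero => exact ⟨fun _ => ∅, d, by simp, by simp, by simp, fun x y h => absurd h (lt_irrefl _)⟩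
  | succ k ih =>
    rw [Finset.sum_range_succ] at hsum
    obtain ⟨W, f, hWw, hdf, hds, hinv⟩ := ih (fun i hi => hw i (by omega)) (by omega)
    obtain ⟨U, f', hU, hff', hinv'⟩ := exists_lower_step (w := w k)
      (fun x => by rw [hdf x]; omega) hdm hC hinv (hw k (by omega)) (by omega)
    have hne : ∀ i ∈ range k, Function.update W k U i = W i := fun i hi =>
      Function.update_of_ne (Finset.mem_range.1 hi).ne _ _
    refine ⟨Function.update W k U, f', ?_, ?_, ?_, hinv'⟩
    · intro i hi
      rcases Nat.lt_succ_iff_lt_or_eq.1 hi with h | rfl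
      · rw [hne i (Finset.mem_range.2 h), hWw i h]
      · rw [Function.update_self, hU]
    · intro x
      have hsame : ∑ i ∈ range k, (if x ∈ Function.update W k U i then 1 else 0) =
          ∑ i ∈ range k, (if x ∈ W i then 1 else 0) :=
        Finset.sum_congr rfl fun i hi => by rw [hne i hi]
      rw [hdf x, hff' x, Finset.card_filter, Finset.card_filter, Finset.sum_range_succ,
        Function.update_self, hsame]
      omega
    · rw [hds, Finset.sum_congr rfl fun x _ => hff' x, Finset.sum_add_distrib, Finset.sum_boole,
        Finset.filter_univ_mem, hU, Finset.sum_range_succ]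
      simp only [Nat.cast_id]
      omega

/-- If `f` arises from `d` by lowering near the top, and by a large enough amount, then `f` is a
degree function. -/
lemma exists_hasDegrees_of_lowered {V : Type*} [Fintype V] {d f : V → ℕ} {C : Finset V} {m : ℕ}
    (hCne : C.Nonempty) (hfd : ∀ x, f x ≤ d x) (hdm : ∀ x, d x ≤ m) (hC : ∀ x ∈ C, d x = m)
    (hinv : ∀ x y, f x < d x → f y ≤ f x + 1) (heven : Even (∑ x, f x))
    (hT : ∀ s, #C ≤ s → s ≤ m → ∑ x, f x + s * (m + 1 - s) ≤ ∑ x, d x) :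
    ∃ G : SimpleGraph V, HasDegrees G f := by
  obtain ⟨c, -⟩ := hCne
  obtain ⟨v, -, hv⟩ := Finset.exists_max_image univ f ⟨c, Finset.mem_univ c⟩
  set S : Finset V := {x | f v ≤ f x + 1} with hS
  have hmemS : ∀ x, x ∈ S ↔ f v ≤ f x + 1 := by simp [hS]
  have hvm : f v ≤ m := (hfd v).trans (hdm v)
  by_cases hcard : f v + 1 ≤ #S
  · exact exists_hasDegrees_of_flat _ f (f v) le_rfl (fun x => hv x (Finset.mem_univ x)) hcard heven
  exfalso
  have hCS : C ⊆ S := by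
    intro x hx
    rw [hmemS]
    rcases (hfd x).lt_or_eq with h | h
    · exact hinv x v h
    · have := hC x hx
      omega
  have h1 := hT #S (Finset.card_le_card hCS) (by omega)
  have h2 : ∑ x, (d x + if x = v then 1 else 0) ≤
      ∑ x, (f x + if x ∈ S then m + 1 - f v else 0) := by
    refine Finset.sum_le_sum fun x _ => ?_
    have hx1 := hdm x
    by_cases hxv : x = v
    · subst hxv
      have : x ∈ S := by rw [hmemS]; omega
      simp only [this, if_true]
      omega
    · by_cases hxS : x ∈ S
      · have := (hmemS x).1 hxS
        simp only [hxv, hxS, if_true, if_false]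
        omega
      · have hlt := mt (hmemS x).2 hxS
        have : d x ≤ f x := by
          by_contra h
          exact hlt (hinv x v (by omega))
        simp only [hxv, hxS, if_false]
        omega
  have hs : ∑ x, (if x ∈ S then m + 1 - f v else 0) = #S * (m + 1 - f v) := by
    rw [← Finset.sum_filter, Finset.filter_univ_mem, Finset.sum_const, smul_eq_mul]
  rw [Finset.sum_add_distrib, Finset.sum_add_distrib, hs] at h2
  simp only [Finset.sum_ite_eq', Finset.mem_univ, if_true] at h2
  have h3 : #S * (m + 1 - f v) ≤ #S * (m + 1 - #S) := Nat.mul_le_mul_left _ (by omega)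
  omega

lemma HasDegrees.even_sum {V : Type*} [Fintype V] {G : SimpleGraph V} {d : V → ℕ}
    (hG : HasDegrees G d) : Even (∑ x, d x) := by
  have h := G.sum_degrees_eq_twice_card_edges
  rw [Finset.sum_congr rfl fun x _ => (hG x).symm]
  refine ⟨#G.edgeFinset, ?_⟩
  rw [← two_mul, ← h]
  refine Finset.sum_congr rfl fun x _ => ?_
  rw [← G.card_neighborFinset_eq_degree, G.neighborFinset_eq_filter]

/-- The degrees in a set `P` are bounded by the edges inside `P` and the degrees outside. -/
lemma HasDegrees.sum_le {V : Type*} [Fintype V] {G : SimpleGraph V} {d : V → ℕ}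
    (hG : HasDegrees G d) (P : Finset V) :
    ∑ x ∈ P, d x ≤ #P * (#P - 1) + ∑ x ∈ Pᶜ, d x := by
  have hin : ∀ x ∈ P, d x ≤ (#P - 1) + #{y ∈ Pᶜ | G.Adj x y} := by
    intro x hx
    rw [← hG x, ← Finset.card_erase_of_mem hx]
    refine (Finset.card_le_card fun y hy => ?_).trans (Finset.card_union_le _ _)
    have hxy : G.Adj x y := by simpa using hy
    by_cases hyP : y ∈ P
    · exact Finset.mem_union_left _ (Finset.mem_erase.2 ⟨hxy.ne', hyP⟩)
    · exact Finset.mem_union_right _ (by simp [hyP, hxy])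
  have hswap : ∑ x ∈ P, #{y ∈ Pᶜ | G.Adj x y} = ∑ y ∈ Pᶜ, #{x ∈ P | G.Adj y x} := by
    simp only [Finset.card_filter]
    rw [Finset.sum_comm]
    simp only [G.adj_comm]
  calc ∑ x ∈ P, d x ≤ ∑ x ∈ P, ((#P - 1) + #{y ∈ Pᶜ | G.Adj x y}) := Finset.sum_le_sum hin
    _ = #P * (#P - 1) + ∑ y ∈ Pᶜ, #{x ∈ P | G.Adj y x} := by
      rw [Finset.sum_add_distrib, Finset.sum_const, smul_eq_mul, hswap]
    _ ≤ _ := by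
      gcongr with y _
      rw [← hG y]
      exact Finset.card_le_card (Finset.filter_subset_filter _ (Finset.subset_univ P))

/-- Adding a copy `a` of a graph `L` on `range k` to `F`, joining `a i` to the vertices of `W i`. -/
lemma exists_hasDegrees_attach {V : Type*} [Fintype V] {F : SimpleGraph V} {d f : V → ℕ}
    (hF : HasDegrees F f) (k : ℕ) (L : SimpleGraph ℕ) {a : ℕ → V} {W : ℕ → Finset V}
    (hinj : ∀ i < k, ∀ j < k, a i = a j → i = j) (hfa : ∀ i < k, f (a i) = 0)
    (hWa : ∀ i < k, ∀ j < k, a i ∉ W j)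
    (hda : ∀ i < k, d (a i) = #(W i) + #{j ∈ range k | L.Adj i j})
    (hd : ∀ x, (∀ i < k, x ≠ a i) → d x = f x + #{i ∈ range k | x ∈ W i}) :
    ∃ G : SimpleGraph V, HasDegrees G d ∧ ∀ i < k, ∀ j < k, L.Adj i j → G.Adj (a i) (a j) := by
  obtain ⟨G, hadj⟩ : ∃ G : SimpleGraph V, ∀ x y, G.Adj x y ↔ F.Adj x y ∨
      (∃ i < k, x = a i ∧ y ∈ W i) ∨ (∃ i < k, y = a i ∧ x ∈ W i) ∨
      ∃ i < k, ∃ j < k, L.Adj i j ∧ x = a i ∧ y = a j := by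
    refine ⟨⟨_, ⟨?_⟩, ⟨?_⟩⟩, fun a b => Iff.rfl⟩
    · rintro x y (h | h | h | ⟨i, hi, j, hj, hij, hx, hy⟩)
      · exact Or.inl h.symm
      · exact Or.inr (Or.inr (Or.inl h))
      · exact Or.inr (Or.inl h)
      · exact Or.inr (Or.inr (Or.inr ⟨j, hj, i, hi, hij.symm, hy, hx⟩))
    · rintro x (h | ⟨i, hi, rfl, h⟩ | ⟨i, hi, rfl, h⟩ | ⟨i, hi, j, hj, hij, rfl, hy⟩)
      · exact F.loopless.irrefl x h
      · exact hWa i hi i hi h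
      · exact hWa i hi i hi h
      · exact hij.ne (hinj i hi j hj hy)
  have hFa : ∀ i < k, ∀ y, ¬ F.Adj (a i) y := by
    intro i hi y h
    have h0 := hF (a i)
    rw [hfa i hi, Finset.card_eq_zero, Finset.filter_eq_empty_iff] at h0
    exact h0 (Finset.mem_univ y) h
  refine ⟨G, fun x => ?_, fun i hi j hj hij =>
    (hadj _ _).2 (Or.inr (Or.inr (Or.inr ⟨i, hi, j, hj, hij, rfl, rfl⟩)))⟩
  by_cases hx : ∃ i < k, x = a i
  · obtain ⟨i, hi, rfl⟩ := hx
    have hN : ({y | G.Adj (a i) y} : Finset V) = W i ∪ {j ∈ range k | L.Adj i j}.image a := by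
      ext y
      simp only [Finset.mem_filter, Finset.mem_univ, true_and, Finset.mem_union, Finset.mem_image,
        Finset.mem_range, hadj]
      constructor
      · rintro (h | ⟨j, hj, hij, h⟩ | ⟨j, hj, rfl, h⟩ | ⟨i', hi', j, hj, hij, hx, rfl⟩)
        · exact absurd h (hFa i hi y)
        · rw [hinj i hi j hj hij]
          exact Or.inl h
        · exact absurd h (hWa i hi j hj)
        · rw [hinj i hi i' hi' hx]
          exact Or.inr ⟨j, ⟨hj, hij⟩, rfl⟩
      · rintro (h | ⟨j, ⟨hj, hij⟩, rfl⟩)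
        · exact Or.inr (Or.inl ⟨i, hi, rfl, h⟩)
        · exact Or.inr (Or.inr (Or.inr ⟨i, hi, j, hj, hij, rfl, rfl⟩))
    rw [hN, Finset.card_union_of_disjoint, Finset.card_image_of_injOn, hda i hi]
    · intro j hj j' hj' h
      simp only [Finset.coe_filter, Finset.mem_range, Set.mem_ofPred_eq] at hj hj'
      exact hinj j hj.1 j' hj'.1 h
    · rw [Finset.disjoint_right]
      intro y hy
      simp only [Finset.mem_image, Finset.mem_filter, Finset.mem_range] at hy
      obtain ⟨j, ⟨hj, -⟩, rfl⟩ := hy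
      exact hWa j hj i hi
  · have hx' : ∀ i < k, x ≠ a i := fun i hi h => hx ⟨i, hi, h⟩
    have hN : ({y | G.Adj x y} : Finset V) =
        ({y | F.Adj x y} : Finset V) ∪ {i ∈ range k | x ∈ W i}.image a := by
      ext y
      simp only [Finset.mem_filter, Finset.mem_univ, true_and, Finset.mem_union, Finset.mem_image,
        Finset.mem_range, hadj]
      constructor
      · rintro (h | ⟨j, hj, hij, h⟩ | ⟨j, hj, rfl, h⟩ | ⟨i', hi', j, hj, hij, h, rfl⟩)
        · exact Or.inl h
        · exact absurd hij (hx' j hj)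
        · exact Or.inr ⟨j, ⟨hj, h⟩, rfl⟩
        · exact absurd h (hx' i' hi')
      · rintro (h | ⟨j, ⟨hj, h⟩, rfl⟩)
        · exact Or.inl h
        · exact Or.inr (Or.inr (Or.inl ⟨j, hj, rfl, h⟩))
    rw [hN, Finset.card_union_of_disjoint, Finset.card_image_of_injOn, hd x hx', hF x]
    · intro j hj j' hj' h
      simp only [Finset.coe_filter, Finset.mem_range, Set.mem_ofPred_eq] at hj hj'
      exact hinj j hj.1 j' hj'.1 h
    · rw [Finset.disjoint_right]
      intro y hy
      simp only [Finset.mem_image, Finset.mem_filter, Finset.mem_range] at hy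
      obtain ⟨j, ⟨hj, -⟩, rfl⟩ := hy
      simp only [Finset.mem_filter, Finset.mem_univ, true_and]
      exact fun h => hFa j hj x h.symm

/-- The degrees in the graph on `range (q + 3)` missing only the edge between `q + 1` and
`q + 2`. -/
lemma card_filter_ne_and_le_or_le {q i : ℕ} (hi : i < q + 3) :
    #{j ∈ range (q + 3) | i ≠ j ∧ (i ≤ q ∨ j ≤ q)} = if i ≤ q then q + 2 else q + 1 := by
  split_ifs with h
  · have : {j ∈ range (q + 3) | i ≠ j ∧ (i ≤ q ∨ j ≤ q)} = (range (q + 3)).erase i := by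
      ext j
      simp only [Finset.mem_filter, Finset.mem_range, Finset.mem_erase]
      omega
    rw [this, Finset.card_erase_of_mem (Finset.mem_range.2 hi), Finset.card_range]
    omega
  · have : {j ∈ range (q + 3) | i ≠ j ∧ (i ≤ q ∨ j ≤ q)} = range (q + 1) := by
      ext j
      simp only [Finset.mem_filter, Finset.mem_range]
      omega
    rw [this, Finset.card_range]

/-- The case where many vertices outside of `a 0, …, a (q + 2)` share the degree `d (a (q + 2))`. -/
lemma exists_hasDegrees_of_large_level {V : Type*} [Fintype V] {G : SimpleGraph V} {d : V → ℕ}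
    (hG : HasDegrees G d) (q : ℕ) {a : ℕ → V} {C : Finset V}
    (hinj : ∀ i < q + 3, ∀ j < q + 3, a i = a j → i = j)
    (hanti : ∀ i j, i ≤ j → j < q + 3 → d (a j) ≤ d (a i))
    (hout : ∀ x, (∀ i < q + 3, x ≠ a i) → d x ≤ d (a (q + 2)))
    (h0 : 2 * q + 3 ≤ d (a 0)) (h1 : q + 2 ≤ d (a q)) (h2 : q + 1 ≤ d (a (q + 2)))
    (hCa : ∀ x ∈ C, ∀ i < q + 3, x ≠ a i) (hCm : ∀ x ∈ C, d x = d (a (q + 2)))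
    (hC : d (a 0) ≤ #C + q + 1) :
    ∃ G' : SimpleGraph V, HasDegrees G' d ∧
      ∀ i < q + 3, ∀ j < q + 3, i ≠ j → (i ≤ q ∨ j ≤ q) → G'.Adj (a i) (a j) := by
  obtain ⟨m, hm⟩ : ∃ m, m = d (a (q + 2)) := ⟨_, rfl⟩
  rw [← hm] at h2
  obtain ⟨A, hA⟩ : ∃ A, A = (range (q + 3)).image a := ⟨_, rfl⟩
  have hinjOn : ∀ k ≤ q + 3, Set.InjOn a (range k) := fun k hk i hi j hj h => by
    simp only [Finset.coe_range, Set.mem_Iio] at hi hj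
    exact hinj i (by omega) j (by omega) h
  have hmemA : ∀ x, x ∈ A ↔ ∃ i < q + 3, x = a i := by
    intro x
    simp only [hA, Finset.mem_image, Finset.mem_range]
    exact ⟨fun ⟨i, h, e⟩ => ⟨i, h, e.symm⟩, fun ⟨i, h, e⟩ => ⟨i, h, e.symm⟩⟩
  have haA : ∀ i < q + 3, a i ∈ A := fun i hi => (hmemA _).2 ⟨i, hi, rfl⟩
  have hnotA : ∀ x, x ∉ A → ∀ i < q + 3, x ≠ a i := fun x hx i hi h => hx (h ▸ haA i hi)
  have hCA : ∀ x ∈ C, x ∉ A := fun x hx h => by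
    obtain ⟨i, hi, e⟩ := (hmemA x).1 h
    exact hCa x hx i hi e
  obtain ⟨dB, hdBA, hdB⟩ : ∃ dB : V → ℕ, (∀ x ∈ A, dB x = 0) ∧ ∀ x, x ∉ A → dB x = d x :=
    ⟨fun x => if x ∈ A then 0 else d x, fun x hx => if_pos hx, fun x hx => if_neg hx⟩
  have hdBm : ∀ x, dB x ≤ m := fun x => by
    by_cases hx : x ∈ A
    · rw [hdBA x hx]; omega
    · rw [hdB x hx, hm]
      exact hout x (hnotA x hx)
  have hCB : ∀ x ∈ C, dB x = m := fun x hx => by rw [hdB x (hCA x hx), hm, hCm x hx]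
  have hsplit : ∑ x, d x = ∑ i ∈ range (q + 3), d (a i) + ∑ x, dB x := by
    rw [← Finset.sum_image (hinjOn _ le_rfl), ← hA, ← Finset.sum_add_sum_compl A d,
      ← Finset.sum_add_sum_compl A dB, Finset.sum_eq_zero hdBA, zero_add]
    congr 1
    exact Finset.sum_congr rfl fun x hx => (hdB x (Finset.mem_compl.1 hx)).symm
  have hCsum : #C * m ≤ ∑ x, dB x := by
    rw [← smul_eq_mul, ← Finset.sum_const]
    calc ∑ _x ∈ C, m = ∑ x ∈ C, dB x := Finset.sum_congr rfl fun x hx => (hCB x hx).symm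
      _ ≤ _ := Finset.sum_le_sum_of_subset (Finset.subset_univ C)
  obtain ⟨w, hw⟩ : ∃ w : ℕ → ℕ,
      ∀ i < q + 3, d (a i) = w i + if i ≤ q then q + 2 else q + 1 := by
    refine ⟨fun i => d (a i) - if i ≤ q then q + 2 else q + 1, fun i hi => ?_⟩
    have h3 := hanti i (q + 2) (by omega) (by omega)
    beta_reduce
    split_ifs with h
    · have := hanti i q h (by omega)
      omega
    · omega
  have hwq : ∀ i ≤ q, w i + 1 ≤ #C := fun i hi => by
    have h3 := hw i (by omega)
    rw [if_pos hi] at h3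
    have := hanti 0 i (by omega) (by omega)
    omega
  have hwC : ∀ i < q + 3, w i ≤ #C := fun i hi => by
    have h3 := hw i hi
    have := hanti 0 i (by omega) (by omega)
    split_ifs at h3 <;> omega
  have hwlast : m = w (q + 2) + (q + 1) := by
    rw [hm, hw (q + 2) (by omega), if_neg (by omega)]
  have hdsum : ∑ i ∈ range (q + 3), d (a i) = ∑ i ∈ range (q + 3), w i + (q + 1) * (q + 4) := by
    rw [Finset.sum_congr rfl fun i hi => hw i (Finset.mem_range.1 hi), Finset.sum_add_distrib]
    congr 1
    rw [Finset.sum_range_succ, Finset.sum_range_succ, if_neg (by omega), if_neg (by omega),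
      Finset.sum_congr rfl fun i hi => if_pos (by have := Finset.mem_range.1 hi; omega),
      Finset.sum_const, Finset.card_range, smul_eq_mul]
    ring
  have hwhead : ∑ i ∈ range (q + 1), w i ≤ (q + 1) * (#C - 1) := by
    have := Finset.sum_le_card_nsmul (range (q + 1)) w (#C - 1) fun i hi => by
      have := Finset.mem_range.1 hi
      have := hwq i (by omega)
      omega
    simpa using this
  have hc1 : q + 2 ≤ #C := by omega
  have hwsum : ∑ i ∈ range (q + 3), w i ≤ ∑ x, dB x := by
    rcases Nat.lt_or_ge m (q + 2) with hlt | hge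
    · have hP := hG.sum_le ((range (q + 2)).image a)
      have hP2 := Finset.sum_add_sum_compl ((range (q + 2)).image a) d
      rw [Finset.card_image_of_injOn (hinjOn _ (by omega)), Finset.card_range,
        Finset.sum_image (hinjOn _ (by omega))] at hP
      rw [Finset.sum_image (hinjOn _ (by omega)), hsplit] at hP2
      have hs : ∑ i ∈ range (q + 3), d (a i) = ∑ i ∈ range (q + 2), d (a i) + m := by
        rw [Finset.sum_range_succ, hm]
      have e1 : (q + 2) * (q + 2 - 1) = q * q + 3 * q + 2 := by
        rw [show q + 2 - 1 = q + 1 by omega]; ring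
      have e2 : (q + 1) * (q + 4) = q * q + 5 * q + 4 := by ring
      omega
    · rw [Finset.sum_range_succ, Finset.sum_range_succ]
      have h3 := hwC (q + 1) (by omega)
      have h4 := hwC (q + 2) (by omega)
      obtain ⟨c, hc⟩ : ∃ c, #C = c + 1 := ⟨#C - 1, by omega⟩
      rw [hc] at hwhead hCsum h3 h4
      rw [Nat.add_sub_cancel] at hwhead
      rcases Nat.lt_or_ge m (q + 3) with hlt | hge'
      · have : m = q + 2 := by omega
        subst this
        nlinarith
      · have : (c + 1) * (q + 3) ≤ (c + 1) * m := Nat.mul_le_mul_left _ hge'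
        nlinarith
  obtain ⟨W, f, hWw, hdf, hds, hinv⟩ := exists_lower_steps hdBm hCB (q + 3) hwC hwsum
  have heven : Even (∑ x, f x) := by
    have h3 := hG.even_sum
    have h4 : Even ((q + 1) * (q + 4)) := by
      rcases Nat.even_or_odd q with h | h
      · exact (h.add (by decide)).mul_left _
      · exact (h.add_odd (by decide)).mul_right _
    rw [hsplit, hdsum, hds] at h3
    rw [Nat.even_iff] at *
    omega
  have hfB : ∀ x, f x ≤ dB x := fun x => by rw [hdf x]; omega
  obtain ⟨F, hF⟩ := exists_hasDegrees_of_lowered (Finset.card_pos.1 (by omega)) hfB hdBm hCB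
    hinv heven (by
      intro s hs hsm
      rw [hds]
      have h3 : 2 * q + 3 + (q + 2) * m ≤ ∑ i ∈ range (q + 3), d (a i) := by
        rw [Finset.sum_range_succ']
        have := Finset.card_nsmul_le_sum (range (q + 2)) (fun i => d (a (i + 1))) m fun i hi => by
          have := Finset.mem_range.1 hi
          rw [hm]
          exact hanti _ _ (by omega) (by omega)
        rw [Finset.card_range, smul_eq_mul] at this
        omega
      rw [hdsum] at h3
      obtain ⟨t, ht⟩ : ∃ t, m = s + t := ⟨m - s, by omega⟩
      obtain ⟨u, hu⟩ : ∃ u, s = q + 2 + u := ⟨s - (q + 2), by omega⟩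
      have hmle : m ≤ d (a 0) := hm ▸ hanti 0 _ (by omega) (by omega)
      have htq : t ≤ q + 1 := by omega
      obtain ⟨p, hp⟩ : ∃ p, q + 1 = t + p := ⟨q + 1 - t, by omega⟩
      rw [ht, show s + t + 1 - s = t + 1 by omega]
      rw [ht, hu] at h3
      rw [hu]
      nlinarith [Nat.zero_le (u * p)])
  have hzero : ∀ i < q + 3, f (a i) = 0 ∧ ∀ j < q + 3, a i ∉ W j := by
    intro i hi
    have h3 := hdf (a i)
    rw [hdBA _ (haA i hi)] at h3
    refine ⟨by omega, fun j hj h => ?_⟩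
    have h4 : #{j ∈ range (q + 3) | a i ∈ W j} = 0 := by omega
    rw [Finset.card_eq_zero, Finset.filter_eq_empty_iff] at h4
    exact h4 (Finset.mem_range.2 hj) h
  obtain ⟨L, hL⟩ : ∃ L : SimpleGraph ℕ, ∀ i j, L.Adj i j ↔ i ≠ j ∧ (i ≤ q ∨ j ≤ q) := by
    refine ⟨⟨_, ⟨?_⟩, ⟨?_⟩⟩, fun a b => Iff.rfl⟩
    · exact fun i j h => ⟨h.1.symm, h.2.symm⟩
    · exact fun i h => h.1 rfl
  obtain ⟨G', hG', hadj⟩ := exists_hasDegrees_attach (d := d) hF (q + 3) L hinj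
    (fun i hi => (hzero i hi).1) (fun i hi => (hzero i hi).2)
    (fun i hi => by
      rw [hWw i hi, hw i hi, ← card_filter_ne_and_le_or_le hi]
      simp only [hL])
    (fun x hx => by
      rw [← hdf x, hdB x fun h => ?_]
      obtain ⟨i, hi, e⟩ := (hmemA x).1 h
      exact hx i hi e)
  exact ⟨G', hG', fun i hi j hj h h' => hadj i hi j hj ((hL i j).2 ⟨h, h'⟩)⟩

/-- A vertex `a 0` of degree at least `q + 2` can be joined to the vertices `a 1, …, a (q + 2)` of
largest degree, with its neighbors dominating the other vertices. -/
lemma exists_hasDegrees_dominating {V : Type*} [Fintype V] {G : SimpleGraph V} {d : V → ℕ}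
    (hG : HasDegrees G d) (q : ℕ) {a : ℕ → V}
    (hinj : ∀ i < q + 3, ∀ j < q + 3, a i = a j → i = j)
    (hanti : ∀ i j, i ≤ j → j < q + 3 → d (a j) ≤ d (a i))
    (hout : ∀ x, (∀ i < q + 3, x ≠ a i) → d x ≤ d (a (q + 2))) (h0 : q + 2 ≤ d (a 0)) :
    ∃ H : SimpleGraph V, HasDegrees H d ∧ (∀ j < q + 3, 0 < j → H.Adj (a 0) (a j)) ∧
      ∀ x y, H.Adj (a 0) x → ¬ H.Adj (a 0) y → y ≠ a 0 → d y ≤ d x := by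
  obtain ⟨w, hwA, hwn⟩ : ∃ w : V → ℕ, (∀ i < q + 3, w (a i) = 2 * d (a i) + 1) ∧
      ∀ x, (∀ i < q + 3, x ≠ a i) → w x = 2 * d x :=
    ⟨fun x => if ∃ i < q + 3, x = a i then 2 * d x + 1 else 2 * d x,
      fun i hi => if_pos ⟨i, hi, rfl⟩, fun x hx => if_neg fun ⟨i, hi, h⟩ => hx i hi h⟩
  have hw : ∀ x, 2 * d x ≤ w x ∧ w x ≤ 2 * d x + 1 := by
    intro x
    by_cases hx : ∃ i < q + 3, x = a i
    · obtain ⟨i, hi, rfl⟩ := hx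
      rw [hwA i hi]
      omega
    · rw [hwn x fun i hi h => hx ⟨i, hi, h⟩]
      omega
  obtain ⟨H, hH, hdom⟩ := exists_hasDegrees_top_neighbors hG (a 0) w fun x y hxy => by
    have := hw x
    have := hw y
    omega
  refine ⟨H, hH, fun j hj hj0 => ?_, fun x y hx hy hya => ?_⟩
  · by_contra hnot
    have hne : a j ≠ a 0 := fun h => hj0.ne' (hinj j hj 0 (by omega) h)
    have hsub : ({u | H.Adj (a 0) u} : Finset V) ⊆ (((range (q + 3)).erase 0).erase j).image a := by
      intro x hx
      have hx : H.Adj (a 0) x := by simpa using hx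
      have h1 := hdom x (a j) hx hnot hne
      rw [hwA j hj] at h1
      have hxA : ∃ i < q + 3, x = a i := by
        by_contra h
        have h' : ∀ i < q + 3, x ≠ a i := fun i hi e => h ⟨i, hi, e⟩
        rw [hwn x h'] at h1
        have := hout x h'
        have := hanti j (q + 2) (by omega) (by omega)
        omega
      obtain ⟨i, hi, rfl⟩ := hxA
      refine Finset.mem_image_of_mem a ?_
      simp only [Finset.mem_erase, Finset.mem_range]
      refine ⟨?_, ?_, hi⟩
      · rintro rfl
        exact hnot hx
      · rintro rfl
        exact H.loopless.irrefl _ hx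
    have hcard := (Finset.card_le_card hsub).trans Finset.card_image_le
    rw [hH (a 0), Finset.card_erase_of_mem (by simp; omega), Finset.card_erase_of_mem (by simp),
      Finset.card_range] at hcard
    omega
  · have := hdom x y hx hy hya
    have := hw x
    have := hw y
    omega

/-- Deleting the edges at `v` lowers the degrees of its neighbors by one. -/
lemma HasDegrees.exists_delete {V : Type*} [Fintype V] {H : SimpleGraph V} {d d' : V → ℕ}
    (hH : HasDegrees H d) (v : V) (hv : d' v = 0) (hadj : ∀ x, H.Adj v x → d x = d' x + 1)
    (hnot : ∀ x, x ≠ v → ¬ H.Adj v x → d' x = d x) : ∃ G : SimpleGraph V, HasDegrees G d' := by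
  obtain ⟨G, hG⟩ : ∃ G : SimpleGraph V, ∀ x y, G.Adj x y ↔ H.Adj x y ∧ x ≠ v ∧ y ≠ v := by
    refine ⟨⟨_, ⟨?_⟩, ⟨?_⟩⟩, fun a b => Iff.rfl⟩
    · exact fun x y h => ⟨h.1.symm, h.2.2, h.2.1⟩
    · exact fun x h => H.loopless.irrefl x h.1
  refine ⟨G, fun x => ?_⟩
  by_cases hx : x = v
  · rw [hx, hv, Finset.card_eq_zero, Finset.filter_eq_empty_iff]
    exact fun y _ h => ((hG v y).1 h).2.1 rfl
  have hN : ({y | G.Adj x y} : Finset V) = ({y | H.Adj x y} : Finset V).erase v := by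
    ext y
    simp only [Finset.mem_filter, Finset.mem_univ, true_and, Finset.mem_erase, hG]
    exact ⟨fun h => ⟨h.2.2, h.1⟩, fun h => ⟨h.2, hx, h.1⟩⟩
  rw [hN]
  by_cases h : H.Adj v x
  · rw [Finset.card_erase_of_mem (by simpa using h.symm), hH x, hadj x h]
    omega
  · rw [Finset.erase_eq_of_notMem (by simpa using fun h' => h (H.symm.symm _ _ h')), hH x,
      hnot x hx h]

/-- If `a 0, …, a (q + 2)` are vertices of largest degrees, and these degrees are large enough, then
there is a graph with the same degrees in which `a 0, …, a (q + 2)` form a clique, up to the edge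
between `a (q + 1)` and `a (q + 2)`. -/
theorem exists_hasDegrees_almost_clique {V : Type*} [Fintype V] (q : ℕ) :
    ∀ {G : SimpleGraph V} {d : V → ℕ} {a : ℕ → V}, HasDegrees G d →
    (∀ i < q + 3, ∀ j < q + 3, a i = a j → i = j) →
    (∀ i j, i ≤ j → j < q + 3 → d (a j) ≤ d (a i)) →
    (∀ x, (∀ i < q + 3, x ≠ a i) → d x ≤ d (a (q + 2))) →
    q + 2 ≤ d (a q) → q + 1 ≤ d (a (q + 2)) → (∀ i < q, 2 * q + 3 ≤ d (a i) + i) →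
    ∃ G' : SimpleGraph V, HasDegrees G' d ∧
      ∀ i < q + 3, ∀ j < q + 3, i ≠ j → (i ≤ q ∨ j ≤ q) → G'.Adj (a i) (a j) := by
  induction q with
  | zero =>
    intro G d a hG hinj hanti hout h1 h2 h3
    obtain ⟨H, hH, hadj, -⟩ := exists_hasDegrees_dominating hG 0 hinj hanti hout h1
    refine ⟨H, hH, fun i hi j hj hij h => ?_⟩
    rcases h with h | h
    · obtain rfl : i = 0 := by omega
      exact hadj j hj (by omega)
    · obtain rfl : j = 0 := by omega
      exact (hadj i hi (by omega)).symm
  | succ q ih =>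
    intro G d a hG hinj hanti hout h1 h2 h3
    have h30 := h3 0 (by omega)
    obtain ⟨H, hH, hadj, hdom⟩ :=
      exists_hasDegrees_dominating hG (q + 1) hinj hanti hout (by omega)
    by_cases hy : ∃ y, (∀ i < q + 1 + 3, y ≠ a i) ∧ ¬ H.Adj (a 0) y ∧ d y = d (a (q + 1 + 2))
    · obtain ⟨y, hyA, hy0, hyd⟩ := hy
      have hmem : ∀ x,
          x ∈ insert y (({u | H.Adj (a 0) u} : Finset V) \ (range (q + 1 + 3)).image a) ↔
          x = y ∨ H.Adj (a 0) x ∧ ∀ i < q + 1 + 3, x ≠ a i := by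
        intro x
        simp only [Finset.mem_insert, Finset.mem_sdiff, Finset.mem_filter, Finset.mem_univ,
          true_and, Finset.mem_image, Finset.mem_range, not_exists, not_and]
        simp only [ne_comm (a := x), ne_eq]
      refine exists_hasDegrees_of_large_level hH (q + 1)
        (C := insert y (({u | H.Adj (a 0) u} : Finset V) \ (range (q + 1 + 3)).image a))
        hinj hanti hout (by omega) h1 h2 ?_ ?_ ?_
      · intro x hx
        rcases (hmem x).1 hx with rfl | h
        · exact hyA
        · exact h.2
      · intro x hx
        rcases (hmem x).1 hx with rfl | h
        · exact hyd
        · exact le_antisymm (hout x h.2) (hyd ▸ hdom x y h.1 hy0 (hyA 0 (by omega)))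
      · rw [Finset.card_insert_of_notMem (by simp [hy0]), ← hH (a 0)]
        have hle : #(({u | H.Adj (a 0) u} : Finset V) ∩ (range (q + 1 + 3)).image a) ≤ q + 3 := by
          have hsub : ({u | H.Adj (a 0) u} : Finset V) ∩ (range (q + 1 + 3)).image a ⊆
              ((range (q + 1 + 3)).erase 0).image a := by
            intro x hx
            simp only [Finset.mem_inter, Finset.mem_filter, Finset.mem_univ, true_and,
              Finset.mem_image, Finset.mem_range] at hx
            obtain ⟨hx, i, hi, rfl⟩ := hx
            refine Finset.mem_image_of_mem a (Finset.mem_erase.2 ⟨?_, Finset.mem_range.2 hi⟩)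
            rintro rfl
            exact H.loopless.irrefl _ hx
          have := (Finset.card_le_card hsub).trans Finset.card_image_le
          rw [Finset.card_erase_of_mem (by simp), Finset.card_range] at this
          omega
        have := Finset.card_sdiff_add_card_inter ({u | H.Adj (a 0) u} : Finset V)
          ((range (q + 1 + 3)).image a)
        omega
    · have hpos : ∀ x, H.Adj (a 0) x → 1 ≤ d x := fun x hx => by
        rw [← hH x, Nat.succ_le_iff, Finset.card_pos]
        exact ⟨a 0, by simpa using hx.symm⟩
      obtain ⟨d', h0', hadj', hnot'⟩ : ∃ d' : V → ℕ, d' (a 0) = 0 ∧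
          (∀ x, H.Adj (a 0) x → d x = d' x + 1) ∧
          ∀ x, x ≠ a 0 → ¬ H.Adj (a 0) x → d' x = d x := by
        refine ⟨fun x => if x = a 0 then 0 else if H.Adj (a 0) x then d x - 1 else d x,
          if_pos rfl, fun x hx => ?_, fun x hx hn => by simp only [hx, hn, if_false]⟩
        have := hpos x hx
        simp only [hx.ne', hx, if_true, if_false]
        omega
      have hda : ∀ i < q + 3, d (a (i + 1)) = d' (a (i + 1)) + 1 := fun i hi =>
        hadj' _ (hadj (i + 1) (by omega) (by omega))
      obtain ⟨G₁, hG₁⟩ := hH.exists_delete (a 0) h0' hadj' hnot'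
      have hlast := hda (q + 2) (by omega)
      obtain ⟨G₂, hG₂, hadj₂⟩ := ih (a := fun i => a (i + 1)) hG₁
        (fun i hi j hj h => by
          have := hinj (i + 1) (by omega) (j + 1) (by omega) h
          omega)
        (fun i j hij hj => by
          have := hanti (i + 1) (j + 1) (by omega) (by omega)
          have := hda i (by omega)
          have := hda j hj
          omega)
        (fun x hx => by
          by_cases hx0 : x = a 0
          · rw [hx0, h0']
            omega
          have hxA : ∀ i < q + 1 + 3, x ≠ a i := by
            intro i hi
            rcases i with _ | i
            · exact hx0
            · exact hx i (by omega)
          have hxm := hout x hxA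
          rw [show q + 1 + 2 = q + 2 + 1 by omega] at hxm hy
          by_cases hxadj : H.Adj (a 0) x
          · have := hadj' x hxadj
            omega
          · have hne : d x ≠ d (a (q + 2 + 1)) := fun e => hy ⟨x, hxA, hxadj, e⟩
            rw [hnot' x hx0 hxadj]
            omega)
        (by
          have := hda q (by omega)
          omega)
        (by
          rw [show q + 1 + 2 = q + 2 + 1 by omega] at h2
          omega)
        (fun i hi => by
          have := h3 (i + 1) (by omega)
          have := hda i (by omega)
          omega)
      obtain ⟨G₃, hG₃, hle, hstar⟩ := exists_hasDegrees_add_star (d := d) hG₂ (a 0)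
        ({u | H.Adj (a 0) u} : Finset V) (by simp) h0' (hH (a 0)).symm
        (fun x hx => hadj' x (by simpa using hx))
        (fun x hx hxn => (hnot' x hx (by simpa using hxn)).symm)
      have hstar' : ∀ j < q + 1 + 3, 0 < j → G₃.Adj (a 0) (a j) := fun j hj hj0 =>
        hstar _ (by simpa using hadj j hj hj0)
      refine ⟨G₃, hG₃, fun i hi j hj hij h => ?_⟩
      rcases i with _ | i
      · exact hstar' j hj (by omega)
      rcases j with _ | j
      · exact (hstar' _ hi (by omega)).symm
      · exact hle (hadj₂ i (by omega) j (by omega) (by omega) (by omega))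

/-- A realization in the sense of `IsRealization` has the prescribed degrees. -/
lemma isRealization_iff_hasDegrees {n : ℕ} {G : SimpleGraph (Fin n)} {d : Fin n → ℕ} :
    IsRealization G d ↔ HasDegrees G d := by
  refine forall_congr' fun v => ?_
  rw [← G.card_neighborFinset_eq_degree, G.neighborFinset_eq_filter]

/-- Lemma 3.1: let `r ≥ 2`, `n ≥ 2r` and `π = (d₁, ..., dₙ)` be an `n`-term graphic
sequence with `d_{r-1} ≥ r` and `d_{r+1} ≥ r - 1`. If `d_i ≥ 2r - i` for
`i = 1, 2, ..., r - 2`, then `π` is potentially `K_{r+1} - e`-graphic. -/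
theorem stmt4 (r n : ℕ) (hr : 2 ≤ r) (hn : 2 * r ≤ n)
    (d : Fin n → ℕ) (hgraphic : IsGraphic d)
    (h1 : r ≤ nth d (r - 1)) (h2 : r - 1 ≤ nth d (r + 1))
    (h3 : ∀ i : ℕ, 1 ≤ i → i ≤ r - 2 → 2 * r - i ≤ nth d i) :
    PotentiallyGraphic d (KsubH (r + 1) 2 (by omega) (⊤ : SimpleGraph (Fin 2))) := by
  obtain ⟨q, rfl⟩ : ∃ q, r = q + 2 := ⟨r - 2, by omega⟩
  obtain ⟨hmono, G, hG⟩ := hgraphic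
  obtain ⟨a, ha⟩ : ∃ a : ℕ → Fin n, ∀ i, i < n → (a i : ℕ) = i :=
    ⟨fun i => if h : i < n then ⟨i, h⟩ else ⟨0, by omega⟩, fun i hi => by simp only [hi, dif_pos]⟩
  have hnth : ∀ i, i < n → nth d (i + 1) = d (a i) := fun i hi => by
    have : a i = ⟨i, hi⟩ := Fin.ext (ha i hi)
    rw [this, nth, dif_pos (by omega : i + 1 - 1 < n)]
    rfl
  have hanti : ∀ i j, i ≤ j → j < q + 3 → d (a j) ≤ d (a i) := fun i j hij hj =>
    hmono (Fin.le_def.2 (by rw [ha i (by omega), ha j (by omega)]; exact hij))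
  have hinj : ∀ i < q + 3, ∀ j < q + 3, a i = a j → i = j := fun i hi j hj h => by
    rw [← ha i (by omega), ← ha j (by omega), h]
  obtain ⟨G', hG', hadj⟩ := exists_hasDegrees_almost_clique q
    (isRealization_iff_hasDegrees.1 hG) hinj hanti
    (fun x hx => hmono (Fin.le_def.2 (by
      rw [ha (q + 2) (by omega)]
      by_contra hlt
      exact hx x (by omega) (Fin.ext (ha x x.2).symm))))
    (by rw [← hnth q (by omega)]; exact h1)
    (by rw [← hnth (q + 2) (by omega)]; exact h2)
    (fun i hi => by
      have := h3 (i + 1) (by omega) (by omega)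
      rw [hnth i (by omega)] at this
      omega)
  refine ⟨G', isRealization_iff_hasDegrees.2 hG', ⟨fun k => a (q + 2 - k), fun k l h => ?_⟩,
    fun k l hkl => ?_⟩
  · have := hinj _ (by omega) _ (by omega) h
    have := k.2
    have := l.2
    exact Fin.ext (by omega)
  · rw [KsubH, SimpleGraph.sdiff_adj, SimpleGraph.top_adj] at hkl
    have hne : (k : ℕ) ≠ l := fun h => hkl.1 (Fin.ext h)
    have hk := k.2
    have hl := l.2
    refine hadj _ (by omega) _ (by omega) (by omega) ?_
    by_contra hlt
    refine hkl.2 ((SimpleGraph.map_adj _ _ _ _).2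
      ⟨⟨k, by omega⟩, ⟨l, by omega⟩, ?_, Fin.ext rfl, Fin.ext rfl⟩)
    exact fun h => hne (Fin.mk.inj h)
end
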